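/- (Macdonald identity, twisted case, not of type BC_l^{(2)}.) Let R_f be a reduced irreducible finite root system with two root lengths, highest root θ, highest short root θ_s, and t = I_f(θ,θ)/I_f(θ_s,θ_s) ∈ {2,3}. Let h be the Coxeter number of R_f (the order of a Coxeter element of W(R_f)) and h^∨_t = 1 + I_f(ρ_f, θ_s^∨) (the dual Coxeter number of the twisted affine root system X_l^{(t)}). Then for every real q with 0 < q < 1, (η(q)^{|Π_{f,s}|} · η(q^t)^{|Π_{f,l}|})^{h+1} = Σ_{γ ∈ h^∨_t · Q(R_f)} d(γ) · q^{(2/I_f(θ_s,θ_s)) · I_f(ρ_f + γ, ρ_f + γ)/(2 h^∨_t)}, and the series on the right-hand side converges absolutely. -/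

import Mathlib

open scoped BigOperators Classical

/-- A reduced irreducible finite root system spanning a real vector space `V`,
equipped with a positive definite symmetric bilinear form `I`. -/
structure RootSys (V : Type) [AddCommGroup V] [Module ℝ V] where
  I : V →ₗ[ℝ] V →ₗ[ℝ] ℝ
  symm : ∀ x y : V, I x y = I y x
  posdef : ∀ x : V, x ≠ 0 → 0 < I x x
  R : Finset V
  zero_notmem : (0 : V) ∉ R
  spanning : Submodule.span ℝ (R : Set V) = ⊤
  reduced : ∀ α ∈ R, ∀ c : ℝ, c • α ∈ R → c = 1 ∨ c = -1
  integral : ∀ α ∈ R, ∀ β ∈ R, ∃ n : ℤ, I ((2 / I α α) • α) β = (n : ℝ)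
  reflect : ∀ α ∈ R, ∀ β ∈ R, β - (I ((2 / I α α) • α) β) • α ∈ R
  irred : ∀ R₁ R₂ : Finset V, R₁ ∪ R₂ = R →
    (∀ α ∈ R₁, ∀ β ∈ R₂, I α β = 0) → R₁ = ∅ ∨ R₂ = ∅

/-- A choice of positive roots and simple roots for a finite root system. -/
structure Base {V : Type} [AddCommGroup V] [Module ℝ V] (S : RootSys V) where
  Pos : Finset V
  Pi : Finset V
  pos_sub : Pos ⊆ S.R
  mem_or_neg : ∀ α ∈ S.R, α ∈ Pos ∨ -α ∈ Pos
  not_both : ∀ α ∈ Pos, -α ∉ Pos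
  pi_sub : Pi ⊆ Pos
  indep : LinearIndependent ℝ (fun b : {x // x ∈ Pi} => (b : V))
  decomp : ∀ α ∈ Pos, ∃ c : V → ℕ, α = ∑ b ∈ Pi, (c b : ℝ) • b

/-- The Weyl vector: half the sum of the positive roots. -/
noncomputable def weylVec {V : Type} [AddCommGroup V] [Module ℝ V] {S : RootSys V}
    (B : Base S) : V := (2 : ℝ)⁻¹ • ∑ α ∈ B.Pos, α

/-- The root lattice `Q(R)`, generated by the roots. -/
noncomputable def rootLat {V : Type} [AddCommGroup V] [Module ℝ V] (S : RootSys V) :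
    AddSubgroup V := AddSubgroup.closure (S.R : Set V)

/-- The factor `d(λ) = ∏_{α ∈ R⁺} I(λ+ρ,α)/I(ρ,α)`. -/
noncomputable def dFun {V : Type} [AddCommGroup V] [Module ℝ V] {S : RootSys V}
    (B : Base S) (lam : V) : ℝ :=
  ∏ α ∈ B.Pos, (S.I (lam + weylVec B) α / S.I (weylVec B) α)

/-- The Dedekind eta function, `η(q) = q^{1/24} ∏_{n=1}^∞ (1 - qⁿ)`, for real `0 < q < 1`. -/
noncomputable def eta (q : ℝ) : ℝ := q ^ ((1 : ℝ) / 24) * ∏' n : ℕ, (1 - q ^ (n + 1))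

namespace RootSys

section Basic

variable {V : Type} [AddCommGroup V] [Module ℝ V] (S : RootSys V)

/-- The linear form `x ↦ I(x, α^∨)`. -/
noncomputable def co (α : V) : V →ₗ[ℝ] ℝ := (2 / S.I α α) • S.I α

lemma co_apply (α x : V) : S.co α x = 2 / S.I α α * S.I α x := rfl

/-- The reflection attached to a vector `α`. -/
noncomputable def refl (α : V) : V →ₗ[ℝ] V := LinearMap.id - (S.co α).smulRight α

lemma refl_apply (α x : V) : S.refl α x = x - S.co α x • α := rfl

variable {S}

lemma ne_zero_of_mem {α : V} (h : α ∈ S.R) : α ≠ 0 := fun h0 => S.zero_notmem (h0 ▸ h)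

lemma I_self_pos {α : V} (h : α ∈ S.R) : 0 < S.I α α := S.posdef α (ne_zero_of_mem h)

lemma I_self_nonneg (x : V) : 0 ≤ S.I x x := by
  by_cases h : x = 0
  · simp [h]
  · exact (S.posdef x h).le

lemma eq_zero_of_I_self {x : V} (h : S.I x x = 0) : x = 0 := by
  by_contra hx
  exact (S.posdef x hx).ne' h

lemma co_self {α : V} (h : α ∈ S.R) : S.co α α = 2 := by
  have := (I_self_pos h).ne'
  rw [co_apply]; field_simp

lemma refl_self {α : V} (h : α ∈ S.R) : S.refl α α = -α := by
  rw [refl_apply, co_self h, two_smul]; abel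

lemma refl_refl {α : V} (h : α ∈ S.R) (x : V) : S.refl α (S.refl α x) = x := by
  rw [refl_apply (x := S.refl α x), refl_apply, map_sub, map_smul, co_self h, smul_eq_mul,
    ← sub_eq_zero]
  module

lemma I_refl_refl {α : V} (h : α ∈ S.R) (x y : V) :
    S.I (S.refl α x) (S.refl α y) = S.I x y := by
  have := (I_self_pos h).ne'
  simp only [refl_apply, map_sub, map_smul, LinearMap.sub_apply, LinearMap.smul_apply,
    smul_eq_mul, co_apply, S.symm x α]
  field_simp
  ring

lemma I_refl_left {α : V} (h : α ∈ S.R) (x y : V) :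
    S.I (S.refl α x) y = S.I x (S.refl α y) := by
  rw [← I_refl_refl h, refl_refl h]

lemma refl_mem {α β : V} (hα : α ∈ S.R) (hβ : β ∈ S.R) : S.refl α β ∈ S.R := by
  have := S.reflect α hα β hβ
  simpa [refl_apply, co_apply] using this

lemma neg_mem {α : V} (h : α ∈ S.R) : -α ∈ S.R := refl_self h ▸ refl_mem h h

lemma co_int {α β : V} (hα : α ∈ S.R) (hβ : β ∈ S.R) : ∃ n : ℤ, S.co α β = n := by
  have := S.integral α hα β hβ
  simpa [co_apply] using this

lemma co_neg (α x : V) : S.co (-α) x = -S.co α x := by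
  simp [co_apply]

lemma refl_neg (α x : V) : S.refl (-α) x = S.refl α x := by
  simp [refl_apply, co_neg]

lemma co_refl_refl {γ : V} (h : γ ∈ S.R) (α x : V) :
    S.co (S.refl γ α) (S.refl γ x) = S.co α x := by
  simp only [co_apply, I_refl_refl h]

lemma co_refl_left {γ : V} (h : γ ∈ S.R) (α x : V) :
    S.co (S.refl γ α) x = S.co α (S.refl γ x) := by
  rw [← co_refl_refl h (x := S.refl γ x), refl_refl h]

lemma refl_conj {γ : V} (h : γ ∈ S.R) (α x : V) :
    S.refl (S.refl γ α) x = S.refl γ (S.refl α (S.refl γ x)) := by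
  rw [refl_apply S α, map_sub, map_smul, refl_refl h, refl_apply S (S.refl γ α),
    co_refl_left h]

/-- A reflection in a root as a linear automorphism. -/
noncomputable def reflEquiv {α : V} (h : α ∈ S.R) : V ≃ₗ[ℝ] V :=
  LinearEquiv.ofInvolutive (S.refl α) (refl_refl h)

@[simp] lemma reflEquiv_apply {α : V} (h : α ∈ S.R) (x : V) :
    reflEquiv h x = S.refl α x := rfl

lemma abs_co_mul_le (α β : V) : S.I α β * S.I α β ≤ S.I α α * S.I β β := by
  by_cases h : α = 0
  · simp [h]
  have hp := S.posdef α h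
  have := I_self_nonneg (S := S) (S.I α α • β - S.I α β • α)
  simp only [map_sub, map_smul, LinearMap.sub_apply, LinearMap.smul_apply, smul_eq_mul,
    S.symm β α] at this
  have h2 : 0 ≤ S.I α α * (S.I α α * S.I β β - S.I α β * S.I α β) := by linarith
  have := nonneg_of_mul_nonneg_right h2 hp
  linarith

lemma I_mul_lt {α β : V} (hα : α ∈ S.R) (hβ : β ∈ S.R) (h : β ≠ α) (h' : β ≠ -α) :
    S.I α β * S.I α β < S.I α α * S.I β β := by
  refine lt_of_le_of_ne (abs_co_mul_le α β) fun he => ?_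
  have hp := I_self_pos hα
  have : S.I α α • β - S.I α β • α = 0 := by
    apply eq_zero_of_I_self (S := S)
    simp only [map_sub, map_smul, LinearMap.sub_apply, LinearMap.smul_apply, smul_eq_mul,
      S.symm β α]
    linear_combination (-S.I α α) * he
  have hb : β = (S.I α β / S.I α α) • α := by
    rw [sub_eq_zero] at this
    rw [div_eq_inv_mul, mul_smul, ← this, smul_smul, inv_mul_cancel₀ hp.ne', one_smul]
  rcases S.reduced α hα _ (hb ▸ hβ) with hc | hc
  · rw [hc, one_smul] at hb; exact h hb
  · rw [hc, neg_one_smul] at hb; exact h' hb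

end Basic

end RootSys

namespace Base

open RootSys

variable {V : Type} [AddCommGroup V] [Module ℝ V] {S : RootSys V} (B : Base S)

lemma pi_mem_R {a : V} (h : a ∈ B.Pi) : a ∈ S.R := B.pos_sub (B.pi_sub h)

lemma span_pi : Submodule.span ℝ (B.Pi : Set V) = ⊤ := by
  rw [eq_top_iff, ← S.spanning, Submodule.span_le]
  have hpos : ∀ α ∈ B.Pos, α ∈ Submodule.span ℝ (B.Pi : Set V) := by
    intro α hα
    obtain ⟨c, rfl⟩ := B.decomp α hα
    exact Submodule.sum_mem _ fun b hb => Submodule.smul_mem _ _ (Submodule.subset_span hb)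
  intro α hα
  rcases B.mem_or_neg α hα with h | h
  · exact hpos α h
  · simpa using Submodule.neg_mem _ (hpos _ h)

/-- The basis of simple roots. -/
noncomputable def basis : Module.Basis {x // x ∈ B.Pi} ℝ V :=
  Module.Basis.mk B.indep (by
    have : Set.range (fun b : {x // x ∈ B.Pi} => (b : V)) = (B.Pi : Set V) := by
      ext; simp
    rw [this, B.span_pi])

@[simp] lemma basis_apply (b : {x // x ∈ B.Pi}) : B.basis b = b := by
  simp [basis]

lemma finrank_eq : Module.finrank ℝ V = B.Pi.card := by
  rw [Module.finrank_eq_card_basis B.basis]; simp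

/-- The coefficient of a vector at a simple root. -/
noncomputable def coord (b : {x // x ∈ B.Pi}) : V →ₗ[ℝ] ℝ := B.basis.coord b

lemma coord_self (b : {x // x ∈ B.Pi}) : B.coord b (b : V) = 1 := by
  have := B.basis.coord_apply b (b : V)
  rw [coord, this, ← B.basis_apply b, B.basis.repr_self]; simp

lemma coord_ne {a b : {x // x ∈ B.Pi}} (h : (a : V) ≠ b) : B.coord b (a : V) = 0 := by
  have := B.basis.coord_apply b (a : V)
  rw [coord, this, ← B.basis_apply a, B.basis.repr_self]
  exact Finsupp.single_eq_of_ne fun h' => h (by rw [h'])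

lemma coord_sum (b : {x // x ∈ B.Pi}) (c : V → ℝ) :
    B.coord b (∑ a ∈ B.Pi, c a • a) = c b := by
  have : ∑ a ∈ B.Pi, c a • a = ∑ a : {x // x ∈ B.Pi}, c a • B.basis a := by
    rw [← Finset.sum_coe_sort]; simp
  rw [this, map_sum, Finset.sum_eq_single b]
  · rw [map_smul, B.basis_apply, B.coord_self, smul_eq_mul, mul_one]
  · intro a _ hab
    rw [map_smul, B.basis_apply, B.coord_ne fun h => hab (Subtype.ext h), smul_zero]
  · simp

lemma sum_coord (x : V) : x = ∑ b : {x // x ∈ B.Pi}, B.coord b x • (b : V) := by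
  conv_lhs => rw [← B.basis.sum_repr x]
  simp [coord]

lemma coord_nat {α : V} (hα : α ∈ B.Pos) (b : {x // x ∈ B.Pi}) :
    ∃ n : ℕ, B.coord b α = n := by
  obtain ⟨c, rfl⟩ := B.decomp α hα
  exact ⟨c b, B.coord_sum b _⟩

lemma coord_nonneg {α : V} (hα : α ∈ B.Pos) (b : {x // x ∈ B.Pi}) : 0 ≤ B.coord b α := by
  obtain ⟨n, hn⟩ := B.coord_nat hα b
  rw [hn]; positivity

lemma pos_of_coord_pos {α : V} (hα : α ∈ S.R) (b : {x // x ∈ B.Pi}) (h : 0 < B.coord b α) :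
    α ∈ B.Pos := by
  rcases B.mem_or_neg α hα with h' | h'
  · exact h'
  · have := B.coord_nonneg h' b
    rw [map_neg] at this; linarith

lemma exists_coord_pos {α a : V} (hα : α ∈ B.Pos) (ha : a ∈ B.Pi) (h : α ≠ a) :
    ∃ b : {x // x ∈ B.Pi}, (b : V) ≠ a ∧ 0 < B.coord b α := by
  by_contra! hc
  have h0 : ∀ b : {x // x ∈ B.Pi}, (b : V) ≠ a → B.coord b α = 0 := fun b hb =>
    le_antisymm (hc b hb) (B.coord_nonneg hα b)
  have hx := B.sum_coord α
  rw [Finset.sum_eq_single (⟨a, ha⟩ : {x // x ∈ B.Pi})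
    (fun b _ hb => by rw [h0 b (fun h' => hb (Subtype.ext h')), zero_smul]) (by simp)] at hx
  simp only at hx
  have hR := B.pos_sub hα
  rw [hx] at hR
  rcases S.reduced a (B.pi_mem_R ha) _ hR with hc | hc
  · rw [hc, one_smul] at hx; exact h hx
  · rw [hc, neg_one_smul] at hx
    exact B.not_both a (B.pi_sub ha) (hx ▸ hα)

lemma refl_mem_pos {α a : V} (hα : α ∈ B.Pos) (ha : a ∈ B.Pi) (h : α ≠ a) :
    S.refl a α ∈ B.Pos := by
  obtain ⟨b, hb, hp⟩ := B.exists_coord_pos hα ha h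
  refine B.pos_of_coord_pos (refl_mem (B.pi_mem_R ha) (B.pos_sub hα)) b ?_
  rw [refl_apply, map_sub, map_smul, B.coord_ne (a := ⟨a, ha⟩) hb.symm]
  simpa using hp

lemma refl_ne_self {α a : V} (hα : α ∈ B.Pos) (ha : a ∈ B.Pi) : S.refl a α ≠ a := by
  intro h
  have h2 := congrArg (S.refl a) h
  rw [refl_refl (B.pi_mem_R ha), refl_self (B.pi_mem_R ha)] at h2
  exact B.not_both a (B.pi_sub ha) (h2 ▸ hα)

/-- Sums over the positive roots other than a simple root `a` are invariant under `s_a`. -/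
lemma sum_erase_refl {M : Type*} [AddCommMonoid M] {a : V} (ha : a ∈ B.Pi) (f : V → M) :
    ∑ α ∈ B.Pos.erase a, f (S.refl a α) = ∑ α ∈ B.Pos.erase a, f α := by
  have hm : ∀ α ∈ B.Pos.erase a, S.refl a α ∈ B.Pos.erase a := fun α h => by
    rw [Finset.mem_erase] at h ⊢
    exact ⟨B.refl_ne_self h.2 ha, B.refl_mem_pos h.2 ha h.1⟩
  exact Finset.sum_nbij' (S.refl a) (S.refl a) hm hm
    (fun α _ => refl_refl (B.pi_mem_R ha) α) (fun α _ => refl_refl (B.pi_mem_R ha) α)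
    (fun α _ => rfl)

lemma prod_erase_refl {M : Type*} [CommMonoid M] {a : V} (ha : a ∈ B.Pi) (f : V → M) :
    ∏ α ∈ B.Pos.erase a, f (S.refl a α) = ∏ α ∈ B.Pos.erase a, f α :=
  sum_erase_refl (M := Additive M) B ha f

lemma refl_weylVec {a : V} (ha : a ∈ B.Pi) : S.refl a (weylVec B) = weylVec B - a := by
  have h := B.sum_erase_refl ha (fun x => x)
  have h1 := Finset.add_sum_erase B.Pos (fun x => x) (B.pi_sub ha)
  have h2 := Finset.add_sum_erase B.Pos (fun x => S.refl a x) (B.pi_sub ha)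
  rw [weylVec, map_smul, map_sum, ← h2, h, refl_self (B.pi_mem_R ha), ← h1]
  module

lemma co_weylVec {a : V} (ha : a ∈ B.Pi) : S.co a (weylVec B) = 1 := by
  have h := B.refl_weylVec ha
  rw [refl_apply, sub_right_inj] at h
  have hn := ne_zero_of_mem (B.pi_mem_R ha)
  have : (S.co a (weylVec B) - 1) • a = 0 := by rw [sub_smul, h]; simp
  rcases smul_eq_zero.1 this with h | h
  · linarith
  · exact absurd h hn

lemma I_weylVec_pi {a : V} (ha : a ∈ B.Pi) : S.I (weylVec B) a = S.I a a / 2 := by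
  have h := B.co_weylVec ha
  have hp := I_self_pos (B.pi_mem_R ha)
  rw [co_apply, S.symm] at h
  field_simp at h
  rw [S.symm]
  linarith

lemma I_eq_sum_coord (x y : V) :
    S.I x y = ∑ b : {x // x ∈ B.Pi}, B.coord b y * S.I x b := by
  conv_lhs => rw [B.sum_coord y]
  simp

lemma exists_coord_pos' {α : V} (hα : α ∈ B.Pos) : ∃ b : {x // x ∈ B.Pi}, 0 < B.coord b α := by
  by_contra! hc
  have hx := B.sum_coord α
  rw [Finset.sum_eq_zero fun b _ => by
    rw [le_antisymm (hc b) (B.coord_nonneg hα b), zero_smul]] at hx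
  exact ne_zero_of_mem (B.pos_sub hα) hx

lemma I_weylVec_pos {α : V} (hα : α ∈ B.Pos) : 0 < S.I (weylVec B) α := by
  rw [B.I_eq_sum_coord]
  obtain ⟨b, hb⟩ := B.exists_coord_pos' hα
  have hq : ∀ b : {x // x ∈ B.Pi}, 0 < S.I (weylVec B) b := fun b => by
    rw [B.I_weylVec_pi b.2]; have := I_self_pos (B.pi_mem_R b.2); linarith
  exact Finset.sum_pos' (fun b _ => mul_nonneg (B.coord_nonneg hα b) (hq b).le)
    ⟨b, Finset.mem_univ _, mul_pos hb (hq b)⟩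

lemma I_pi_nonpos {a b : V} (ha : a ∈ B.Pi) (hb : b ∈ B.Pi) (h : a ≠ b) : S.I a b ≤ 0 := by
  have h1 := B.coord_nonneg (B.refl_mem_pos (B.pi_sub hb) ha h.symm) ⟨a, ha⟩
  rw [refl_apply, map_sub, map_smul, B.coord_ne (a := ⟨b, hb⟩) (b := ⟨a, ha⟩) h.symm,
    B.coord_self ⟨a, ha⟩, co_apply] at h1
  have hp := I_self_pos (B.pi_mem_R ha)
  have hp2 : 0 < 2 / S.I a a := by positivity
  simp only [smul_eq_mul] at h1
  by_contra! hc
  nlinarith [mul_pos hp2 hc]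

/-- The sum of the coordinates of a vector. -/
noncomputable def height (x : V) : ℝ := ∑ b : {x // x ∈ B.Pi}, B.coord b x

/-- Induction on roots: a property of roots which holds for simple roots and is stable under
simple reflections and negation holds for all roots. -/
lemma root_induction {P : V → Prop} (h1 : ∀ a ∈ B.Pi, P a)
    (h2 : ∀ a ∈ B.Pi, ∀ β ∈ S.R, P β → P (S.refl a β)) (h3 : ∀ β ∈ S.R, P β → P (-β)) :
    ∀ α ∈ S.R, P α := by
  have key : ∀ n : ℕ, ∀ α ∈ B.Pos, B.height α ≤ n → P α := by
    intro n
    induction n with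
    | zero =>
      intro α hα hn
      obtain ⟨b, hb⟩ := B.exists_coord_pos' hα
      have : 0 < B.height α := Finset.sum_pos' (fun b _ => B.coord_nonneg hα b)
        ⟨b, Finset.mem_univ _, hb⟩
      simp at hn; linarith
    | succ n ih =>
      intro α hα hn
      have hR := B.pos_sub hα
      have hp := I_self_pos hR
      rw [B.I_eq_sum_coord] at hp
      obtain ⟨b, -, hb⟩ := Finset.exists_lt_of_sum_lt (s := Finset.univ)
        (f := fun _ : {x // x ∈ B.Pi} => (0 : ℝ)) (by simpa using hp)
      have hc := B.coord_nonneg hα b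
      have hI : 0 < S.I α b := by
        by_contra! h
        nlinarith [mul_nonneg hc (neg_nonneg.2 h)]
      by_cases hab : α = b
      · exact hab ▸ h1 b b.2
      have hpos := B.refl_mem_pos hα b.2 hab
      obtain ⟨m, hm⟩ := co_int (B.pi_mem_R b.2) hR
      have hm0 : 0 < S.co b α := by
        rw [co_apply, S.symm b α]
        have := I_self_pos (B.pi_mem_R b.2)
        positivity
      have hm1 : 1 ≤ S.co b α := by
        rw [hm] at hm0 ⊢
        have : 0 < m := by exact_mod_cast hm0
        exact_mod_cast this
      have hh : B.height (S.refl b α) = B.height α - S.co b α := by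
        have : B.height (b : V) = 1 := by
          rw [height, Finset.sum_eq_single b (fun c _ hcb => B.coord_ne fun h => hcb
            (Subtype.ext h.symm)) (by simp), B.coord_self]
        simp only [height] at this ⊢
        simp only [refl_apply, map_sub, map_smul, Finset.sum_sub_distrib, smul_eq_mul,
          ← Finset.mul_sum, this, mul_one]
      have := h2 b b.2 _ (B.pos_sub hpos) (ih _ hpos (by push_cast at hn; rw [hh]; linarith))
      rwa [refl_refl (B.pi_mem_R b.2)] at this
  have hpos : ∀ α ∈ B.Pos, P α := fun α hα => by
    obtain ⟨n, hn⟩ := exists_nat_ge (B.height α)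
    exact key n α hα hn
  intro α hα
  rcases B.mem_or_neg α hα with h | h
  · exact hpos α h
  · simpa using h3 _ (B.pos_sub h) (hpos _ h)

lemma co_weylVec_int {α : V} (hα : α ∈ S.R) : ∃ n : ℤ, S.co α (weylVec B) = n := by
  have := B.root_induction (P := fun α => α ∈ S.R ∧ ∃ n : ℤ, S.co α (weylVec B) = n)
    (fun a ha => ⟨B.pi_mem_R ha, 1, by simp [B.co_weylVec ha]⟩)
    (fun a ha β _ h => by
      obtain ⟨hβ, n, hn⟩ := h
      obtain ⟨m, hm⟩ := co_int hβ (B.pi_mem_R ha)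
      refine ⟨refl_mem (B.pi_mem_R ha) hβ, n - m, ?_⟩
      rw [co_refl_left (B.pi_mem_R ha), B.refl_weylVec ha, map_sub, hn, hm]; simp)
    (fun β _ h => by
      obtain ⟨hβ, n, hn⟩ := h
      exact ⟨neg_mem hβ, -n, by rw [co_neg, hn]; simp⟩)
  exact (this α hα).2

lemma root_mem_closure {α : V} (hα : α ∈ S.R) :
    α ∈ AddSubgroup.closure (B.Pi : Set V) := by
  have hpos : ∀ α ∈ B.Pos, α ∈ AddSubgroup.closure (B.Pi : Set V) := fun α h => by
    obtain ⟨c, rfl⟩ := B.decomp α h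
    refine AddSubgroup.sum_mem _ fun b hb => ?_
    rw [Nat.cast_smul_eq_nsmul]
    exact AddSubgroup.nsmul_mem _ (AddSubgroup.subset_closure hb) _
  rcases B.mem_or_neg α hα with h | h
  · exact hpos α h
  · simpa using AddSubgroup.neg_mem _ (hpos _ h)

end Base

namespace RootSys

variable {V : Type} [AddCommGroup V] [Module ℝ V] {S : RootSys V}

/-- Irreducibility: a function on roots which agrees on non-orthogonal roots is constant. -/
lemma const_of_connected {X : Type*} (c : V → X)
    (h : ∀ α ∈ S.R, ∀ β ∈ S.R, S.I α β ≠ 0 → c α = c β) {α β : V} (hα : α ∈ S.R)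
    (hβ : β ∈ S.R) : c α = c β := by
  rcases S.irred (S.R.filter fun γ => c γ = c β) (S.R.filter fun γ => ¬ c γ = c β)
    (Finset.filter_union_filter_not_eq _ _) (fun γ hγ δ hδ => by
      rw [Finset.mem_filter] at hγ hδ
      by_contra hI
      exact hδ.2 (by rw [← h γ hγ.1 δ hδ.1 hI, hγ.2])) with h0 | h0
  · have : β ∈ S.R.filter fun γ => c γ = c β := by simp [hβ]
    rw [h0] at this; simp at this
  · by_contra hc
    have : α ∈ S.R.filter fun γ => ¬ c γ = c β := by simp [hα, hc]
    rw [h0] at this; simp at this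

lemma ext_of_roots {W : Type*} [AddCommGroup W] [Module ℝ W] {f g : V →ₗ[ℝ] W}
    (h : ∀ α ∈ S.R, f α = g α) : f = g :=
  LinearMap.ext_on S.spanning fun α hα => h α hα

lemma exists_orthonormal [FiniteDimensional ℝ V] (S : RootSys V) :
    ∃ e : Fin (Module.finrank ℝ V) → V, (∀ i, S.I (e i) (e i) = 1) ∧
      ∀ x y, ∑ i, S.I (e i) x * S.I (e i) y = S.I x y := by
  let core : InnerProductSpace.Core ℝ V :=
    { inner := fun x y => S.I x y
      conj_inner_symm := fun x y => by simp [S.symm y x]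
      re_inner_nonneg := fun x => by simpa using I_self_nonneg x
      add_left := fun x y z => by simp
      smul_left := fun x y r => by simp
      definite := fun x hx => eq_zero_of_I_self hx }
  let _ : NormedAddCommGroup V := core.toNormedAddCommGroup
  let _ : InnerProductSpace ℝ V := InnerProductSpace.ofCore core.toCore
  let b := stdOrthonormalBasis ℝ V
  refine ⟨b, fun i => ?_, fun x y => ?_⟩
  · have := b.inner_eq_one i
    exact this
  · have h := b.sum_inner_mul_inner x y
    have h2 : ∑ i, S.I x (b i) * S.I (b i) y = S.I x y := h
    rw [← h2]
    exact Finset.sum_congr rfl fun i _ => by rw [S.symm x]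

end RootSys

namespace Base

open RootSys

variable {V : Type} [AddCommGroup V] [Module ℝ V] {S : RootSys V} (B : Base S)

/-- The operator `x ↦ ∑ f(α) I(α, x) α` over positive roots. -/
noncomputable def sumOp (f : V → ℝ) : V →ₗ[ℝ] V :=
  ∑ α ∈ B.Pos, f α • (S.I α).smulRight α

lemma sumOp_apply (f : V → ℝ) (x : V) :
    B.sumOp f x = ∑ α ∈ B.Pos, (f α * S.I α x) • α := by
  simp [sumOp, smul_smul]

lemma sum_pos_refl {M : Type*} [AddCommMonoid M] {a : V} (ha : a ∈ B.Pi) (g : V → M)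
    (hg : g (-a) = g a) : ∑ α ∈ B.Pos, g (S.refl a α) = ∑ α ∈ B.Pos, g α := by
  rw [← Finset.add_sum_erase B.Pos g (B.pi_sub ha),
    ← Finset.add_sum_erase B.Pos (fun x => g (S.refl a x)) (B.pi_sub ha),
    B.sum_erase_refl ha g, refl_self (B.pi_mem_R ha), hg]

lemma sumOp_scalar {f : V → ℝ} (hf : ∀ α ∈ S.R, ∀ β ∈ S.R, f (S.refl α β) = f β) :
    ∃ k : ℝ, ∀ x, B.sumOp f x = k • x := by
  have hneg : ∀ α ∈ S.R, f (-α) = f α := fun α hα => by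
    rw [← refl_self hα, hf α hα α hα]
  have hs : ∀ x y, S.I (B.sumOp f x) y = S.I x (B.sumOp f y) := fun x y => by
    simp only [sumOp_apply, map_sum, map_smul, LinearMap.sum_apply, LinearMap.smul_apply,
      smul_eq_mul]
    exact Finset.sum_congr rfl fun α _ => by rw [S.symm x α]; ring
  have hc0 : ∀ a ∈ B.Pi, ∀ x, B.sumOp f (S.refl a x) = S.refl a (B.sumOp f x) := by
    intro a ha x
    have h := B.sum_pos_refl ha (fun β => (f β * S.I β x) • β)
      (by simp [hneg a (B.pi_mem_R ha)])
    rw [sumOp_apply, sumOp_apply, ← h, map_sum]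
    refine Finset.sum_congr rfl fun α hα => ?_
    rw [map_smul, refl_refl (B.pi_mem_R ha), hf a (B.pi_mem_R ha) α (B.pos_sub hα),
      I_refl_left (B.pi_mem_R ha)]
  have hc : ∀ α ∈ S.R, ∀ x, B.sumOp f (S.refl α x) = S.refl α (B.sumOp f x) :=
    B.root_induction hc0
      (fun a ha β hβ h x => by
        rw [refl_conj (B.pi_mem_R ha), refl_conj (B.pi_mem_R ha), hc0 a ha, h, hc0 a ha])
      (fun β _ h x => by rw [refl_neg, refl_neg]; exact h x)
  set c : V → ℝ := fun α => S.co α (B.sumOp f α) / 2 with hcdef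
  have heig : ∀ α ∈ S.R, B.sumOp f α = c α • α := fun α hα => by
    have h := hc α hα α
    rw [refl_self hα, map_neg, refl_apply] at h
    have h2 : (2 : ℝ) • B.sumOp f α = S.co α (B.sumOp f α) • α := by
      rw [two_smul]
      calc _ = B.sumOp f α - -(B.sumOp f α) := by abel
        _ = _ := by rw [h]; abel
    change B.sumOp f α = (S.co α (B.sumOp f α) / 2) • α
    rw [div_eq_inv_mul, mul_smul, ← h2, smul_smul]; norm_num
  have hcon : ∀ α ∈ S.R, ∀ β ∈ S.R, S.I α β ≠ 0 → c α = c β := fun α hα β hβ hI => by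
    have := hs α β
    rw [heig α hα, heig β hβ, map_smul, map_smul, LinearMap.smul_apply, smul_eq_mul,
      smul_eq_mul] at this
    exact mul_right_cancel₀ hI this
  by_cases hR : S.R.Nonempty
  · obtain ⟨α0, h0⟩ := hR
    refine ⟨c α0, fun x => ?_⟩
    have : B.sumOp f = c α0 • LinearMap.id := ext_of_roots (S := S) fun α hα => by
      rw [heig α hα, const_of_connected c hcon hα h0]; rfl
    rw [this]; rfl
  · refine ⟨0, fun x => ?_⟩
    have : B.sumOp f = 0 := ext_of_roots (S := S) fun α hα => absurd ⟨α, hα⟩ hR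
    rw [this]; simp

lemma sumOp_trace {f : V → ℝ} {k : ℝ} (h : ∀ x, B.sumOp f x = k • x) :
    k * B.Pi.card = ∑ α ∈ B.Pos, f α * S.I α α := by
  have : FiniteDimensional ℝ V := Module.Finite.of_basis B.basis
  obtain ⟨e, he1, he⟩ := S.exists_orthonormal
  calc k * B.Pi.card = ∑ i, S.I (e i) (B.sumOp f (e i)) := by
        simp [h, he1, B.finrank_eq, mul_comm]
    _ = ∑ α ∈ B.Pos, f α * ∑ i, S.I (e i) α * S.I (e i) α := by
        simp only [sumOp_apply, map_sum, map_smul, smul_eq_mul, Finset.mul_sum]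
        rw [Finset.sum_comm]
        exact Finset.sum_congr rfl fun α _ => Finset.sum_congr rfl fun i _ => by
          rw [S.symm α]; ring
    _ = _ := by simp only [he]

lemma sumOp_quad {f : V → ℝ} {k : ℝ} (h : ∀ x, B.sumOp f x = k • x) (x y : V) :
    ∑ α ∈ B.Pos, f α * (S.I α x * S.I α y) = k * S.I x y := by
  have := congrArg (fun z => S.I z y) (h x)
  simp only [sumOp_apply, map_sum, map_smul, LinearMap.sum_apply, LinearMap.smul_apply,
    smul_eq_mul] at this
  rw [← this]
  exact Finset.sum_congr rfl fun α _ => by ring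

section Highest

variable {θs : V} (hθsR : θs ∈ S.R)
    (hθshigh : ∀ α ∈ S.R, S.I α α = S.I θs θs →
      ∃ c : V → ℕ, θs - α = ∑ b ∈ B.Pi, (c b : ℝ) • b)

include hθsR hθshigh

lemma coord_le_highest {α : V} (hα : α ∈ S.R) (hl : S.I α α = S.I θs θs)
    (b : {x // x ∈ B.Pi}) : B.coord b α ≤ B.coord b θs := by
  obtain ⟨c, hc⟩ := hθshigh α hα hl
  have := B.coord_sum b (fun b => (c b : ℝ))
  rw [← hc, map_sub] at this
  have h2 : (0 : ℝ) ≤ c b := by positivity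
  linarith

lemma highest_pos : θs ∈ B.Pos := by
  rcases B.mem_or_neg θs hθsR with h | h
  · exact h
  · obtain ⟨b, hb⟩ := B.exists_coord_pos' h
    have := B.coord_le_highest hθsR hθshigh (neg_mem hθsR) (by simp) b
    rw [map_neg] at this hb
    linarith

lemma highest_dominant {a : V} (ha : a ∈ B.Pi) : 0 ≤ S.I θs a := by
  have h := B.coord_le_highest hθsR hθshigh (refl_mem (B.pi_mem_R ha) hθsR)
    (I_refl_refl (B.pi_mem_R ha) _ _) ⟨a, ha⟩
  rw [refl_apply, map_sub, map_smul, B.coord_self ⟨a, ha⟩, co_apply] at h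
  have hp := I_self_pos (B.pi_mem_R ha)
  simp only [smul_eq_mul, mul_one] at h
  have h2 : 0 ≤ 2 / S.I a a * S.I a θs := by linarith
  rw [S.symm]
  exact nonneg_of_mul_nonneg_right h2 (by positivity)

lemma highest_I_nonneg {α : V} (hα : α ∈ B.Pos) : 0 ≤ S.I θs α := by
  rw [B.I_eq_sum_coord]
  exact Finset.sum_nonneg fun b _ => mul_nonneg (B.coord_nonneg hα b)
    (B.highest_dominant hθsR hθshigh b.2)

lemma co_highest (hmin : ∀ α ∈ S.R, S.I θs θs ≤ S.I α α) {α : V} (hα : α ∈ B.Pos)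
    (hne : α ≠ θs) : S.co α θs = 0 ∨ S.co α θs = 1 := by
  have hR := B.pos_sub hα
  have hp := I_self_pos hR
  have hps := I_self_pos hθsR
  obtain ⟨n, hn⟩ := co_int hR hθsR
  have h0 : 0 ≤ S.co α θs := by
    have := B.highest_I_nonneg hθsR hθshigh hα
    rw [co_apply, S.symm α θs]
    exact mul_nonneg (by positivity) this
  have hne' : θs ≠ -α := fun h =>
    B.not_both α hα (h ▸ B.highest_pos hθsR hθshigh)
  have h1 := I_mul_lt hR hθsR hne.symm hne'
  have h2 : S.co α θs < 2 := by
    rw [co_apply, div_mul_eq_mul_div, div_lt_iff₀ hp]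
    have := hmin α hR
    nlinarith
  rw [hn] at h0 h2 ⊢
  have h0' : 0 ≤ n := by exact_mod_cast h0
  have h2' : n < 2 := by exact_mod_cast h2
  interval_cases n <;> simp

/-- The eigenvalue of `∑ α^∨ ⊗ α` is the dual Coxeter number of the twisted affine system. -/
lemma sumOp_coroot (hmin : ∀ α ∈ S.R, S.I θs θs ≤ S.I α α) (x : V) :
    B.sumOp (fun α => 2 / S.I α α) x = (1 + S.co θs (weylVec B)) • x := by
  obtain ⟨k, hk⟩ := B.sumOp_scalar (f := fun α => 2 / S.I α α)
    (fun α hα β _ => by simp only [I_refl_refl hα])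
  have hps := I_self_pos hθsR
  have hq := B.sumOp_quad hk θs θs
  have h1 : ∑ α ∈ B.Pos, S.co α θs * S.co θs α = 2 * k := by
    have : 2 * k = 2 / S.I θs θs * (k * S.I θs θs) := by field_simp
    rw [this, ← hq, Finset.mul_sum]
    exact Finset.sum_congr rfl fun α _ => by
      rw [co_apply, co_apply, S.symm θs α]; ring
  have hθp := B.highest_pos hθsR hθshigh
  rw [← Finset.add_sum_erase _ _ hθp, Finset.sum_congr rfl
    (g := fun α => S.co θs α) (fun α hα => ?_)] at h1
  · have h2 : ∑ α ∈ B.Pos, S.co θs α = 2 * S.co θs (weylVec B) := by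
      rw [weylVec, map_smul, map_sum, smul_eq_mul]; ring
    rw [← Finset.add_sum_erase _ _ hθp] at h2
    rw [co_self hθsR] at h1 h2
    rw [hk, show k = 1 + S.co θs (weylVec B) by linarith]
  · rw [Finset.mem_erase] at hα
    have hp := I_self_pos (B.pos_sub hα.2)
    rcases B.co_highest hθsR hθshigh hmin hα.2 hα.1 with h | h
    · rw [h, zero_mul]
      rw [co_apply] at h ⊢
      have : S.I α θs = 0 := by
        rcases mul_eq_zero.1 h with h | h
        · have : 0 < 2 / S.I α α := by positivity
          linarith
        · exact h
      rw [S.symm θs α, this, mul_zero]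
    · rw [h, one_mul]

end Highest

end Base

/-- Words related by cyclic rotations and by swapping adjacent letters related by `r`. -/
inductive CoxEq {X : Type*} (r : X → X → Prop) : List X → List X → Prop
  | refl (L : List X) : CoxEq r L L
  | symm {L L' : List X} : CoxEq r L L' → CoxEq r L' L
  | trans {L L' L'' : List X} : CoxEq r L L' → CoxEq r L' L'' → CoxEq r L L''
  | rot (a : X) (L : List X) : CoxEq r (a :: L) (L ++ [a])
  | swap (L : List X) (a b : X) (L' : List X) (h : r a b) :
      CoxEq r (L ++ a :: b :: L') (L ++ b :: a :: L')

namespace CoxEq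

variable {X : Type*} {r : X → X → Prop}

lemma perm {L L' : List X} (h : CoxEq r L L') : L.Perm L' := by
  induction h with
  | refl L => exact List.Perm.refl L
  | symm _ ih => exact ih.symm
  | trans _ _ ih1 ih2 => exact ih1.trans ih2
  | rot a L => exact (List.perm_append_singleton a L).symm
  | swap L a b L' _ => exact (List.Perm.swap b a L').append_left L

lemma rotate (L L' : List X) : CoxEq r (L ++ L') (L' ++ L) := by
  induction L generalizing L' with
  | nil => simpa using CoxEq.refl _
  | cons a L ih =>
    refine (CoxEq.rot a (L ++ L')).trans ?_
    have := ih (L' ++ [a])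
    simpa [List.append_assoc] using this

lemma move {a : X} (L K : List X) (h : ∀ x ∈ K, r x a) :
    CoxEq r (L ++ K ++ [a]) (L ++ a :: K) := by
  induction K generalizing L with
  | nil => simpa using CoxEq.refl _
  | cons x K ih =>
    have h1 := ih (L ++ [x]) fun y hy => h y (by simp [hy])
    have h2 := CoxEq.swap L x a K (h x (by simp))
    simp only [List.append_assoc, List.cons_append,
      List.nil_append] at h1 ⊢
    exact h1.trans h2

lemma append_leaf (hs : ∀ x y, r x y → r y x) {a : X} {K K' : List X} (h : CoxEq r K K')
    (hK : K.Nodup) (ha : ∀ b ∈ K, ∀ c ∈ K, ¬ r a b → ¬ r a c → b = c) :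
    CoxEq r (K ++ [a]) (K' ++ [a]) := by
  induction h with
  | refl L => exact CoxEq.refl _
  | symm h ih =>
    have hp := h.perm
    exact (ih (hp.nodup_iff.2 hK) fun b hb c hc =>
      ha b (hp.mem_iff.1 hb) c (hp.mem_iff.1 hc)).symm
  | trans h1 h2 ih1 ih2 =>
    have hp := h1.perm
    exact (ih1 hK ha).trans (ih2 (hp.nodup_iff.1 hK) fun b hb c hc =>
      ha b (hp.mem_iff.2 hb) c (hp.mem_iff.2 hc))
  | rot x L =>
    by_cases hx : r a x
    · refine (CoxEq.rot x (L ++ [a])).trans ?_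
      have := CoxEq.swap L a x [] hx
      simpa [List.append_assoc] using this
    · have hL : ∀ y ∈ L, r y a := fun y hy => by
        by_contra hy'
        have hxy := ha x (by simp) y (by simp [hy]) hx (fun h => hy' (hs _ _ h))
        rw [List.nodup_cons] at hK
        exact hK.1 (hxy ▸ hy)
      have h1 := CoxEq.move [x] L hL
      have h2 := CoxEq.rot (r := r) x (a :: L)
      have h3 := CoxEq.rot (r := r) a (L ++ [x])
      simp only [List.cons_append] at h1 h2 h3 ⊢
      exact (h1.trans h2).trans h3
  | swap L a' b L' h =>
    have := CoxEq.swap L a' b (L' ++ [a]) h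
    simpa [List.append_assoc] using this

lemma of_forest (hs : ∀ x y, r x y → r y x) (J : Finset X)
    (hleaf : ∀ K ⊆ J, K.Nonempty → ∃ a ∈ K, ∀ b ∈ K, ∀ c ∈ K, b ≠ a → c ≠ a →
      ¬ r a b → ¬ r a c → b = c) (L L' : List X) (hL : L.Nodup) (hL' : L'.Nodup)
    (h : L.toFinset = J) (h' : L'.toFinset = J) : CoxEq r L L' := by
  induction hn : J.card using Nat.strong_induction_on generalizing J L L' with
  | _ n ih =>
    rcases J.eq_empty_or_nonempty with h0 | h0
    · subst h0
      rw [List.toFinset_eq_empty_iff] at h h'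
      rw [h, h']; exact CoxEq.refl _
    · obtain ⟨a, haJ, ha⟩ := hleaf J subset_rfl h0
      have key : ∀ L : List X, L.Nodup → L.toFinset = J → ∃ K : List X,
          CoxEq r L (K ++ [a]) ∧ K.Nodup ∧ K.toFinset = J.erase a := by
        intro L hL hLJ
        have haL : a ∈ L := by rw [← List.mem_toFinset, hLJ]; exact haJ
        obtain ⟨L1, L2, rfl⟩ := List.append_of_mem haL
        have hp : (L1 ++ a :: L2).Perm ((L2 ++ L1) ++ [a]) := by
          refine (List.perm_append_comm).trans ?_
          rw [List.cons_append]
          exact (List.perm_append_singleton a _).symm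
        refine ⟨L2 ++ L1, ?_, ?_, ?_⟩
        · refine (CoxEq.rotate L1 (a :: L2)).trans ?_
          exact CoxEq.rot a (L2 ++ L1)
        · exact (List.nodup_append.1 (hp.nodup_iff.1 hL)).1
        · have h2 := hp.nodup_iff.1 hL
          rw [List.nodup_append] at h2
          ext x
          rw [Finset.mem_erase, ← hLJ, List.mem_toFinset, List.mem_toFinset, hp.mem_iff,
            List.mem_append (s := L2 ++ L1), List.mem_singleton]
          constructor
          · intro hx
            exact ⟨h2.2.2 x hx a (by simp), Or.inl hx⟩
          · rintro ⟨h1, h3 | h3⟩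
            · exact h3
            · exact absurd h3 h1
      obtain ⟨K, hK1, hK2, hK3⟩ := key L hL h
      obtain ⟨K', hK1', hK2', hK3'⟩ := key L' hL' h'
      have hKK := ih (J.erase a).card (by rw [← hn]; exact Finset.card_erase_lt_of_mem haJ)
        (J.erase a) (fun K hK => hleaf K (hK.trans (Finset.erase_subset _ _))) K K' hK2 hK2'
        hK3 hK3' rfl
      refine (hK1.trans (append_leaf hs hKK hK2 ?_)).trans hK1'.symm
      have hmem : ∀ b ∈ K, b ≠ a ∧ b ∈ J := fun b hb => by
        rw [← List.mem_toFinset, hK3, Finset.mem_erase] at hb; exact hb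
      exact fun b hb c hc => ha b (hmem b hb).2 c (hmem c hc).2 (hmem b hb).1 (hmem c hc).1

end CoxEq

lemma exists_two_coloring {X : Type*} (r : X → X → Prop) (hs : ∀ x y, r x y → r y x)
    (J : Finset X)
    (hleaf : ∀ K ⊆ J, K.Nonempty → ∃ a ∈ K, ∀ b ∈ K, ∀ c ∈ K, b ≠ a → c ≠ a →
      ¬ r a b → ¬ r a c → b = c) :
    ∃ χ : X → Bool, ∀ a ∈ J, ∀ b ∈ J, a ≠ b → ¬ r a b → χ a ≠ χ b := by
  induction hn : J.card using Nat.strong_induction_on generalizing J with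
  | _ n ih =>
    rcases J.eq_empty_or_nonempty with h0 | h0
    · subst h0; exact ⟨fun _ => true, by simp⟩
    · obtain ⟨a, haJ, ha⟩ := hleaf J subset_rfl h0
      obtain ⟨χ, hχ⟩ := ih (J.erase a).card
        (by rw [← hn]; exact Finset.card_erase_lt_of_mem haJ) (J.erase a)
        (fun K hK => hleaf K (hK.trans (Finset.erase_subset _ _))) rfl
      have hv : ∃ v : Bool, ∀ b ∈ J, b ≠ a → ¬ r a b → χ b ≠ v := by
        by_cases hb : ∃ b ∈ J, b ≠ a ∧ ¬ r a b
        · obtain ⟨b, hbJ, hba, hb⟩ := hb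
          refine ⟨!χ b, fun c hc hca hrc => ?_⟩
          rw [ha c hc b hbJ hca hba hrc hb]
          cases χ b <;> simp
        · push Not at hb
          exact ⟨true, fun b h1 h2 h3 => absurd (hb b h1 h2) h3⟩
      obtain ⟨v, hv⟩ := hv
      refine ⟨Function.update χ a v, fun x hx y hy hxy hr => ?_⟩
      by_cases hxa : x = a
      · subst hxa
        rw [Function.update_self, Function.update_of_ne hxy.symm]
        exact (hv y hy hxy.symm hr).symm
      · rw [Function.update_of_ne hxa]
        by_cases hya : y = a
        · subst hya
          rw [Function.update_self]
          exact hv x hx hxa fun h => hr (hs _ _ h)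
        · rw [Function.update_of_ne hya]
          exact hχ x (Finset.mem_erase.2 ⟨hxa, hx⟩) y (Finset.mem_erase.2 ⟨hya, hy⟩) hxy hr

/-- A symmetric nonnegative matrix with zero diagonal has a nonnegative eigenvector. -/
lemma exists_nonneg_eigenvector {ι : Type*} [Fintype ι] [Nonempty ι] (M : ι → ι → ℝ)
    (hsymm : ∀ i j, M i j = M j i) (hdiag : ∀ i, M i i = 0) (hM : ∀ i j, 0 ≤ M i j) :
    ∃ (μ : ℝ) (v : ι → ℝ), (∀ i, 0 ≤ v i) ∧ v ≠ 0 ∧ ∀ j, ∑ i, M i j * v i = μ * v j := by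
  let Q : (ι → ℝ) → ℝ := fun v => ∑ i, ∑ j, M i j * v i * v j
  let N : (ι → ℝ) → ℝ := fun v => ∑ i, v i ^ 2
  have hNpos : ∀ v, v ≠ 0 → 0 < N v := fun v hv => by
    obtain ⟨i, hi⟩ := Function.ne_iff.1 hv
    exact Finset.sum_pos' (fun j _ => sq_nonneg _) ⟨i, Finset.mem_univ _, by
      have : v i ≠ 0 := hi
      positivity⟩
  have hNc : Continuous N := by fun_prop
  have hQc : Continuous Q := by fun_prop
  have hcomp : IsCompact {v : ι → ℝ | N v = 1} := by
    refine Metric.isCompact_of_isClosed_isBounded (isClosed_singleton.preimage hNc) ?_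
    refine (Metric.isBounded_closedBall (x := (0 : ι → ℝ)) (r := 1)).subset fun v hv => ?_
    rw [mem_closedBall_zero_iff, pi_norm_le_iff_of_nonneg zero_le_one]
    intro i
    have h1 : v i ^ 2 ≤ N v := Finset.single_le_sum (f := fun i => v i ^ 2)
      (fun j _ => sq_nonneg _) (Finset.mem_univ i)
    rw [Set.mem_ofPred_eq] at hv
    rw [Real.norm_eq_abs, ← sq_le_one_iff_abs_le_one]
    linarith
  obtain ⟨i0⟩ := ‹Nonempty ι›
  have hne : {v : ι → ℝ | N v = 1}.Nonempty := ⟨Pi.single i0 1, by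
    simp only [N, Set.mem_ofPred_eq]
    rw [Finset.sum_eq_single i0] <;> simp +contextual⟩
  obtain ⟨v, hv, hmax⟩ := hcomp.exists_isMaxOn hne hQc.continuousOn
  have hv1 : N v = 1 := hv
  have hle : ∀ x, Q x ≤ Q v * N x := fun x => by
    by_cases hx : x = 0
    · subst hx; simp [Q, N]
    · have hp := hNpos x hx
      set c := (Real.sqrt (N x))⁻¹ with hc
      have hc2 : c ^ 2 * N x = 1 := by
        rw [hc, inv_pow, Real.sq_sqrt hp.le, inv_mul_cancel₀ hp.ne']
      have h1 : N (fun i => c * x i) = 1 := by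
        rw [← hc2]; simp only [N, mul_pow, Finset.mul_sum]
      have h2 : Q (fun i => c * x i) = c ^ 2 * Q x := by
        simp only [Q, Finset.mul_sum]
        exact Finset.sum_congr rfl fun i _ => Finset.sum_congr rfl fun j _ => by ring
      have h3 : Q (fun i => c * x i) ≤ Q v := hmax h1
      rw [h2] at h3
      have := mul_le_mul_of_nonneg_right h3 hp.le
      calc Q x = c ^ 2 * N x * Q x := by rw [hc2, one_mul]
        _ = c ^ 2 * Q x * N x := by ring
        _ ≤ _ := this
  have habs1 : N (fun i => |v i|) = 1 := by rw [← hv1]; simp only [N, sq_abs]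
  have habs : Q v ≤ Q (fun i => |v i|) :=
    Finset.sum_le_sum fun i _ => Finset.sum_le_sum fun j _ => by
      rw [mul_assoc, mul_assoc, ← abs_mul]
      exact mul_le_mul_of_nonneg_left (le_abs_self _) (hM i j)
  refine ⟨Q v, fun i => |v i|, fun i => abs_nonneg _, fun h0 => ?_, fun j => ?_⟩
  · rw [h0] at habs1; simp [N] at habs1
  · set w : ι → ℝ := fun i => |v i| with hw
    set D := Q v * w j - ∑ i, M i j * w i with hD
    have key : ∀ s : ℝ, 0 ≤ Q v * s ^ 2 + 2 * s * D := fun s => by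
      have h1 := hle (fun i => w i + s * (if i = j then 1 else 0))
      have hN2 : N (fun i => w i + s * (if i = j then 1 else 0)) = N w + 2 * s * w j + s ^ 2 := by
        simp only [N]
        have : ∀ i, (w i + s * (if i = j then 1 else 0)) ^ 2 =
            w i ^ 2 + (if i = j then 2 * s * w i + s ^ 2 else 0) := fun i => by
          split_ifs <;> ring
        simp only [this, Finset.sum_add_distrib, Finset.sum_ite_eq', Finset.mem_univ, if_true]
        ring
      have hQ2 : Q (fun i => w i + s * (if i = j then 1 else 0)) =
          Q w + 2 * s * ∑ i, M i j * w i := by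
        simp only [Q]
        have : ∀ i k, M i k * (w i + s * (if i = j then 1 else 0)) *
            (w k + s * (if k = j then 1 else 0)) =
            M i k * w i * w k + (if k = j then s * (M i k * w i) else 0)
              + (if i = j then s * (M i k * w k) else 0)
              + (if i = j then (if k = j then s ^ 2 * M i k else 0) else 0) := fun i k => by
          split_ifs <;> ring
        simp only [this, Finset.sum_add_distrib, Finset.sum_ite_eq', Finset.mem_univ, if_true]
        have h3 : ∑ x, ∑ k, (if x = j then s * (M x k * w k) else 0) =
            ∑ i, s * (M i j * w i) := by
          rw [Finset.sum_comm]
          simp only [Finset.sum_ite_eq', Finset.mem_univ, if_true]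
          exact Finset.sum_congr rfl fun i _ => by rw [hsymm]
        have h4 : ∑ x, ∑ k, (if x = j then (if k = j then s ^ 2 * M x k else 0) else 0) = 0 := by
          rw [Finset.sum_comm]
          simp [hdiag]
        rw [h3, h4, ← Finset.mul_sum]; ring
      rw [hN2, hQ2, habs1] at h1
      rw [hD]
      have := habs
      nlinarith
    have hQ0 : 0 ≤ Q v := le_trans (Finset.sum_nonneg fun i _ => Finset.sum_nonneg fun k _ =>
      mul_nonneg (mul_nonneg (hM i k) (abs_nonneg _)) (abs_nonneg _) : 0 ≤ Q w)
        (by have := hle w; rw [habs1, mul_one] at this; exact this)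
    have hD0 : D = 0 := by
      have h1 := key (-D / (Q v + 1))
      have : Q v * (-D / (Q v + 1)) ^ 2 + 2 * (-D / (Q v + 1)) * D =
          -(D ^ 2 * ((Q v + 2) / (Q v + 1) ^ 2)) := by field_simp; ring
      rw [this] at h1
      have h2 : 0 < (Q v + 2) / (Q v + 1) ^ 2 := by positivity
      have h3 : D ^ 2 ≤ 0 := by
        by_contra h; push Not at h
        have := mul_pos h h2
        linarith
      exact pow_eq_zero_iff (two_ne_zero) |>.1 (le_antisymm h3 (sq_nonneg _))
    linarith

namespace RootSys

variable {V : Type} [AddCommGroup V] [Module ℝ V] (S : RootSys V)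

/-- The product of the reflections in a list of vectors, the first letter acting first. -/
noncomputable def word : List V → Module.End ℝ V
  | [] => 1
  | a :: L => word L * S.refl a

lemma word_nil : S.word [] = 1 := rfl

lemma word_cons (a : V) (L : List V) : S.word (a :: L) = S.word L * S.refl a := rfl

lemma word_cons_apply (a : V) (L : List V) (x : V) :
    S.word (a :: L) x = S.word L (S.refl a x) := rfl

lemma word_append (L L' : List V) : S.word (L ++ L') = S.word L' * S.word L := by
  induction L with
  | nil => simp [word_nil]
  | cons a L ih => rw [List.cons_append, word_cons, ih, word_cons, mul_assoc]

lemma word_foldl (L : List V) (x : V) :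
    L.foldl (fun y α => y - (2 * S.I α y / S.I α α) • α) x = S.word L x := by
  induction L generalizing x with
  | nil => rfl
  | cons a L ih =>
    rw [List.foldl_cons, ih, word_cons_apply, refl_apply, co_apply, div_mul_eq_mul_div]

variable {S}

lemma refl_sq {a : V} (ha : a ∈ S.R) : S.refl a * S.refl a = 1 :=
  LinearMap.ext fun x => refl_refl ha x

lemma refl_comm {a b : V} (h : S.I a b = 0) : S.refl a * S.refl b = S.refl b * S.refl a := by
  ext x
  have h' : S.I b a = 0 := by rw [S.symm, h]
  simp only [Module.End.mul_apply, refl_apply, co_apply, map_sub, map_smul, h, h',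
    mul_zero, zero_smul, sub_zero]
  abel

lemma word_mem {L : List V} (hL : ∀ a ∈ L, a ∈ S.R) {α : V} (hα : α ∈ S.R) :
    S.word L α ∈ S.R := by
  induction L generalizing α with
  | nil => exact hα
  | cons a L ih =>
    rw [word_cons_apply]
    exact ih (fun b hb => hL b (by simp [hb])) (refl_mem (hL a (by simp)) hα)

lemma word_orth_fixed {L : List V} {x : V} (h : ∀ a ∈ L, S.I a x = 0) : S.word L x = x := by
  induction L with
  | nil => rfl
  | cons a L ih =>
    rw [word_cons_apply, refl_apply, co_apply, h a (by simp), mul_zero, zero_smul, sub_zero]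
    exact ih fun b hb => h b (by simp [hb])

lemma word_orth_apply {L : List V} (h : L.Pairwise fun a b => S.I a b = 0) (x : V) :
    S.word L x = x - (L.map fun a => S.co a x • a).sum := by
  induction L generalizing x with
  | nil => simp [word_nil]
  | cons a L ih =>
    rw [List.pairwise_cons] at h
    rw [word_cons_apply, ih h.2, List.map_cons, List.sum_cons]
    have : L.map (fun b => S.co b (S.refl a x) • b) = L.map (fun b => S.co b x • b) := by
      refine List.map_congr_left fun b hb => ?_
      have hba : S.I b a = 0 := by rw [S.symm, h.1 b hb]
      rw [refl_apply, map_sub, map_smul, S.co_apply b a, hba, mul_zero, smul_zero, sub_zero]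
    rw [this, refl_apply]; abel

lemma word_pow_of_coxEq {L L' : List V} (h : CoxEq (fun a b => S.I a b = 0) L L')
    (hL : ∀ a ∈ L, a ∈ S.R) (k : ℕ) : S.word L ^ k = 1 ↔ S.word L' ^ k = 1 := by
  induction h with
  | refl L => rfl
  | symm h ih => exact (ih fun a ha => hL a (h.perm.mem_iff.1 ha)).symm
  | trans h1 _ ih1 ih2 => exact (ih1 hL).trans (ih2 fun a ha => hL a (h1.perm.mem_iff.2 ha))
  | rot a L =>
    have ha := refl_sq (hL a (by simp))
    have h := mul_pow_mul (S.refl a) (S.word L) k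
    have h' := mul_pow_mul (S.word L) (S.refl a) k
    rw [word_append, word_cons, word_cons, word_nil, one_mul]
    constructor
    · intro h1
      rw [h1, mul_one] at h
      calc (S.refl a * S.word L) ^ k = (S.refl a * S.word L) ^ k * (S.refl a * S.refl a) := by
            rw [ha, mul_one]
        _ = 1 := by rw [← mul_assoc, h, ha]
    · intro h1
      rw [h1, one_mul] at h
      calc (S.word L * S.refl a) ^ k = (S.refl a * S.refl a) * (S.word L * S.refl a) ^ k := by
            rw [ha, one_mul]
        _ = 1 := by rw [mul_assoc, ← h, ha]
  | swap L a b L' h =>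
    rw [word_append, word_append, word_cons, word_cons, word_cons, word_cons, mul_assoc _ _
      (S.refl a), mul_assoc _ _ (S.refl b), refl_comm h]

end RootSys

namespace Base

open RootSys

variable {V : Type} [AddCommGroup V] [Module ℝ V] {S : RootSys V} (B : Base S)

lemma exists_exchange {a : V} (ha : a ∈ B.Pos) (L : List V) (hL : ∀ b ∈ L, b ∈ B.Pi)
    (h : S.word L a ∉ B.Pos) :
    ∃ L1 b L2, L = L1 ++ b :: L2 ∧ S.word L1 a = b := by
  induction L generalizing a with
  | nil => exact absurd ha h
  | cons c L ih =>
    by_cases hac : a = c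
    · exact ⟨[], c, L, rfl, hac⟩
    · have hc := B.refl_mem_pos ha (hL c (by simp)) hac
      obtain ⟨L1, b, L2, rfl, hb⟩ := ih hc (fun b hb => hL b (by simp [hb])) h
      exact ⟨c :: L1, b, L2, rfl, hb⟩

lemma word_refl_conj {L : List V} (hL : ∀ a ∈ L, a ∈ S.R) (x : V) :
    S.word L * S.refl x = S.refl (S.word L x) * S.word L := by
  induction L generalizing x with
  | nil => simp [word_nil]
  | cons a L ih =>
    have ha := hL a (by simp)
    have hconj : S.refl a * S.refl x = S.refl (S.refl a x) * S.refl a := by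
      ext y
      simp only [Module.End.mul_apply]
      rw [refl_conj ha, refl_refl ha]
    rw [word_cons, mul_assoc, hconj, ← mul_assoc, ih (fun b hb => hL b (by simp [hb])), mul_assoc]
    rfl

lemma word_eq_one (L : List V) (hL : ∀ b ∈ L, b ∈ B.Pi)
    (h : ∀ a ∈ B.Pi, S.word L a ∈ B.Pos) : S.word L = 1 := by
  induction hn : L.length using Nat.strong_induction_on generalizing L with
  | _ n ih =>
    cases L with
    | nil => rfl
    | cons a L =>
      have ha := hL a (by simp)
      have hL' : ∀ b ∈ L, b ∈ B.Pi := fun b hb => hL b (by simp [hb])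
      have h1 := h a ha
      rw [word_cons_apply, refl_self (B.pi_mem_R ha), map_neg] at h1
      obtain ⟨L1, b, L2, rfl, hb⟩ := B.exists_exchange (B.pi_sub ha) L hL'
        (fun h' => B.not_both _ h' h1)
      have hbPi : b ∈ B.Pi := hL' b (by simp)
      have key : S.word (a :: (L1 ++ b :: L2)) = S.word (L1 ++ L2) := by
        have hL1 : ∀ c ∈ L1, c ∈ S.R := fun c hc => B.pi_mem_R (hL' c (by simp [hc]))
        rw [word_cons, word_append, word_append, word_cons, mul_assoc, word_refl_conj hL1, hb,
          mul_assoc, ← mul_assoc (S.refl b), refl_sq (B.pi_mem_R hbPi), one_mul]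
      rw [key]
      refine ih (L1 ++ L2).length ?_ _ ?_ ?_ rfl
      · rw [← hn]; simp
      · intro c hc
        refine hL' c ?_
        rw [List.mem_append] at hc ⊢
        rcases hc with hc | hc
        · exact Or.inl hc
        · exact Or.inr (by simp [hc])
      · rw [← key]; exact h

/-- Weighted count of the positive roots made negative by a word. -/
noncomputable def invSum (g : ℝ → ℝ) (L : List V) : ℝ :=
  ∑ α ∈ B.Pos, if S.word L α ∈ B.Pos then 0 else g (S.I α α)

lemma invSum_cons (g : ℝ → ℝ) {a : V} (ha : a ∈ B.Pi) (L : List V)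
    (h : S.word L a ∈ B.Pos) : B.invSum g (a :: L) = g (S.I a a) + B.invSum g L := by
  have haR := B.pi_mem_R ha
  have haP := B.pi_sub ha
  rw [invSum, invSum, ← Finset.add_sum_erase _ _ haP, ← Finset.add_sum_erase _ _ haP, if_pos h,
    zero_add]
  congr 1
  · rw [word_cons_apply, refl_self haR, map_neg, if_neg (B.not_both _ h)]
  · rw [← B.sum_erase_refl ha]
    refine Finset.sum_congr rfl fun α _ => ?_
    rw [word_cons_apply, refl_refl haR, I_refl_refl haR]

lemma invSum_append (g : ℝ → ℝ) (K L : List V) (hK : ∀ a ∈ K, a ∈ B.Pi)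
    (horth : K.Pairwise fun a b => S.I a b = 0) (h : ∀ a ∈ K, S.word L a ∈ B.Pos) :
    B.invSum g (K ++ L) = (K.map fun a => g (S.I a a)).sum + B.invSum g L := by
  induction K with
  | nil => simp
  | cons a K ih =>
    rw [List.pairwise_cons] at horth
    rw [List.cons_append, B.invSum_cons g (hK a (by simp)), ih (fun b hb => hK b (by simp [hb]))
      horth.2 (fun b hb => h b (by simp [hb])), List.map_cons, List.sum_cons, add_assoc]
    rw [word_append, Module.End.mul_apply, word_orth_fixed (L := K) fun b hb => by
      rw [S.symm]; exact horth.1 b hb]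
    exact h a (by simp)

lemma one_le_co_mul_co {a b : V} (ha : a ∈ S.R) (hb : b ∈ S.R) (h : S.I a b ≠ 0) :
    S.I a a * S.I b b ≤ 4 * S.I a b ^ 2 := by
  obtain ⟨m, hm⟩ := co_int ha hb
  obtain ⟨n, hn⟩ := co_int hb ha
  have hpa := I_self_pos ha
  have hpb := I_self_pos hb
  rw [co_apply] at hm hn
  rw [S.symm b a] at hn
  have h1 : (m : ℝ) * n * (S.I a a * S.I b b) = 4 * S.I a b ^ 2 := by
    rw [← hm, ← hn]; field_simp; norm_num
  have h2 : (0 : ℝ) < (m : ℝ) * n := by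
    have h3 : 0 < 4 * S.I a b ^ 2 := by positivity
    rw [← h1] at h3
    exact (pos_iff_pos_of_mul_pos h3).2 (by positivity)
  have h3 : (1 : ℝ) ≤ (m : ℝ) * n := by
    have : (0 : ℤ) < m * n := by exact_mod_cast h2
    have h4 : (1 : ℤ) ≤ m * n := this
    exact_mod_cast h4
  rw [← h1]
  exact le_mul_of_one_le_left (by positivity) h3

/-- The normalised Gram matrix. -/
noncomputable def cosI (S : RootSys V) (a b : V) : ℝ :=
  S.I a b / (Real.sqrt (S.I a a) * Real.sqrt (S.I b b))

lemma exists_leaf (K : Finset V) (hK : K ⊆ B.Pi) (hne : K.Nonempty) :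
    ∃ a ∈ K, ∀ b ∈ K, ∀ c ∈ K, b ≠ a → c ≠ a → ¬ S.I a b = 0 → ¬ S.I a c = 0 → b = c := by
  by_contra hcon
  push Not at hcon
  have hsq : ∀ a ∈ K, 0 < Real.sqrt (S.I a a) := fun a ha =>
    Real.sqrt_pos.2 (I_self_pos (B.pi_mem_R (hK ha)))
  set x : V := ∑ a ∈ K, (Real.sqrt (S.I a a))⁻¹ • a with hx
  have hx0 : x ≠ 0 := by
    obtain ⟨a, ha⟩ := hne
    intro h0
    have h1 := B.coord_sum ⟨a, hK ha⟩ (fun b => if b ∈ K then (Real.sqrt (S.I b b))⁻¹ else 0)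
    have h2 : ∑ b ∈ B.Pi, (if b ∈ K then (Real.sqrt (S.I b b))⁻¹ else 0) • b = x := by
      simp only [ite_smul, zero_smul]
      rw [← Finset.sum_filter, Finset.filter_mem_eq_inter, Finset.inter_eq_right.2 hK]
    rw [h2, h0, map_zero] at h1
    simp only [ha, if_true] at h1
    have := inv_pos.2 (hsq a ha)
    linarith
  have hpos := S.posdef x hx0
  have hexp : S.I x x = ∑ a ∈ K, ∑ b ∈ K, cosI S a b := by
    rw [hx]
    simp only [map_sum, map_smul, LinearMap.sum_apply, LinearMap.smul_apply, smul_eq_mul]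
    simp only [Finset.mul_sum]
    rw [Finset.sum_comm]
    refine Finset.sum_congr rfl fun a _ => Finset.sum_congr rfl fun b _ => ?_
    rw [cosI, div_eq_mul_inv, mul_inv]; ring
  rw [hexp] at hpos
  have hle : ∑ a ∈ K, ∑ b ∈ K, cosI S a b ≤ 0 := Finset.sum_nonpos fun a ha => by
    obtain ⟨b, hb, c, hc, hba, hca, hab, hac, hbc⟩ := hcon a ha
    have hne' : ∀ d ∈ K, d ≠ a → cosI S a d ≤ 0 := fun d hd hda =>
      div_nonpos_of_nonpos_of_nonneg (B.I_pi_nonpos (hK ha) (hK hd) hda.symm) (by positivity)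
    have hhalf : ∀ d ∈ K, d ≠ a → S.I a d ≠ 0 → cosI S a d ≤ -(1 / 2) := fun d hd hda h => by
      have h1 := B.I_pi_nonpos (hK ha) (hK hd) hda.symm
      have h2 := one_le_co_mul_co (B.pi_mem_R (hK ha)) (B.pi_mem_R (hK hd)) h
      have hp := mul_pos (hsq a ha) (hsq d hd)
      rw [cosI, div_le_iff₀ hp]
      have h3 : (Real.sqrt (S.I a a) * Real.sqrt (S.I d d)) ^ 2 = S.I a a * S.I d d := by
        rw [mul_pow, Real.sq_sqrt (I_self_nonneg a), Real.sq_sqrt (I_self_nonneg d)]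
      nlinarith
    have hself : cosI S a a = 1 := by
      rw [cosI, Real.mul_self_sqrt (I_self_nonneg a),
        div_self (I_self_pos (B.pi_mem_R (hK ha))).ne']
    rw [← Finset.add_sum_erase _ _ ha,
      ← Finset.add_sum_erase _ _ (Finset.mem_erase.2 ⟨hba, hb⟩),
      ← Finset.add_sum_erase _ _ (Finset.mem_erase.2 ⟨Ne.symm hbc, Finset.mem_erase.2 ⟨hca, hc⟩⟩)]
    have hrest : ∑ d ∈ ((K.erase a).erase b).erase c, cosI S a d ≤ 0 :=
      Finset.sum_nonpos fun d hd => by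
        simp only [Finset.mem_erase] at hd
        exact hne' d hd.2.2.2 hd.2.2.1
    have := hhalf b hb hba hab
    have := hhalf c hc hca hac
    linarith
  linarith

/-- The Dynkin diagram is connected. -/
lemma pi_connected {X : Type*} (c : V → X)
    (h : ∀ a ∈ B.Pi, ∀ b ∈ B.Pi, S.I a b ≠ 0 → c a = c b) {a b : V} (ha : a ∈ B.Pi)
    (hb : b ∈ B.Pi) : c a = c b := by
  let U : X → Submodule ℝ V := fun x => Submodule.span ℝ {a | a ∈ B.Pi ∧ c a = x}
  have horth : ∀ x y, x ≠ y → ∀ u ∈ U x, ∀ v ∈ U y, S.I u v = 0 := by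
    intro x y hxy u hu v hv
    induction hu using Submodule.span_induction with
    | mem u hu =>
      induction hv using Submodule.span_induction with
      | mem v hv =>
        by_contra h0
        exact hxy (by rw [← hu.2, ← hv.2]; exact h u hu.1 v hv.1 h0)
      | zero => simp
      | add v w _ _ h1 h2 => rw [map_add, h1, h2, add_zero]
      | smul r v _ h1 => rw [map_smul, h1, smul_zero]
    | zero => simp
    | add v w _ _ h1 h2 => rw [map_add, LinearMap.add_apply, h1, h2, add_zero]
    | smul r v _ h1 => rw [map_smul, LinearMap.smul_apply, h1, smul_zero]
  have hmem : ∀ α ∈ S.R, ∃ x, α ∈ U x := B.root_induction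
    (fun a ha => ⟨c a, Submodule.subset_span ⟨ha, rfl⟩⟩)
    (fun a ha β _ ⟨x, hx⟩ => by
      refine ⟨x, ?_⟩
      by_cases hc : c a = x
      · rw [refl_apply]
        exact Submodule.sub_mem _ hx (Submodule.smul_mem _ _ (Submodule.subset_span ⟨ha, hc⟩))
      · rw [refl_apply, co_apply,
          horth _ _ hc a (Submodule.subset_span ⟨ha, rfl⟩) β hx, mul_zero, zero_smul, sub_zero]
        exact hx)
    (fun β _ ⟨x, hx⟩ => ⟨x, Submodule.neg_mem _ hx⟩)
  let col : V → X := fun α => if hα : α ∈ S.R then (hmem α hα).choose else c α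
  have hcol : ∀ α ∈ S.R, α ∈ U (col α) := fun α hα => by
    simp only [col, hα, dif_pos]; exact (hmem α hα).choose_spec
  have hcolpi : ∀ a ∈ B.Pi, col a = c a := fun a ha => by
    by_contra hne
    have := horth _ _ hne a (hcol a (B.pi_mem_R ha)) a (Submodule.subset_span ⟨ha, rfl⟩)
    exact (I_self_pos (B.pi_mem_R ha)).ne' this
  rw [← hcolpi a ha, ← hcolpi b hb]
  refine const_of_connected (S := S) col (fun α hα β hβ hI => ?_) (B.pi_mem_R ha) (B.pi_mem_R hb)
  by_contra hne
  exact hI (horth _ _ hne α (hcol α hα) β (hcol β hβ))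

/-- A positive functional which is an eigenvector of the Cartan matrix. -/
lemma exists_perron (hne : B.Pi.Nonempty) : ∃ (μ : ℝ) (δ : V → ℝ), (∀ a ∈ B.Pi, 0 < δ a) ∧
    ∀ b ∈ B.Pi, ∑ a ∈ B.Pi.erase b, -S.co a b * δ a = μ * δ b := by
  have : Nonempty {x // x ∈ B.Pi} := hne.to_subtype
  let M : {x // x ∈ B.Pi} → {x // x ∈ B.Pi} → ℝ := fun a b =>
    if a = b then 0 else -cosI S a b
  have hcs : ∀ a b : V, cosI S a b = cosI S b a := fun a b => by
    rw [cosI, cosI, S.symm, mul_comm]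
  obtain ⟨μ, v, hv0, hv, hμ⟩ := exists_nonneg_eigenvector M
    (fun i j => by simp only [M, hcs i, eq_comm (a := i)]) (fun i => by simp [M])
    (fun i j => by
      simp only [M]
      split_ifs with h
      · exact le_rfl
      · exact neg_nonneg.2 (div_nonpos_of_nonpos_of_nonneg (B.I_pi_nonpos i.2 j.2
          fun h' => h (Subtype.ext h')) (by positivity)))
  have hMnn : ∀ i j, 0 ≤ M i j := fun i j => by
    simp only [M]
    split_ifs with h
    · exact le_rfl
    · exact neg_nonneg.2 (div_nonpos_of_nonpos_of_nonneg (B.I_pi_nonpos i.2 j.2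
        fun h' => h (Subtype.ext h')) (by positivity))
  have hsq : ∀ a ∈ B.Pi, 0 < Real.sqrt (S.I a a) := fun a ha =>
    Real.sqrt_pos.2 (I_self_pos (B.pi_mem_R ha))
  let w : V → ℝ := fun a => if h : a ∈ B.Pi then v ⟨a, h⟩ else 0
  have hzero : ∀ a ∈ B.Pi, ∀ b ∈ B.Pi, S.I a b ≠ 0 → w a = 0 → w b = 0 := by
    intro a ha b hb hI hwa
    by_cases hab : a = b
    · rw [← hab, hwa]
    simp only [w, ha, hb, dif_pos] at hwa ⊢
    have h1 := hμ ⟨a, ha⟩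
    rw [hwa, mul_zero, Finset.sum_eq_zero_iff_of_nonneg
      (fun i _ => mul_nonneg (hMnn _ _) (hv0 i))] at h1
    have h2 := h1 ⟨b, hb⟩ (Finset.mem_univ _)
    rcases mul_eq_zero.1 h2 with h2 | h2
    · exfalso
      simp only [M, Subtype.mk.injEq, Ne.symm hab, if_false, neg_eq_zero, cosI] at h2
      rcases div_eq_zero_iff.1 h2 with h3 | h3
      · exact hI (by rw [S.symm, h3])
      · exact (mul_pos (hsq b hb) (hsq a ha)).ne' h3
    · exact h2
  have hpos : ∀ a ∈ B.Pi, 0 < w a := by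
    intro a ha
    by_contra hle
    have hwa : w a = 0 := le_antisymm (not_lt.1 hle) (by simp only [w, ha, dif_pos]; exact hv0 _)
    refine hv (funext fun b => ?_)
    have := B.pi_connected (fun a => w a = 0) (fun x hx y hy hI => propext
      ⟨hzero x hx y hy hI, hzero y hy x hx (by rwa [S.symm])⟩) ha b.2
    have h2 : w b = 0 := this ▸ hwa
    simp only [w, b.2, dif_pos] at h2
    exact h2
  refine ⟨2 * μ, fun a => Real.sqrt (S.I a a) * w a, fun a ha => mul_pos (hsq a ha) (hpos a ha),
    fun b hb => ?_⟩
  have h1 := hμ ⟨b, hb⟩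
  have hwb : v ⟨b, hb⟩ = w b := by simp only [w, hb, dif_pos]
  rw [hwb] at h1
  have h2 : ∑ i : {x // x ∈ B.Pi}, M i ⟨b, hb⟩ * v i =
      ∑ a ∈ B.Pi, (if a = b then 0 else -cosI S a b) * w a := by
    rw [← Finset.sum_coe_sort B.Pi]
    refine Finset.sum_congr rfl fun i _ => ?_
    simp only [M, w, i.2, dif_pos, Subtype.ext_iff]
  rw [h2, ← Finset.add_sum_erase _ _ hb, if_pos rfl, zero_mul, zero_add] at h1
  calc _ = 2 * Real.sqrt (S.I b b) *
        ∑ a ∈ B.Pi.erase b, (if a = b then 0 else -cosI S a b) * w a := by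
        rw [Finset.mul_sum]
        refine Finset.sum_congr rfl fun a ha => ?_
        rw [Finset.mem_erase] at ha
        have hqa := hsq a ha.2
        have hqb := hsq b hb
        have hsa := Real.mul_self_sqrt (I_self_nonneg (S := S) a)
        rw [if_neg ha.1, co_apply, cosI]
        field_simp
        rw [Real.sq_sqrt (I_self_nonneg _)]
        have := (I_self_pos (B.pi_mem_R ha.2)).ne'
        field_simp
    _ = _ := by rw [h1]; ring

end Base

namespace Base

open RootSys

variable {V : Type} [AddCommGroup V] [Module ℝ V] {S : RootSys V} (B : Base S)

/-- The two colour classes of simple roots, indexed by parity. -/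
noncomputable def cls (χ : V → Bool) (n : ℕ) : Finset V := B.Pi.filter fun a => χ a = decide (Even n)

/-- Alternating products of the two colour classes. -/
noncomputable def altWord (χ : V → Bool) (s : ℕ) : ℕ → List V
  | 0 => []
  | n + 1 => (B.cls χ (s + n)).toList ++ altWord χ s n

/-- Chebyshev-like sequence governing alternating products. -/
noncomputable def kap (μ : ℝ) : ℕ → ℝ
  | 0 => 1
  | 1 => 1 + μ
  | n + 2 => μ * kap μ (n + 1) - kap μ n

section

variable {B} {χ : V → Bool}

lemma cls_add_two (n : ℕ) : B.cls χ (n + 2) = B.cls χ n := by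
  simp [cls, Nat.even_add]

lemma cls_add_even {k : ℕ} (hk : Even k) (n : ℕ) : B.cls χ (n + k) = B.cls χ n := by
  simp [cls, Nat.even_add, hk]

lemma cls_sub {n : ℕ} {a : V} (h : a ∈ B.cls χ n) : a ∈ B.Pi := (Finset.mem_filter.1 h).1

lemma mem_cls_or {a : V} (h : a ∈ B.Pi) (n : ℕ) : a ∈ B.cls χ n ∨ a ∈ B.cls χ (n + 1) := by
  simp only [cls, Finset.mem_filter, h, true_and, Nat.even_add_one]
  by_cases hn : Even n <;> cases χ a <;> simp [hn]

lemma cls_succ (n : ℕ) : B.cls χ (n + 1) = B.Pi \ B.cls χ n := by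
  ext a
  simp only [cls, Finset.mem_filter, Finset.mem_sdiff, Nat.even_add_one]
  by_cases hn : Even n <;> cases χ a <;> simp [hn]

lemma sum_cls_add {M : Type*} [AddCommMonoid M] (n : ℕ) (g : V → M) :
    ∑ a ∈ B.cls χ n, g a + ∑ a ∈ B.cls χ (n + 1), g a = ∑ a ∈ B.Pi, g a := by
  rw [cls_succ, add_comm]
  exact Finset.sum_sdiff (Finset.filter_subset _ _)

lemma altWord_sub (s n : ℕ) : ∀ a ∈ B.altWord χ s n, a ∈ B.Pi := by
  induction n with
  | zero => simp [altWord]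
  | succ n ih =>
    intro a ha
    rw [altWord, List.mem_append] at ha
    rcases ha with ha | ha
    · exact cls_sub (Finset.mem_toList.1 ha)
    · exact ih a ha

lemma altWord_sub_R (s n : ℕ) : ∀ a ∈ B.altWord χ s n, a ∈ S.R :=
  fun a ha => B.pi_mem_R (altWord_sub s n a ha)

lemma word_altWord_add (s m n : ℕ) : S.word (B.altWord χ s (m + n)) =
    S.word (B.altWord χ s m) * S.word (B.altWord χ (s + m) n) := by
  induction n with
  | zero => simp [altWord, word_nil]
  | succ n ih =>
    rw [← add_assoc, altWord, word_append, ih, altWord, word_append, mul_assoc, add_assoc s m n]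

lemma altWord_add_even {k : ℕ} (hk : Even k) (s n : ℕ) :
    B.altWord χ (s + k) n = B.altWord χ s n := by
  induction n with
  | zero => rfl
  | succ n ih => rw [altWord, altWord, ih, add_right_comm, cls_add_even hk]

lemma word_altWord_even (k : ℕ) :
    S.word (B.altWord χ 0 (2 * k)) = S.word (B.altWord χ 0 2) ^ k := by
  induction k with
  | zero => simp [altWord, word_nil]
  | succ k ih =>
    rw [mul_add, mul_one, word_altWord_add, ih, pow_succ, altWord_add_even (by simp)]

variable (hχ : ∀ a ∈ B.Pi, ∀ b ∈ B.Pi, a ≠ b → ¬ S.I a b = 0 → χ a ≠ χ b)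

include hχ

lemma cls_orth {n : ℕ} {a b : V} (ha : a ∈ B.cls χ n) (hb : b ∈ B.cls χ n) (hab : a ≠ b) :
    S.I a b = 0 := by
  by_contra h
  exact hχ a (cls_sub ha) b (cls_sub hb) hab h
    ((Finset.mem_filter.1 ha).2.trans (Finset.mem_filter.1 hb).2.symm)

lemma cls_pairwise (n : ℕ) : (B.cls χ n).toList.Pairwise fun a b => S.I a b = 0 :=
  (Finset.nodup_toList (B.cls χ n)).imp_of_mem fun ha hb hab =>
    cls_orth hχ (Finset.mem_toList.1 ha) (Finset.mem_toList.1 hb) hab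

lemma word_cls_apply (n : ℕ) (x : V) :
    S.word (B.cls χ n).toList x = x - ∑ a ∈ B.cls χ n, S.co a x • a := by
  rw [word_orth_apply (cls_pairwise hχ n), Finset.sum_map_toList]

lemma word_cls_self {n : ℕ} {c : V} (hc : c ∈ B.cls χ n) :
    S.word (B.cls χ n).toList c = -c := by
  rw [word_cls_apply hχ, ← Finset.add_sum_erase _ _ hc, Finset.sum_eq_zero, add_zero,
    co_self (B.pi_mem_R (cls_sub hc)), two_smul]
  · abel
  · intro a ha
    rw [Finset.mem_erase] at ha
    rw [co_apply, cls_orth hχ ha.2 hc ha.1, mul_zero, zero_smul]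

lemma word_altWord_prev (s n : ℕ) {c : V} (hc : c ∈ B.cls χ (s + n)) :
    S.word (B.altWord χ s (n + 1)) c = -S.word (B.altWord χ s n) c := by
  rw [altWord, word_append, Module.End.mul_apply, word_cls_self hχ hc, map_neg]

variable {μ : ℝ} {δ : V → ℝ}
    (hμ : ∀ b ∈ B.Pi, ∑ a ∈ B.Pi.erase b, -S.co a b * δ a = μ * δ b)
    {ℓ : V →ₗ[ℝ] ℝ} (hℓ : ∀ a ∈ B.Pi, ℓ a = δ a)

include hμ

lemma sum_cls_perron (n : ℕ) {c : V} (hc : c ∈ B.cls χ (n + 1)) :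
    ∑ a ∈ B.cls χ n, -S.co a c * δ a = μ * δ c := by
  have hcPi := cls_sub hc
  rw [cls_succ, Finset.mem_sdiff] at hc
  rw [← hμ c hcPi]
  refine Finset.sum_subset (fun a ha => Finset.mem_erase.2 ⟨fun h => hc.2 (h ▸ ha), cls_sub ha⟩)
    fun a ha hn => ?_
  rw [Finset.mem_erase] at ha
  have ha' : a ∈ B.cls χ (n + 1) := by rw [cls_succ, Finset.mem_sdiff]; exact ⟨ha.2, hn⟩
  rw [co_apply, cls_orth hχ ha' (by rw [cls_succ, Finset.mem_sdiff]; exact hc) ha.1, mul_zero,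
    neg_zero, zero_mul]

include hℓ

lemma apply_altWord (s n : ℕ) : ∀ c ∈ B.cls χ (s + n),
    ℓ (S.word (B.altWord χ s n) c) = δ c * kap μ n := by
  induction n using Nat.twoStepInduction with
  | zero =>
    intro c hc
    rw [altWord, word_nil, Module.End.one_apply, hℓ c (cls_sub hc), kap, mul_one]
  | one =>
    intro c hc
    rw [altWord, altWord, List.append_nil, word_cls_apply hχ, map_sub, map_sum,
      hℓ c (cls_sub hc)]
    have := sum_cls_perron hχ hμ s hc
    simp only [map_smul, smul_eq_mul]
    rw [Finset.sum_congr rfl fun a ha => by rw [hℓ a (cls_sub ha)], kap, mul_add, mul_one,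
      mul_comm (δ c), ← this, sub_eq_add_neg, ← Finset.sum_neg_distrib]
    simp only [neg_mul, add_zero]
  | more n ih1 ih2 =>
    intro c hc
    have h0 : c ∈ B.cls χ (s + n) := by
      rw [← cls_add_two, add_assoc]; exact hc
    have := sum_cls_perron hχ hμ (s + (n + 1)) (c := c) (by rw [add_assoc]; exact hc)
    rw [altWord, word_append, Module.End.mul_apply, word_cls_apply hχ, map_sub, map_sub, map_sum,
      map_sum, word_altWord_prev hχ s n h0, map_neg, ih1 c h0]
    simp only [map_smul, smul_eq_mul]
    rw [Finset.sum_congr rfl fun a ha => by rw [ih2 a ha], kap, mul_sub,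
      ← mul_assoc, mul_comm (δ c) μ, ← this, Finset.sum_mul, sub_eq_add_neg (-_),
      ← Finset.sum_neg_distrib, neg_add_eq_sub]
    congr 1
    exact Finset.sum_congr rfl fun a _ => by ring

end

/-- The order of a Coxeter element, in the form of the length-weighted count `2 |R⁺| = h l`. -/
theorem coxeter_count (hlen : ∃ α ∈ S.R, ∃ β ∈ S.R, S.I α α ≠ S.I β β) (cx : V ≃ₗ[ℝ] V)
    (lst : List V) (hnd : lst.Nodup) (hset : lst.toFinset = B.Pi)
    (hcx : ∀ x : V, cx x = S.word lst x) (g : ℝ → ℝ) :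
    2 * ∑ α ∈ B.Pos, g (S.I α α) = orderOf cx * ∑ b ∈ B.Pi, g (S.I b b) := by
  have horths : ∀ x y : V, S.I x y = 0 → S.I y x = 0 := fun x y h => by rw [S.symm, h]
  have hleaf := B.exists_leaf
  obtain ⟨χ, hχ⟩ := exists_two_coloring (fun a b => S.I a b = 0) horths B.Pi hleaf
  have hPine : B.Pi.Nonempty := by
    obtain ⟨α, hα, -⟩ := hlen
    rcases B.mem_or_neg α hα with h | h <;> obtain ⟨b, -⟩ := B.exists_coord_pos' h <;>
      exact ⟨b, b.2⟩
  have hclsne : ∀ n, (B.cls χ n).Nonempty := by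
    intro n
    by_contra h0
    rw [Finset.not_nonempty_iff_eq_empty] at h0
    have hall : ∀ a ∈ B.Pi, a ∈ B.cls χ (n + 1) := fun a ha => by
      rcases mem_cls_or (B := B) (χ := χ) ha n with h | h
      · rw [h0] at h; simp at h
      · exact h
    have hsub : ∀ a ∈ B.Pi, ∀ b ∈ B.Pi, a = b := fun a ha b hb =>
      B.pi_connected (fun x => x) (fun a ha b hb hI => by
        by_contra hab
        exact hI (cls_orth hχ (hall a ha) (hall b hb) hab)) ha hb
    obtain ⟨a, ha⟩ := hPine
    have hR : ∀ α ∈ S.R, S.I α α = S.I a a := B.root_induction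
      (fun b hb => by rw [hsub b hb a ha])
      (fun b hb β _ h => by rw [I_refl_refl (B.pi_mem_R hb), h])
      (fun β _ h => by simp [h])
    obtain ⟨α, hα, β, hβ, h⟩ := hlen
    exact h (by rw [hR α hα, hR β hβ])
  obtain ⟨μ, δ, hδ, hμ⟩ := B.exists_perron hPine
  let ℓ : V →ₗ[ℝ] ℝ := ∑ b : {x // x ∈ B.Pi}, δ b • B.coord b
  have hℓ : ∀ a ∈ B.Pi, ℓ a = δ a := fun a ha => by
    simp only [ℓ, LinearMap.sum_apply, LinearMap.smul_apply, smul_eq_mul]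
    rw [Finset.sum_eq_single (⟨a, ha⟩ : {x // x ∈ B.Pi})]
    · rw [B.coord_self ⟨a, ha⟩, mul_one]
    · intro b _ hb
      rw [B.coord_ne (a := ⟨a, ha⟩) (fun h => hb (Subtype.ext h.symm)), mul_zero]
    · simp
  have hℓpos : ∀ α ∈ B.Pos, 0 < ℓ α := fun α hα => by
    simp only [ℓ, LinearMap.sum_apply, LinearMap.smul_apply, smul_eq_mul]
    obtain ⟨b, hb⟩ := B.exists_coord_pos' hα
    exact Finset.sum_pos' (fun c _ => mul_nonneg (hδ c c.2).le (B.coord_nonneg hα c))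
      ⟨b, Finset.mem_univ _, mul_pos (hδ b b.2) hb⟩
  have hℓneg : ∀ α ∈ S.R, α ∉ B.Pos → ℓ α < 0 := fun α hα h => by
    have := hℓpos (-α) ((B.mem_or_neg α hα).resolve_left h)
    rw [map_neg] at this
    linarith
  set W : ℕ → ℕ → Module.End ℝ V := fun s n => S.word (B.altWord χ s n) with hW
  have hWR : ∀ s n, ∀ α ∈ S.R, W s n α ∈ S.R := fun s n α hα => word_mem (altWord_sub_R s n) hα
  have happ : ∀ s n, ∀ c ∈ B.cls χ (s + n), ℓ (W s n c) = δ c * kap μ n :=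
    apply_altWord hχ hμ hℓ
  have hkpos : ∀ s n, ∀ c ∈ B.cls χ (s + n), (W s n c ∈ B.Pos ↔ 0 < kap μ n) := by
    intro s n c hc
    have h1 := happ s n c hc
    have h2 := hδ c (cls_sub hc)
    constructor
    · intro h
      have := hℓpos _ h
      rw [h1] at this
      exact (pos_iff_pos_of_mul_pos this).1 h2
    · intro h
      by_contra h3
      have := hℓneg _ (hWR s n c (B.pi_mem_R (cls_sub hc))) h3
      rw [h1] at this
      have := mul_pos h2 h
      linarith
  have hinv : ∀ (f : ℝ → ℝ) (s n : ℕ), (∀ k < n, 0 < kap μ k) →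
      B.invSum f (B.altWord χ s n) =
        ∑ k ∈ Finset.range n, ∑ a ∈ B.cls χ (s + k), f (S.I a a) := by
    intro f s n hn
    induction n with
    | zero =>
      rw [Finset.range_zero, Finset.sum_empty, invSum]
      exact Finset.sum_eq_zero fun α hα => if_pos hα
    | succ n ih =>
      rw [altWord, B.invSum_append f, ih fun k hk => hn k (by omega), Finset.sum_range_succ,
        Finset.sum_map_toList, add_comm]
      · exact fun a ha => cls_sub (Finset.mem_toList.1 ha)
      · exact cls_pairwise hχ _
      · intro a ha
        exact (hkpos s n a (Finset.mem_toList.1 ha)).2 (hn n (by omega))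
  have hex : ∃ n, ¬ 0 < kap μ n := by
    by_contra hcon
    push Not at hcon
    have h1 := hinv (fun _ => 1) 0 (B.Pos.card + 1) fun k _ => hcon k
    have h2 : B.invSum (fun _ => 1) (B.altWord χ 0 (B.Pos.card + 1)) ≤ B.Pos.card := by
      rw [invSum, Finset.card_eq_sum_ones, Nat.cast_sum]
      exact Finset.sum_le_sum fun α _ => by split_ifs <;> simp
    have h3 : ((B.Pos.card + 1 : ℕ) : ℝ) ≤ ∑ k ∈ Finset.range (B.Pos.card + 1),
        ∑ a ∈ B.cls χ (0 + k), (1 : ℝ) := by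
      have : ∑ k ∈ Finset.range (B.Pos.card + 1), (1 : ℝ) ≤ ∑ k ∈ Finset.range (B.Pos.card + 1),
          ∑ a ∈ B.cls χ (0 + k), (1 : ℝ) := Finset.sum_le_sum fun k _ => by
        rw [Finset.sum_const, nsmul_eq_mul, mul_one]
        exact_mod_cast Finset.card_pos.2 (hclsne _)
      simpa using this
    rw [← h1] at h3
    push_cast at h3
    linarith
  obtain ⟨M, hM, hMmin⟩ : ∃ M, ¬ 0 < kap μ M ∧ ∀ k < M, 0 < kap μ k :=
    ⟨Nat.find hex, Nat.find_spec hex, fun k hk => by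
      have := Nat.find_min hex hk; push Not at this; exact this⟩
  have hM0 : 0 < M := by
    rcases Nat.eq_zero_or_pos M with h | h
    · subst h; exact absurd (by simp [kap]) hM
    · exact h
  have hsimple : ∀ s, ∀ c ∈ B.Pi, W s M c ∉ B.Pos := by
    intro s c hc
    obtain ⟨m, rfl⟩ : ∃ m, M = m + 1 := ⟨M - 1, by omega⟩
    rcases mem_cls_or (B := B) (χ := χ) hc (s + m) with h | h
    · simp only [hW]
      rw [word_altWord_prev hχ s m h]
      exact fun h' => B.not_both _ ((hkpos s m c h).2 (hMmin m (by omega))) h'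
    · rw [hkpos s (m + 1) c h]; exact hM
  have hflip : ∀ s, ∀ α ∈ B.Pos, W s M α ∉ B.Pos := by
    intro s α hα h
    have h1 := hℓpos _ h
    have h2 : ℓ (W s M α) ≤ 0 := by
      rw [B.sum_coord α, map_sum, map_sum]
      refine Finset.sum_nonpos fun b _ => ?_
      rw [map_smul, map_smul, smul_eq_mul]
      exact mul_nonpos_of_nonneg_of_nonpos (B.coord_nonneg hα b)
        (hℓneg _ (hWR s M b (B.pi_mem_R b.2)) (hsimple s b b.2)).le
    linarith
  have hcount : ∀ f : ℝ → ℝ,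
      2 * ∑ α ∈ B.Pos, f (S.I α α) = M * ∑ b ∈ B.Pi, f (S.I b b) := by
    intro f
    have h1 : ∀ s, ∑ α ∈ B.Pos, f (S.I α α) =
        ∑ k ∈ Finset.range M, ∑ a ∈ B.cls χ (s + k), f (S.I a a) := fun s => by
      rw [← hinv f s M hMmin, invSum]
      exact Finset.sum_congr rfl fun α hα => (if_neg (hflip s α hα)).symm
    calc _ = ∑ k ∈ Finset.range M, (∑ a ∈ B.cls χ (0 + k), f (S.I a a) +
          ∑ a ∈ B.cls χ (1 + k), f (S.I a a)) := by
          rw [Finset.sum_add_distrib, ← h1, ← h1, two_mul]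
      _ = _ := by
          rw [Finset.sum_congr rfl fun k _ => by rw [zero_add, add_comm 1 k, sum_cls_add]]
          simp
  have hWneg : ∀ s n α, W s n (-α) = -W s n α := fun s n α => map_neg _ _
  have hWM : S.word (B.altWord χ 0 2) ^ M = 1 := by
    rw [← word_altWord_even]
    refine B.word_eq_one _ (altWord_sub 0 _) fun a ha => ?_
    rw [two_mul, word_altWord_add, Module.End.mul_apply]
    have h1 := hsimple (0 + M) a ha
    have haR := hWR (0 + M) M a (B.pi_mem_R ha)
    have h2 := (B.mem_or_neg _ haR).resolve_left h1
    have h3 := hflip 0 _ h2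
    rw [hWneg] at h3
    have h4 := (B.mem_or_neg _ (neg_mem (hWR 0 M _ haR))).resolve_left h3
    rwa [neg_neg] at h4
  have hWk : ∀ k < M, 0 < k → S.word (B.altWord χ 0 2) ^ k ≠ 1 := by
    intro k hkM hk0 h1
    rw [← word_altWord_even] at h1
    obtain ⟨j, hj⟩ : ∃ j, 2 * k = j + 1 := ⟨2 * k - 1, by omega⟩
    obtain ⟨c, hc⟩ := hclsne (0 + 2 * k)
    have hkap1 : 0 < kap μ (2 * k) := by
      rw [← hkpos 0 (2 * k) c hc]
      simp only [hW, h1, Module.End.one_apply]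
      exact B.pi_sub (cls_sub hc)
    obtain ⟨d, hd⟩ := hclsne (0 + j)
    have hkap2 : ¬ 0 < kap μ j := by
      rw [← hkpos 0 j d hd]
      have := word_altWord_prev hχ 0 j hd
      rw [← hj, h1, Module.End.one_apply] at this
      intro h
      refine B.not_both _ h ?_
      simp only [hW]
      rw [← this]
      exact B.pi_sub (cls_sub hd)
    have hMj : M ≤ j := by
      by_contra h
      exact hkap2 (hMmin j (by omega))
    obtain ⟨i, hi⟩ : ∃ i, 2 * k = M + i := ⟨2 * k - M, by omega⟩
    rw [hi] at hkap1 hc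
    rw [← hkpos 0 (M + i) c hc] at hkap1
    simp only [hW] at hkap1
    rw [word_altWord_add, Module.End.mul_apply] at hkap1
    refine hflip 0 _ ?_ hkap1
    exact (hkpos (0 + M) i c (by rw [add_assoc]; exact hc)).2 (hMmin i (by omega))
  have hox : CoxEq (fun a b => S.I a b = 0) lst (B.altWord χ 0 2) := by
    refine CoxEq.of_forest horths B.Pi hleaf _ _ hnd ?_ hset ?_
    · simp only [altWord, List.append_nil]
      rw [List.nodup_append]
      refine ⟨Finset.nodup_toList _, Finset.nodup_toList _, fun a ha b hb => ?_⟩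
      rw [Finset.mem_toList] at ha hb
      rintro rfl
      rw [cls_succ, Finset.mem_sdiff] at ha
      exact ha.2 hb
    · ext a
      simp only [altWord, List.append_nil, List.mem_toFinset, List.mem_append, Finset.mem_toList]
      exact ⟨fun h => h.elim cls_sub cls_sub, fun h => (mem_cls_or h _).symm⟩
  have hpow : ∀ k, cx ^ k = 1 ↔ S.word (B.altWord χ 0 2) ^ k = 1 := by
    intro k
    rw [← word_pow_of_coxEq hox (fun a ha => B.pi_mem_R (by
      rw [← hset, List.mem_toFinset]; exact ha))]
    have h1 : ∀ x, (cx ^ k) x = (S.word lst ^ k) x := by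
      intro x
      induction k generalizing x with
      | zero => rfl
      | succ k ih =>
        rw [pow_succ, pow_succ, LinearEquiv.mul_apply, Module.End.mul_apply, ih, hcx]
    constructor
    · intro h; ext x; rw [← h1, h]; rfl
    · intro h; ext x; rw [h1, h]; rfl
  have : orderOf cx = M := by
    rw [orderOf_eq_iff hM0]
    exact ⟨(hpow M).2 hWM, fun m hm hm0 h => hWk m hm hm0 ((hpow m).1 h)⟩
  rw [this]
  exact hcount g

end Base

namespace Base

open RootSys

variable {V : Type} [AddCommGroup V] [Module ℝ V] {S : RootSys V} (B : Base S)

/-- Alternating sum over the expansion of the Weyl denominator. -/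
noncomputable def altSum (H : V → ℝ) : ℝ :=
  ∑ E ∈ B.Pos.powerset, (-1) ^ E.card * H (weylVec B - ∑ α ∈ E, α)

lemma altSum_erase {a : V} (ha : a ∈ B.Pi) (H : V → ℝ) :
    B.altSum H = ∑ E ∈ (B.Pos.erase a).powerset, (-1) ^ E.card *
      (H (weylVec B - ∑ α ∈ E, α) - H (weylVec B - a - ∑ α ∈ E, α)) := by
  rw [altSum, ← Finset.insert_erase (B.pi_sub ha), Finset.sum_powerset_insert
    (Finset.notMem_erase _ _), ← Finset.sum_add_distrib, Finset.erase_insert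
    (Finset.notMem_erase _ _)]
  refine Finset.sum_congr rfl fun E hE => ?_
  have haE : a ∉ E := fun h => Finset.notMem_erase _ _ (Finset.mem_powerset.1 hE h)
  rw [Finset.card_insert_of_notMem haE, Finset.sum_insert haE, pow_succ, sub_sub]
  ring

lemma altSum_refl {a : V} (ha : a ∈ B.Pi) (H : V → ℝ) :
    B.altSum (fun x => H (S.refl a x)) = -B.altSum H := by
  have haR := B.pi_mem_R ha
  have hinj : Function.Injective (S.refl a) := (reflEquiv haR).injective
  have himg : ∀ E : Finset V, (E.image (S.refl a)).image (S.refl a) = E := fun E => by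
    rw [Finset.image_image]
    have : (S.refl a : V → V) ∘ S.refl a = id := funext fun x => refl_refl haR x
    rw [this, Finset.image_id]
  have hsub : ∀ E ∈ (B.Pos.erase a).powerset,
      E.image (S.refl a) ∈ (B.Pos.erase a).powerset := fun E hE => by
    rw [Finset.mem_powerset] at hE ⊢
    intro x hx
    obtain ⟨y, hy, rfl⟩ := Finset.mem_image.1 hx
    have := Finset.mem_erase.1 (hE hy)
    exact Finset.mem_erase.2 ⟨B.refl_ne_self this.2 ha, B.refl_mem_pos this.2 ha this.1⟩
  rw [B.altSum_erase ha, B.altSum_erase ha, ← Finset.sum_neg_distrib]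
  refine Finset.sum_bij (fun E _ => E.image (S.refl a)) hsub
    (fun E _ F _ h => by rw [← himg E, h, himg]) (fun E hE => ⟨_, hsub E hE, himg E⟩) ?_
  intro E _
  rw [Finset.card_image_of_injective _ hinj, Finset.sum_image hinj.injOn]
  simp only [map_sub, map_sum, B.refl_weylVec ha, refl_self haR]
  rw [sub_neg_eq_add, sub_add_cancel]
  ring

/-- Coefficients of the Weyl denominator. -/
noncomputable def denCoeff (μ : V) : ℝ := B.altSum fun x => if x = μ then 1 else 0

lemma denCoeff_refl {a : V} (ha : a ∈ B.Pi) (μ : V) :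
    B.denCoeff (S.refl a μ) = -B.denCoeff μ := by
  rw [denCoeff, denCoeff, ← B.altSum_refl ha]
  congr 1
  ext x
  have : S.refl a x = μ ↔ x = S.refl a μ := by
    constructor
    · rintro rfl; rw [refl_refl (B.pi_mem_R ha)]
    · rintro rfl; rw [refl_refl (B.pi_mem_R ha)]
  simp only [this]

/-- The vectors appearing in the expansion of the Weyl denominator. -/
noncomputable def denSupp : Finset V := B.Pos.powerset.image fun E => weylVec B - ∑ α ∈ E, α

lemma altSum_eq (H : V → ℝ) : B.altSum H = ∑ μ ∈ B.denSupp, B.denCoeff μ * H μ := by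
  simp only [denCoeff, altSum, Finset.sum_mul]
  rw [Finset.sum_comm]
  refine Finset.sum_congr rfl fun E hE => ?_
  rw [Finset.sum_eq_single_of_mem (weylVec B - ∑ α ∈ E, α)
    (show _ ∈ B.denSupp from Finset.mem_image_of_mem (fun E => weylVec B - ∑ α ∈ E, α) hE)]
  · simp
  · intro μ _ h; simp [h.symm]

lemma mem_denSupp {μ : V} (h : B.denCoeff μ ≠ 0) :
    ∃ E ⊆ B.Pos, μ = weylVec B - ∑ α ∈ E, α := by
  obtain ⟨E, hE, h1⟩ := Finset.exists_ne_zero_of_sum_ne_zero h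
  refine ⟨E, Finset.mem_powerset.1 hE, ?_⟩
  by_contra h2
  exact h1 (by simp [Ne.symm h2])

lemma sum_pos_eq_zero {E : Finset V} (hE : E ⊆ B.Pos)
    (h : ∀ a ∈ B.Pi, S.I a (∑ α ∈ E, α) ≤ 0) : ∑ α ∈ E, α = 0 := by
  refine eq_zero_of_I_self (S := S) (le_antisymm ?_ (I_self_nonneg _))
  rw [B.I_eq_sum_coord]
  refine Finset.sum_nonpos fun b _ => mul_nonpos_of_nonneg_of_nonpos ?_ ?_
  · rw [map_sum]; exact Finset.sum_nonneg fun α hα => B.coord_nonneg (hE hα) b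
  · rw [S.symm]; exact h b b.2

lemma eq_empty_of_sum_eq_zero {E : Finset V} (hE : E ⊆ B.Pos) (h : ∑ α ∈ E, α = 0) : E = ∅ := by
  by_contra hne
  obtain ⟨α, hα⟩ := Finset.nonempty_iff_ne_empty.2 hne
  have h1 : 0 < ∑ α ∈ E, S.I (weylVec B) α :=
    Finset.sum_pos (fun α hα => B.I_weylVec_pos (hE hα)) ⟨α, hα⟩
  rw [← map_sum, h, map_zero] at h1
  exact lt_irrefl _ h1

lemma denCoeff_weylVec : B.denCoeff (weylVec B) = 1 := by
  rw [denCoeff, altSum, Finset.sum_eq_single ∅]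
  · simp
  · intro E hE hne
    rw [if_neg, mul_zero]
    intro h
    exact hne (B.eq_empty_of_sum_eq_zero (Finset.mem_powerset.1 hE) (sub_eq_self.1 h))
  · intro h; simp at h

lemma denCoeff_induction {C : V → Prop} (h0 : C (weylVec B))
    (h1 : ∀ a ∈ B.Pi, ∀ x, C x → C (S.refl a x)) {μ : V} (h : B.denCoeff μ ≠ 0) : C μ := by
  have hnat : ∀ μ, B.denCoeff μ ≠ 0 → ∃ n : ℕ, B.height (weylVec B - μ) = n := fun μ h => by
    obtain ⟨E, hE, rfl⟩ := B.mem_denSupp h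
    choose f hf using fun (p : {x // x ∈ E} × {x // x ∈ B.Pi}) => B.coord_nat (hE p.1.2) p.2
    refine ⟨∑ b : {x // x ∈ B.Pi}, ∑ α : {x // x ∈ E}, f (α, b), ?_⟩
    rw [sub_sub_cancel, height]
    push_cast
    refine Finset.sum_congr rfl fun b _ => ?_
    rw [map_sum, ← Finset.sum_coe_sort E]
    exact Finset.sum_congr rfl fun α _ => hf (α, b)
  obtain ⟨n, hn⟩ := hnat μ h
  induction n using Nat.strong_induction_on generalizing μ with
  | _ n ih =>
    by_cases hdom : ∃ a ∈ B.Pi, S.co a μ ≤ 0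
    · obtain ⟨a, ha, hneg⟩ := hdom
      have hb := B.denCoeff_refl ha μ
      have haR := B.pi_mem_R ha
      have h2 : B.denCoeff (S.refl a μ) ≠ 0 := by rw [hb]; exact neg_ne_zero.2 h
      obtain ⟨m, hm⟩ := hnat _ h2
      have hht : B.height (weylVec B - S.refl a μ) = B.height (weylVec B - μ) + S.co a μ := by
        rw [refl_apply, height, height, show weylVec B - (μ - S.co a μ • a) =
          (weylVec B - μ) + S.co a μ • a by abel]
        simp only [map_add, map_smul, Finset.sum_add_distrib, smul_eq_mul]
        congr 1
        rw [Finset.sum_eq_single (⟨a, ha⟩ : {x // x ∈ B.Pi})]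
        · rw [B.coord_self ⟨a, ha⟩, mul_one]
        · intro b _ hb
          rw [B.coord_ne (a := ⟨a, ha⟩) (fun h => hb (Subtype.ext h.symm)), mul_zero]
        · simp
      rcases hneg.lt_or_eq with hlt | heq
      · have hmn : m < n := by
          rw [hm, hn] at hht
          have : (m : ℝ) < n := by linarith
          exact_mod_cast this
        have := h1 a ha _ (ih m hmn h2 hm)
        rwa [refl_refl haR] at this
      · rw [refl_apply, heq, zero_smul, sub_zero] at hb
        exact absurd (by linarith) h
    · push Not at hdom
      obtain ⟨E, hE, rfl⟩ := B.mem_denSupp h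
      rw [B.sum_pos_eq_zero hE, sub_zero]
      · exact h0
      · intro a ha
        have h3 := hdom a ha
        have hcoint : ∃ k : ℤ, S.co a (∑ α ∈ E, α) = k := by
          choose f hf using fun (p : {x // x ∈ E}) =>
            co_int (B.pi_mem_R ha) (B.pos_sub (hE p.2))
          refine ⟨∑ α : {x // x ∈ E}, f α, ?_⟩
          rw [map_sum, ← Finset.sum_coe_sort E]
          push_cast
          exact Finset.sum_congr rfl fun α _ => hf α
        obtain ⟨k, hk⟩ := hcoint
        rw [map_sub, B.co_weylVec ha, hk] at h3
        have h4 : k ≤ 0 := by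
          have : (k : ℝ) < 1 := by linarith
          have h5 : k < 1 := by exact_mod_cast this
          omega
        have h6 : S.co a (∑ α ∈ E, α) ≤ 0 := by rw [hk]; exact_mod_cast h4
        rw [co_apply] at h6
        have hp := I_self_pos (B.pi_mem_R ha)
        by_contra h7
        push Not at h7
        have : 0 < 2 / S.I a a * S.I a (∑ α ∈ E, α) := by positivity
        linarith

/-- The alternating sum of an antisymmetric function is a fixed positive multiple of its
value at the Weyl vector. -/
lemma exists_altSum : ∃ m : ℝ, 0 < m ∧ ∀ G : V → ℝ,
    (∀ a ∈ B.Pi, ∀ x, G (S.refl a x) = -G x) → B.altSum G = m * G (weylVec B) := by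
  have hmem : weylVec B ∈ B.denSupp.filter fun μ => B.denCoeff μ ≠ 0 := by
    rw [Finset.mem_filter, B.denCoeff_weylVec]
    exact ⟨Finset.mem_image.2 ⟨∅, by simp, by simp⟩, one_ne_zero⟩
  refine ⟨(B.denSupp.filter fun μ => B.denCoeff μ ≠ 0).card, ?_, fun G hG => ?_⟩
  · exact_mod_cast Finset.card_pos.2 ⟨_, hmem⟩
  · rw [altSum_eq, ← Finset.sum_filter_add_sum_filter_not _ (fun μ => B.denCoeff μ ≠ 0),
      Finset.sum_eq_zero (s := B.denSupp.filter fun μ => ¬ B.denCoeff μ ≠ 0), add_zero,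
      Finset.sum_congr rfl (g := fun _ => G (weylVec B)), Finset.sum_const, nsmul_eq_mul]
    · intro μ hμ
      refine B.denCoeff_induction (C := fun μ => B.denCoeff μ * G μ = G (weylVec B)) ?_ ?_
        (Finset.mem_filter.1 hμ).2
      · rw [B.denCoeff_weylVec, one_mul]
      · intro a ha x h
        rw [B.denCoeff_refl ha, hG a ha, neg_mul_neg, h]
    · intro μ hμ
      have := (Finset.mem_filter.1 hμ).2
      push Not at this
      rw [this, zero_mul]

lemma altSum_norm (G : V → ℝ) :
    B.altSum (fun x => S.I x x * G x) = S.I (weylVec B) (weylVec B) * B.altSum G := by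
  rw [altSum_eq, altSum_eq, Finset.mul_sum]
  refine Finset.sum_congr rfl fun μ _ => ?_
  by_cases h : B.denCoeff μ = 0
  · simp [h]
  · have : S.I μ μ = S.I (weylVec B) (weylVec B) :=
      B.denCoeff_induction (C := fun μ => S.I μ μ = S.I (weylVec B) (weylVec B)) rfl
        (fun a ha x hx => by rw [I_refl_refl (B.pi_mem_R ha), hx]) h
    rw [this]; ring

lemma prod_sinh (z : V) : ∏ α ∈ B.Pos, 2 * Real.sinh (S.I α z / 2) =
    B.altSum fun x => Real.exp (S.I x z) := by
  have h1 : ∀ α ∈ B.Pos, 2 * Real.sinh (S.I α z / 2) =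
      -Real.exp (-(S.I α z / 2)) + Real.exp (S.I α z / 2) := fun α _ => by
    rw [Real.sinh_eq]; ring
  rw [Finset.prod_congr rfl h1, Finset.prod_add, altSum]
  refine Finset.sum_congr rfl fun E hE => ?_
  rw [Finset.mem_powerset] at hE
  rw [Finset.prod_neg, mul_assoc, ← Real.exp_sum, ← Real.exp_sum, ← Real.exp_add]
  congr 2
  simp only [weylVec, map_sub, map_smul, map_sum, LinearMap.sub_apply, LinearMap.smul_apply,
    LinearMap.sum_apply, smul_eq_mul]
  rw [← Finset.sum_sdiff hE, Finset.sum_neg_distrib, ← Finset.sum_div, ← Finset.sum_div]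
  ring

end Base

lemma abs_exp_sub_sum_le (x : ℝ) (n : ℕ) :
    |Real.exp x - ∑ m ∈ Finset.range n, x ^ m / (m.factorial : ℝ)| ≤
      |x| ^ n * Real.exp |x| := by
  have h := Complex.norm_exp_sub_sum_le_norm_mul_exp (x : ℂ) n
  rw [Complex.norm_real, Real.norm_eq_abs] at h
  rw [← Real.norm_eq_abs, ← Complex.norm_real]
  push_cast
  exact h

lemma abs_sinh_sub_le (y : ℝ) : |Real.sinh y - y| ≤ |y| ^ 3 * Real.exp |y| := by
  have h1 := abs_exp_sub_sum_le y 3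
  have h2 := abs_exp_sub_sum_le (-y) 3
  rw [abs_neg] at h2
  norm_num [Finset.sum_range_succ] at h1 h2
  rw [Real.sinh_eq]
  rw [abs_le] at *
  constructor <;> linarith [h1.1, h1.2, h2.1, h2.2]

lemma abs_sinh_sub_cubic_le (y : ℝ) :
    |Real.sinh y - y - y ^ 3 / 6| ≤ |y| ^ 5 * Real.exp |y| := by
  have h1 := abs_exp_sub_sum_le y 5
  have h2 := abs_exp_sub_sum_le (-y) 5
  rw [abs_neg] at h2
  norm_num [Finset.sum_range_succ, Nat.factorial] at h1 h2
  rw [Real.sinh_eq]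
  have e3 : (-y) ^ 3 = - y ^ 3 := by ring
  rw [e3] at h2
  rw [abs_le] at *
  constructor <;> linarith [h1.1, h1.2, h2.1, h2.2]

lemma abs_cosh_sub_le (y : ℝ) :
    |Real.cosh y - 1 - y ^ 2 / 2| ≤ |y| ^ 4 * Real.exp |y| := by
  have h1 := abs_exp_sub_sum_le y 4
  have h2 := abs_exp_sub_sum_le (-y) 4
  rw [abs_neg] at h2
  norm_num [Finset.sum_range_succ, Nat.factorial] at h1 h2
  rw [Real.cosh_eq]
  have e3 : (-y) ^ 3 = - y ^ 3 := by ring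
  rw [e3] at h2
  rw [abs_le] at *
  constructor <;> linarith [h1.1, h1.2, h2.1, h2.2]

open Filter Topology

/-- A quotient that differs from `c` by `O(y)` tends to `c`. -/
lemma tendsto_of_abs_sub_le {f : ℝ → ℝ} {c : ℝ} {n : ℕ} (hn : n ≠ 0) (C : ℝ)
    (h : ∀ y, y ≠ 0 → |f y - c| ≤ C * (|y| ^ n * Real.exp |y|)) :
    Tendsto f (𝓝[≠] 0) (𝓝 c) := by
  rw [tendsto_iff_norm_sub_tendsto_zero]
  have hc : Continuous fun y : ℝ => C * (|y| ^ n * Real.exp |y|) := by fun_prop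
  have h0 : Tendsto (fun y : ℝ => C * (|y| ^ n * Real.exp |y|)) (𝓝[≠] 0) (𝓝 0) := by
    have := (hc.tendsto 0).mono_left (nhdsWithin_le_nhds (s := {0}ᶜ))
    simpa [hn] using this
  refine squeeze_zero' (Eventually.of_forall fun _ => norm_nonneg _) ?_ h0
  filter_upwards [self_mem_nhdsWithin] with y hy
  exact h y hy

lemma tendsto_sinh_div : Tendsto (fun y : ℝ => Real.sinh y / y) (𝓝[≠] 0) (𝓝 1) := by
  refine tendsto_of_abs_sub_le (n := 2) (by norm_num) 1 fun y hy => ?_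
  have hy' : 0 < |y| := abs_pos.2 hy
  rw [div_sub_one hy, abs_div, div_le_iff₀ hy']
  calc _ ≤ _ := abs_sinh_sub_le y
    _ = _ := by ring

lemma tendsto_coth_sub :
    Tendsto (fun y : ℝ => (y * Real.cosh y - Real.sinh y) / y ^ 3) (𝓝[≠] 0) (𝓝 (1 / 3)) := by
  refine tendsto_of_abs_sub_le (n := 2) (by norm_num) 2 fun y hy => ?_
  have hy' : 0 < |y| := abs_pos.2 hy
  have h3 : y ^ 3 ≠ 0 := pow_ne_zero 3 hy
  have : (y * Real.cosh y - Real.sinh y) / y ^ 3 - 1 / 3 =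
      (y * (Real.cosh y - 1 - y ^ 2 / 2) - (Real.sinh y - y - y ^ 3 / 6)) / y ^ 3 := by
    field_simp; ring
  rw [this, abs_div, div_le_iff₀ (abs_pos.2 h3), abs_pow]
  calc _ ≤ _ := abs_sub _ _
    _ ≤ |y| * (|y| ^ 4 * Real.exp |y|) + |y| ^ 5 * Real.exp |y| := by
      rw [abs_mul]
      exact add_le_add (mul_le_mul_of_nonneg_left (abs_cosh_sub_le y) hy'.le)
        (abs_sinh_sub_cubic_le y)
    _ = _ := by ring

/-- `y coth y`. -/
noncomputable def ycoth (y : ℝ) : ℝ := y * Real.cosh y / Real.sinh y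

lemma tendsto_ycoth_sub : Tendsto (fun y : ℝ => (ycoth y - 1) / y ^ 2) (𝓝[≠] 0) (𝓝 (1 / 3)) := by
  have := tendsto_coth_sub.div tendsto_sinh_div one_ne_zero
  rw [div_one] at this
  refine this.congr' ?_
  filter_upwards [self_mem_nhdsWithin] with y hy
  have hy : y ≠ 0 := hy
  have hs : Real.sinh y ≠ 0 := by rwa [Ne, Real.sinh_eq_zero]
  simp only [ycoth, Pi.div_apply]
  field_simp

lemma tendsto_mul_right_punctured {x : ℝ} (hx : 0 < x) :
    Tendsto (fun s : ℝ => s * x) (𝓝[>] 0) (𝓝[≠] 0) := by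
  refine tendsto_nhdsWithin_iff.2 ⟨?_, ?_⟩
  · have : Continuous fun s : ℝ => s * x := by fun_prop
    simpa using (this.tendsto 0).mono_left (nhdsWithin_le_nhds (s := Set.Ioi 0))
  · filter_upwards [self_mem_nhdsWithin] with s hs
    exact (mul_pos hs hx).ne'

lemma tendsto_ycoth_sub_scaled {x : ℝ} (hx : 0 < x) :
    Tendsto (fun s : ℝ => (ycoth (s * x) - 1) / s ^ 2) (𝓝[>] 0) (𝓝 (x ^ 2 / 3)) := by
  have := (tendsto_ycoth_sub.comp (tendsto_mul_right_punctured hx)).mul_const (x ^ 2)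
  rw [show x ^ 2 / 3 = 1 / 3 * x ^ 2 by ring]
  refine this.congr' ?_
  filter_upwards [self_mem_nhdsWithin] with s hs
  have hs : s ≠ 0 := ne_of_gt hs
  simp only [Function.comp]
  field_simp

lemma tendsto_ycoth_scaled {x : ℝ} (hx : 0 < x) :
    Tendsto (fun s : ℝ => ycoth (s * x)) (𝓝[>] 0) (𝓝 1) := by
  have h2 : Tendsto (fun s : ℝ => s ^ 2) (𝓝[>] 0) (𝓝 0) := by
    have : Continuous fun s : ℝ => s ^ 2 := by fun_prop
    simpa using (this.tendsto 0).mono_left (nhdsWithin_le_nhds (s := Set.Ioi 0))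
  have := ((tendsto_ycoth_sub_scaled hx).mul h2).add_const 1
  rw [mul_zero, zero_add] at this
  refine this.congr' ?_
  filter_upwards [self_mem_nhdsWithin] with s hs
  have hs : s ≠ 0 := ne_of_gt hs
  field_simp
  ring

namespace Base

open RootSys

variable {V : Type} [AddCommGroup V] [Module ℝ V] {S : RootSys V} (B : Base S)

lemma altSum_sq_exp (z e : V) (hz : ∀ α ∈ B.Pos, S.I α z ≠ 0) :
    B.altSum (fun x => S.I x e * S.I x e * Real.exp (S.I x z)) =
      (∏ α ∈ B.Pos, 2 * Real.sinh (S.I α z / 2)) * ∑ α ∈ B.Pos, (S.I α e * S.I α e / 4 +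
        ∑ β ∈ B.Pos.erase α, S.I α e * S.I β e / 4 *
          (Real.cosh (S.I α z / 2) / Real.sinh (S.I α z / 2)) *
          (Real.cosh (S.I β z / 2) / Real.sinh (S.I β z / 2))) := by
  have hsinh : ∀ α ∈ B.Pos, Real.sinh (S.I α z / 2) ≠ 0 := fun α hα => by
    rw [Ne, Real.sinh_eq_zero]
    have := hz α hα
    intro h; apply this; linarith
  have hlin : ∀ α (τ : ℝ), HasDerivAt (fun τ : ℝ => S.I α (z + τ • e)) (S.I α e) τ := fun α τ => by
    have : (fun τ : ℝ => S.I α (z + τ • e)) = fun τ : ℝ => S.I α z + τ * S.I α e := by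
      ext τ; simp
    rw [this]
    simpa using ((hasDerivAt_id τ).mul_const (S.I α e)).const_add (S.I α z)
  have hs : ∀ α (τ : ℝ), HasDerivAt (fun τ : ℝ => 2 * Real.sinh (S.I α (z + τ • e) / 2))
      (Real.cosh (S.I α (z + τ • e) / 2) * S.I α e) τ := fun α τ => by
    have := (((hlin α τ).div_const 2).sinh).const_mul 2
    exact this.congr_deriv (by ring)
  have hc : ∀ α (τ : ℝ), HasDerivAt (fun τ : ℝ => Real.cosh (S.I α (z + τ • e) / 2) * S.I α e)
      (Real.sinh (S.I α (z + τ • e) / 2) * S.I α e * S.I α e / 2) τ := fun α τ => by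
    have := (((hlin α τ).div_const 2).cosh).mul_const (S.I α e)
    exact this.congr_deriv (by ring)
  have hexp : ∀ x (τ : ℝ), HasDerivAt (fun τ : ℝ => Real.exp (S.I x (z + τ • e)))
      (S.I x e * Real.exp (S.I x (z + τ • e))) τ := fun x τ => by
    have := (hlin x τ).exp
    rwa [mul_comm] at this
  have hD : ∀ (g g' : V → ℝ → ℝ) (τ : ℝ), (∀ x, HasDerivAt (g x) (g' x τ) τ) →
      HasDerivAt (fun τ => B.altSum fun x => g x τ) (B.altSum fun x => g' x τ) τ := by
    intro g g' τ h
    exact HasDerivAt.fun_sum fun E _ => (h _).const_mul _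
  have key : ∀ τ : ℝ, ∏ α ∈ B.Pos, 2 * Real.sinh (S.I α (z + τ • e) / 2) =
      B.altSum (fun x => Real.exp (S.I x (z + τ • e))) := fun τ => B.prod_sinh _
  have hd1 : ∀ τ : ℝ, ∑ α ∈ B.Pos, (∏ β ∈ B.Pos.erase α,
      2 * Real.sinh (S.I β (z + τ • e) / 2)) * (Real.cosh (S.I α (z + τ • e) / 2) * S.I α e) =
      B.altSum (fun x => S.I x e * Real.exp (S.I x (z + τ • e))) := fun τ => by
    have h1 := HasDerivAt.fun_finsetProd (u := B.Pos) (x := τ) fun α _ => hs α τ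
    simp only [smul_eq_mul] at h1
    have h2 := hD (fun x τ => Real.exp (S.I x (z + τ • e)))
      (fun x τ => S.I x e * Real.exp (S.I x (z + τ • e))) τ fun x => hexp x τ
    simp only [key] at h1
    exact h1.unique h2
  have h2 := hD (fun x τ => S.I x e * Real.exp (S.I x (z + τ • e)))
      (fun x τ => S.I x e * S.I x e * Real.exp (S.I x (z + τ • e))) 0 fun x => by
        have := (hexp x 0).const_mul (S.I x e)
        rwa [← mul_assoc] at this
  have h1 := HasDerivAt.fun_sum (u := B.Pos) (x := (0 : ℝ)) fun α _ =>
    (HasDerivAt.fun_finsetProd (u := B.Pos.erase α) (x := (0 : ℝ)) fun β _ => hs β 0).fun_mul (hc α 0)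
  simp only [smul_eq_mul] at h1
  simp only [← hd1] at h2
  have h4 := h2.unique h1
  simp only [zero_smul, add_zero] at h4
  rw [h4, Finset.mul_sum]
  refine Finset.sum_congr rfl fun α hα => ?_
  rw [mul_add, add_comm, Finset.mul_sum, Finset.sum_mul]
  congr 1
  · rw [← Finset.mul_prod_erase _ _ hα]
    ring
  · refine Finset.sum_congr rfl fun β hβ => ?_
    rw [← Finset.mul_prod_erase _ _ hα, ← Finset.mul_prod_erase _ _ hβ]
    have h5 := hsinh α hα
    have h6 := hsinh β (Finset.mem_of_mem_erase hβ)
    field_simp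
    ring

lemma coth_identity [FiniteDimensional ℝ V] (z : V) (hz : ∀ α ∈ B.Pos, S.I α z ≠ 0) :
    4 * S.I (weylVec B) (weylVec B) = ∑ α ∈ B.Pos, (S.I α α +
        ∑ β ∈ B.Pos.erase α, S.I α β *
          (Real.cosh (S.I α z / 2) / Real.sinh (S.I α z / 2)) *
          (Real.cosh (S.I β z / 2) / Real.sinh (S.I β z / 2))) := by
  obtain ⟨e, -, he⟩ := S.exists_orthonormal
  have h1 : ∑ i, B.altSum (fun x => S.I x (e i) * S.I x (e i) * Real.exp (S.I x z)) =
      S.I (weylVec B) (weylVec B) * ∏ α ∈ B.Pos, 2 * Real.sinh (S.I α z / 2) := by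
    rw [B.prod_sinh, ← B.altSum_norm]
    simp only [altSum]
    rw [Finset.sum_comm]
    refine Finset.sum_congr rfl fun E _ => ?_
    rw [← Finset.mul_sum, ← Finset.sum_mul]
    congr 2
    rw [← he]
    exact Finset.sum_congr rfl fun i _ => by rw [S.symm (e i)]
  simp only [B.altSum_sq_exp z _ hz, ← Finset.mul_sum] at h1
  have hne : ∏ α ∈ B.Pos, 2 * Real.sinh (S.I α z / 2) ≠ 0 := by
    refine Finset.prod_ne_zero_iff.2 fun α hα => mul_ne_zero two_ne_zero ?_
    rw [Ne, Real.sinh_eq_zero]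
    have := hz α hα
    intro h; apply this; linarith
  rw [mul_comm] at h1
  have h2 := mul_right_cancel₀ hne h1
  rw [← h2, Finset.sum_comm, Finset.mul_sum]
  refine Finset.sum_congr rfl fun α _ => ?_
  have hI : ∀ x y, S.I x y = ∑ i, S.I x (e i) * S.I y (e i) := fun x y => by
    rw [← he]
    exact Finset.sum_congr rfl fun i _ => by rw [S.symm (e i), S.symm (e i)]
  rw [Finset.sum_add_distrib, mul_add, Finset.sum_comm, Finset.mul_sum, Finset.mul_sum, hI α α]
  congr 1
  · exact Finset.sum_congr rfl fun i _ => by ring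
  · refine Finset.sum_congr rfl fun β _ => ?_
    rw [hI α β, ← Finset.sum_mul, ← Finset.sum_mul, ← Finset.sum_div]
    ring

/-- The strange formula of Freudenthal and de Vries. -/
lemma strange_formula [FiniteDimensional ℝ V] {k : ℝ} (hk : ∀ x, B.sumOp (fun _ => 1) x = k • x) :
    S.I (weylVec B) (weylVec B) = k * (B.Pi.card + 2 * B.Pos.card) / 12 := by
  set ρ := weylVec B with hρ
  set x : V → ℝ := fun α => S.I α ρ with hx
  have hxpos : ∀ α ∈ B.Pos, 0 < x α := fun α hα => by
    rw [hx]; simp only; rw [S.symm]; exact B.I_weylVec_pos hα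
  set M := S.I ρ ρ - (∑ α ∈ B.Pos, S.I α α) / 4 with hM
  set w : V → V → ℝ := fun α β => S.I α β / (x α * x β) with hw
  have key : ∀ s : ℝ, 0 < s → ∑ α ∈ B.Pos, ∑ β ∈ B.Pos.erase α,
      w α β * (ycoth (s * (x α / 2)) * ycoth (s * (x β / 2))) = s ^ 2 * M := by
    intro s hs
    have h := B.coth_identity (s • ρ) fun α hα => by
      rw [map_smul, smul_eq_mul]; exact (mul_pos hs (hxpos α hα)).ne'
    rw [Finset.sum_add_distrib] at h
    have h2 : s ^ 2 * M = s ^ 2 / 4 * (4 * S.I ρ ρ - ∑ α ∈ B.Pos, S.I α α) := by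
      rw [hM]; ring
    rw [h2, h, add_sub_cancel_left, Finset.mul_sum]
    refine Finset.sum_congr rfl fun α hα => ?_
    rw [Finset.mul_sum]
    refine Finset.sum_congr rfl fun β hβ => ?_
    have h3 := hxpos α hα
    have h4 := hxpos β (Finset.mem_of_mem_erase hβ)
    have e : ∀ γ, S.I γ (s • ρ) / 2 = s * (x γ / 2) := fun γ => by
      rw [map_smul, smul_eq_mul, mul_div_assoc]
    rw [e, e]
    simp only [ycoth, hw]
    field_simp
    ring
  have hev : ∀ᶠ s : ℝ in 𝓝[>] 0, 0 < s := self_mem_nhdsWithin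
  have hhalf : ∀ α ∈ B.Pos, 0 < x α / 2 := fun α hα => half_pos (hxpos α hα)
  have hsum0 : ∑ α ∈ B.Pos, ∑ β ∈ B.Pos.erase α, w α β = 0 := by
    have h1 : Tendsto (fun s : ℝ => ∑ α ∈ B.Pos, ∑ β ∈ B.Pos.erase α,
        w α β * (ycoth (s * (x α / 2)) * ycoth (s * (x β / 2)))) (𝓝[>] 0)
        (𝓝 (∑ α ∈ B.Pos, ∑ β ∈ B.Pos.erase α, w α β * (1 * 1))) :=
      tendsto_finsetSum _ fun α hα => tendsto_finsetSum _ fun β hβ =>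
        ((tendsto_ycoth_scaled (hhalf α hα)).mul
          (tendsto_ycoth_scaled (hhalf β (Finset.mem_of_mem_erase hβ)))).const_mul _
    have h2 : Tendsto (fun s : ℝ => s ^ 2 * M) (𝓝[>] 0) (𝓝 0) := by
      have : Continuous fun s : ℝ => s ^ 2 * M := by fun_prop
      simpa using (this.tendsto 0).mono_left (nhdsWithin_le_nhds (s := Set.Ioi 0))
    have h3 := tendsto_nhds_unique (h1.congr' (hev.mono key)) h2
    simpa using h3
  have hsum2 : ∑ α ∈ B.Pos, ∑ β ∈ B.Pos.erase α,
      w α β * (1 * ((x β / 2) ^ 2 / 3) + (x α / 2) ^ 2 / 3) = M := by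
    have h1 : Tendsto (fun s : ℝ => ∑ α ∈ B.Pos, ∑ β ∈ B.Pos.erase α,
        w α β * (ycoth (s * (x α / 2)) * ((ycoth (s * (x β / 2)) - 1) / s ^ 2) +
          (ycoth (s * (x α / 2)) - 1) / s ^ 2)) (𝓝[>] 0)
        (𝓝 (∑ α ∈ B.Pos, ∑ β ∈ B.Pos.erase α,
          w α β * (1 * ((x β / 2) ^ 2 / 3) + (x α / 2) ^ 2 / 3))) :=
      tendsto_finsetSum _ fun α hα => tendsto_finsetSum _ fun β hβ =>
        (((tendsto_ycoth_scaled (hhalf α hα)).mul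
          (tendsto_ycoth_sub_scaled (hhalf β (Finset.mem_of_mem_erase hβ)))).add
          (tendsto_ycoth_sub_scaled (hhalf α hα))).const_mul _
    refine tendsto_nhds_unique (h1.congr' ?_) tendsto_const_nhds
    filter_upwards [hev] with s hs
    have h2 := key s hs
    have : M = (s ^ 2 * M - ∑ α ∈ B.Pos, ∑ β ∈ B.Pos.erase α, w α β) / s ^ 2 := by
      rw [hsum0, sub_zero]; field_simp
    rw [this, ← h2, ← Finset.sum_sub_distrib, Finset.sum_div]
    refine Finset.sum_congr rfl fun α _ => ?_
    rw [← Finset.sum_sub_distrib, Finset.sum_div]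
    refine Finset.sum_congr rfl fun β _ => ?_
    field_simp
    ring
  have hswap : ∀ g : V → V → ℝ, ∑ α ∈ B.Pos, ∑ β ∈ B.Pos.erase α, g α β =
      ∑ α ∈ B.Pos, ∑ β ∈ B.Pos, g α β - ∑ α ∈ B.Pos, g α α := fun g => by
    rw [← Finset.sum_sub_distrib]
    refine Finset.sum_congr rfl fun α hα => ?_
    rw [← Finset.add_sum_erase _ _ hα]; ring
  have hquad : ∀ α, ∑ β ∈ B.Pos, S.I α β * x β = k * x α := fun α => by
    rw [← B.sumOp_quad hk]
    exact Finset.sum_congr rfl fun β _ => by rw [S.symm α β]; simp [hx]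
  have htr := B.sumOp_trace hk
  simp only [one_mul] at htr
  rw [hswap] at hsum2
  have e1 : ∑ α ∈ B.Pos, ∑ β ∈ B.Pos, w α β * (1 * ((x β / 2) ^ 2 / 3) + (x α / 2) ^ 2 / 3) =
      k * B.Pos.card / 6 := by
    have : ∀ α ∈ B.Pos, ∀ β ∈ B.Pos, w α β * (1 * ((x β / 2) ^ 2 / 3) + (x α / 2) ^ 2 / 3) =
        (S.I α β * x β) / x α / 12 + (S.I β α * x α) / x β / 12 := fun α hα β hβ => by
      have h3 := hxpos α hα
      have h4 := hxpos β hβ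
      rw [S.symm β α]
      simp only [hw]
      field_simp
      ring
    rw [Finset.sum_congr rfl fun α hα => Finset.sum_congr rfl fun β hβ => this α hα β hβ]
    simp only [Finset.sum_add_distrib]
    rw [Finset.sum_comm (f := fun α β => S.I β α * x α / x β / 12)]
    have h5 : ∑ α ∈ B.Pos, ∑ β ∈ B.Pos, S.I α β * x β / x α / 12 = k * B.Pos.card / 12 := by
      have : ∀ α ∈ B.Pos, ∑ β ∈ B.Pos, S.I α β * x β / x α / 12 = k / 12 := fun α hα => by
        rw [← Finset.sum_div, ← Finset.sum_div, hquad]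
        have h3 := hxpos α hα
        field_simp
      rw [Finset.sum_congr rfl this, Finset.sum_const, nsmul_eq_mul]
      ring
    rw [h5]; ring
  have e2 : ∑ α ∈ B.Pos, w α α * (1 * ((x α / 2) ^ 2 / 3) + (x α / 2) ^ 2 / 3) =
      k * B.Pi.card / 6 := by
    rw [htr, Finset.sum_div]
    refine Finset.sum_congr rfl fun α hα => ?_
    have h3 := hxpos α hα
    simp only [hw]
    field_simp
    ring
  rw [e1, e2, hM, ← htr] at hsum2
  linarith

end Base

/-- Second-order expansion of a finite product. -/
lemma tendsto_prod_sub_div {A : Type*} (T : Finset A) {g : A → ℝ → ℝ} {X Y : A → ℝ}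
    (h1 : ∀ a ∈ T, Tendsto (g a) (𝓝[>] 0) (𝓝 (X a)))
    (h2 : ∀ a ∈ T, Tendsto (fun s => (g a s - X a) / s ^ 2) (𝓝[>] 0) (𝓝 (X a * Y a))) :
    Tendsto (fun s => (∏ a ∈ T, g a s - ∏ a ∈ T, X a) / s ^ 2) (𝓝[>] 0)
      (𝓝 ((∏ a ∈ T, X a) * ∑ a ∈ T, Y a)) := by
  induction T using Finset.induction_on with
  | empty => simp
  | insert a T ha ih =>
    have h := ((h1 a (Finset.mem_insert_self _ _)).mul
      (ih (fun b hb => h1 b (Finset.mem_insert_of_mem hb))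
        fun b hb => h2 b (Finset.mem_insert_of_mem hb))).add
      ((h2 a (Finset.mem_insert_self _ _)).mul_const (∏ a ∈ T, X a))
    rw [Finset.prod_insert ha, Finset.sum_insert ha]
    simp only [Finset.prod_insert ha]
    refine (h.congr fun s => ?_).trans_eq ?_
    · ring
    · congr 1; ring

lemma eventually_small : ∀ᶠ s : ℝ in 𝓝[>] 0, 0 < s ∧ s ≤ 1 := by
  filter_upwards [Ioo_mem_nhdsGT (zero_lt_one (α := ℝ))] with s hs
  exact ⟨hs.1, hs.2.le⟩

lemma abs_le_exp_abs (X : ℝ) : |X| ≤ Real.exp |X| := by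
  linarith [Real.add_one_le_exp |X|]

lemma abs_cube_le_exp_abs (X : ℝ) : |X| ^ 3 ≤ 6 * Real.exp |X| := by
  have := Real.pow_div_factorial_le_exp |X| (abs_nonneg X) 3
  norm_num [Nat.factorial] at this
  linarith

lemma abs_two_sinh_div_sub_le {s : ℝ} (hs : 0 < s) (hs1 : s ≤ 1) (X : ℝ) :
    |2 * Real.sinh (s * X / 2) / s - X| ≤ 6 * s ^ 2 * Real.exp (2 * |X|) := by
  have h := abs_sinh_sub_le (s * X / 2)
  have e : |s * X / 2| = s * |X| / 2 := by
    rw [abs_div, abs_mul, abs_of_pos hs, abs_two]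
  rw [e] at h
  have h1 : 2 * Real.sinh (s * X / 2) / s - X = 2 / s * (Real.sinh (s * X / 2) - s * X / 2) := by
    field_simp
  have h2 : Real.exp (s * |X| / 2) ≤ Real.exp |X| := by
    apply Real.exp_le_exp.2
    nlinarith [abs_nonneg X]
  rw [h1, abs_mul, abs_of_pos (by positivity : 0 < 2 / s)]
  calc _ ≤ 2 / s * ((s * |X| / 2) ^ 3 * Real.exp (s * |X| / 2)) := by gcongr
    _ = s ^ 2 / 4 * |X| ^ 3 * Real.exp (s * |X| / 2) := by field_simp; ring
    _ ≤ s ^ 2 / 4 * (6 * Real.exp |X|) * Real.exp |X| := by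
      gcongr; exact abs_cube_le_exp_abs X
    _ = 6 / 4 * s ^ 2 * Real.exp (2 * |X|) := by rw [two_mul, Real.exp_add]; ring
    _ ≤ _ := by gcongr; norm_num

lemma abs_two_sinh_div_le {s : ℝ} (hs : 0 < s) (hs1 : s ≤ 1) (X : ℝ) :
    |2 * Real.sinh (s * X / 2) / s| ≤ Real.exp (2 * |X|) := by
  have h : ∀ y : ℝ, 0 ≤ y → Real.sinh y ≤ y * Real.exp y := fun y _ => by
    have h1 := Real.add_one_le_exp (-(2 * y))
    have h2 : Real.exp (-y) = Real.exp y * Real.exp (-(2 * y)) := by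
      rw [← Real.exp_add]; congr 1; ring
    rw [Real.sinh_eq, h2]
    nlinarith [Real.exp_pos y]
  have h1 := h |s * X / 2| (abs_nonneg _)
  rw [← Real.abs_sinh] at h1
  have e : |s * X / 2| = s * |X| / 2 := by
    rw [abs_div, abs_mul, abs_of_pos hs, abs_two]
  rw [e] at h1
  have h2 : Real.exp (s * |X| / 2) ≤ Real.exp |X| := by
    apply Real.exp_le_exp.2
    nlinarith [abs_nonneg X]
  rw [abs_div, abs_mul, abs_two, abs_of_pos hs, div_le_iff₀ hs]
  calc _ ≤ 2 * (s * |X| / 2 * Real.exp (s * |X| / 2)) := by gcongr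
    _ ≤ 2 * (s * Real.exp |X| / 2 * Real.exp |X|) := by
      gcongr
      exact abs_le_exp_abs X
    _ = _ := by rw [two_mul |X|, Real.exp_add]; ring

lemma tendsto_two_sinh_div (X : ℝ) :
    Tendsto (fun s : ℝ => 2 * Real.sinh (s * X / 2) / s) (𝓝[>] 0) (𝓝 X) := by
  rw [tendsto_iff_norm_sub_tendsto_zero]
  have h0 : Tendsto (fun s : ℝ => 6 * s ^ 2 * Real.exp (2 * |X|)) (𝓝[>] 0) (𝓝 0) := by
    have hc : Continuous fun s : ℝ => 6 * s ^ 2 * Real.exp (2 * |X|) := by fun_prop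
    simpa using (hc.tendsto 0).mono_left (nhdsWithin_le_nhds (s := Set.Ioi 0))
  refine squeeze_zero' (Eventually.of_forall fun _ => norm_nonneg _) ?_ h0
  filter_upwards [eventually_small] with s hs
  exact abs_two_sinh_div_sub_le hs.1 hs.2 X

lemma tendsto_two_sinh_div_sub (X : ℝ) :
    Tendsto (fun s : ℝ => (2 * Real.sinh (s * X / 2) / s - X) / s ^ 2) (𝓝[>] 0)
      (𝓝 (X * (X ^ 2 / 24))) := by
  rw [tendsto_iff_norm_sub_tendsto_zero]
  have h0 : Tendsto (fun s : ℝ => s ^ 2 / 16 * |X| ^ 5 * Real.exp (s * |X| / 2))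
      (𝓝[>] 0) (𝓝 0) := by
    have hc : Continuous fun s : ℝ => s ^ 2 / 16 * |X| ^ 5 * Real.exp (s * |X| / 2) := by fun_prop
    simpa using (hc.tendsto 0).mono_left (nhdsWithin_le_nhds (s := Set.Ioi 0))
  refine squeeze_zero' (Eventually.of_forall fun _ => norm_nonneg _) ?_ h0
  filter_upwards [eventually_small] with s hs
  have hs := hs.1
  have h := abs_sinh_sub_cubic_le (s * X / 2)
  have e : |s * X / 2| = s * |X| / 2 := by
    rw [abs_div, abs_mul, abs_of_pos hs, abs_two]
  rw [e] at h
  have h1 : (2 * Real.sinh (s * X / 2) / s - X) / s ^ 2 - X * (X ^ 2 / 24) =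
      2 / s ^ 3 * (Real.sinh (s * X / 2) - s * X / 2 - (s * X / 2) ^ 3 / 6) := by
    field_simp; ring
  rw [h1, Real.norm_eq_abs, abs_mul, abs_of_pos (by positivity : 0 < 2 / s ^ 3)]
  calc _ ≤ 2 / s ^ 3 * ((s * |X| / 2) ^ 5 * Real.exp (s * |X| / 2)) := by gcongr
    _ = _ := by field_simp; ring

section Expansion

variable {ι A : Type*} {c : ι → ℝ} {T : Finset A} {X : ι → A → ℝ}

lemma abs_prod_le_exp (T : Finset A) (X : A → ℝ) :
    |∏ a ∈ T, X a| ≤ Real.exp (2 * ∑ a ∈ T, |X a|) := by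
  rw [Finset.abs_prod, Finset.mul_sum, Real.exp_sum]
  refine Finset.prod_le_prod (fun _ _ => abs_nonneg _) fun a _ => (abs_le_exp_abs _).trans ?_
  apply Real.exp_le_exp.2
  linarith [abs_nonneg (X a)]

lemma abs_prod_sinh_le {s : ℝ} (hs : 0 < s) (hs1 : s ≤ 1) (T : Finset A) (X : A → ℝ) :
    |∏ a ∈ T, 2 * Real.sinh (s * X a / 2) / s| ≤ Real.exp (2 * ∑ a ∈ T, |X a|) := by
  rw [Finset.abs_prod, Finset.mul_sum, Real.exp_sum]
  exact Finset.prod_le_prod (fun _ _ => abs_nonneg _) fun a _ => abs_two_sinh_div_le hs hs1 _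

lemma abs_prod_sinh_sub_le {s : ℝ} (hs : 0 < s) (hs1 : s ≤ 1) (T : Finset A) (X : A → ℝ) :
    |∏ a ∈ T, 2 * Real.sinh (s * X a / 2) / s - ∏ a ∈ T, X a| ≤
      6 * T.card * s ^ 2 * Real.exp (2 * ∑ a ∈ T, |X a|) := by
  induction T using Finset.induction_on with
  | empty => simp
  | insert a T ha ih =>
    rw [Finset.prod_insert ha, Finset.prod_insert ha, Finset.sum_insert ha,
      Finset.card_insert_of_notMem ha]
    have h : ∀ p q r t : ℝ, p * q - r * t = p * (q - t) + (p - r) * t := fun _ _ _ _ => by ring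
    rw [h]
    refine (abs_add_le _ _).trans ?_
    rw [abs_mul, abs_mul]
    calc _ ≤ Real.exp (2 * |X a|) * (6 * T.card * s ^ 2 * Real.exp (2 * ∑ a ∈ T, |X a|)) +
          6 * s ^ 2 * Real.exp (2 * |X a|) * Real.exp (2 * ∑ a ∈ T, |X a|) := by
          gcongr
          · exact abs_two_sinh_div_le hs hs1 _
          · exact abs_two_sinh_div_sub_le hs hs1 _
          · exact abs_prod_le_exp T X
      _ = _ := by rw [mul_add, Real.exp_add]; push_cast; ring

lemma summable_mul_of_abs_le {f : ι → ℝ} {K : ℝ} {E : ι → ℝ} (hc : Summable fun i => |c i| * E i)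
    (hf : ∀ i, |f i| ≤ K * E i) : Summable fun i => c i * f i := by
  refine Summable.of_norm_bounded (hc.mul_left K) fun i => ?_
  rw [Real.norm_eq_abs, abs_mul]
  calc _ ≤ |c i| * (K * E i) := by gcongr; exact hf i
    _ = _ := by ring

lemma tendsto_tsum_sinh (hc : Summable fun i => |c i| * Real.exp (2 * ∑ a ∈ T, |X i a|)) :
    Tendsto (fun s : ℝ => ∑' i, c i * ∏ a ∈ T, 2 * Real.sinh (s * X i a / 2) / s) (𝓝[>] 0)
      (𝓝 (∑' i, c i * ∏ a ∈ T, X i a)) := by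
  refine tendsto_tsum_of_dominated_convergence hc (fun i => ?_) ?_
  · exact (tendsto_finsetProd _ fun a _ => tendsto_two_sinh_div _).const_mul _
  · filter_upwards [eventually_small] with s hs i
    rw [Real.norm_eq_abs, abs_mul]
    gcongr
    exact abs_prod_sinh_le hs.1 hs.2 T _

lemma tendsto_tsum_sinh_sub (hc : Summable fun i => |c i| * Real.exp (2 * ∑ a ∈ T, |X i a|)) :
    Tendsto (fun s : ℝ => ((∑' i, c i * ∏ a ∈ T, 2 * Real.sinh (s * X i a / 2) / s) -
        ∑' i, c i * ∏ a ∈ T, X i a) / s ^ 2) (𝓝[>] 0)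
      (𝓝 (∑' i, c i * ((∏ a ∈ T, X i a) * ∑ a ∈ T, X i a ^ 2 / 24))) := by
  have h := tendsto_tsum_of_dominated_convergence (hc.mul_left (6 * T.card : ℝ)) (𝓕 := 𝓝[>] (0 : ℝ))
    (f := fun s i => c i * ((∏ a ∈ T, 2 * Real.sinh (s * X i a / 2) / s - ∏ a ∈ T, X i a) / s ^ 2))
    (g := fun i => c i * ((∏ a ∈ T, X i a) * ∑ a ∈ T, X i a ^ 2 / 24))
    (fun i => (tendsto_prod_sub_div T (fun a _ => tendsto_two_sinh_div (X i a))
        fun a _ => tendsto_two_sinh_div_sub (X i a)).const_mul _) (by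
      filter_upwards [eventually_small] with s hs i
      rw [Real.norm_eq_abs, abs_mul, abs_div, abs_of_pos (by positivity [hs.1] : 0 < s ^ 2)]
      have := abs_prod_sinh_sub_le hs.1 hs.2 T (X i)
      have hs2 : 0 < s ^ 2 := pow_pos hs.1 2
      calc _ ≤ |c i| * ((6 * T.card * s ^ 2 * Real.exp (2 * ∑ a ∈ T, |X i a|)) / s ^ 2) := by
            gcongr
        _ = _ := by
          have := hs.1.ne'
          field_simp)
  refine h.congr' ?_
  filter_upwards [eventually_small] with s hs
  have s1 := summable_mul_of_abs_le (K := 1) hc (f := fun i => ∏ a ∈ T, 2 * Real.sinh (s * X i a / 2) / s)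
    fun i => by rw [one_mul]; exact abs_prod_sinh_le hs.1 hs.2 T _
  have s2 := summable_mul_of_abs_le (K := 1) hc (f := fun i => ∏ a ∈ T, X i a)
    fun i => by rw [one_mul]; exact abs_prod_le_exp T _
  rw [← s1.tsum_sub s2, ← tsum_div_const]
  refine tsum_congr fun i => ?_
  ring

end Expansion

/-- Termwise differentiation of a generalized Dirichlet series. -/
lemma hasDerivAt_tsum_exp {ι : Type*} {d e : ι → ℝ} (he : ∀ i, 0 ≤ e i)
    (h0 : ∀ u, 0 < u → Summable fun i => d i * Real.exp (-(u * e i)))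
    (h1 : ∀ u, 0 < u → Summable fun i => |d i| * e i * Real.exp (-(u * e i))) {u : ℝ} (hu : 0 < u) :
    HasDerivAt (fun u => ∑' i, d i * Real.exp (-(u * e i)))
      (∑' i, -(d i * e i * Real.exp (-(u * e i)))) u := by
  refine hasDerivAt_tsum_of_isPreconnected (h1 (u / 2) (half_pos hu)) isOpen_Ioi
    isPreconnected_Ioi (t := Set.Ioi (u / 2))
    (g' := fun i v => -(d i * e i * Real.exp (-(v * e i)))) ?_ ?_ (y₀ := u) ?_ (h0 u hu) ?_
  · intro i v _
    have := ((((hasDerivAt_id v).mul_const (e i)).fun_neg).exp).const_mul (d i)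
    simp only [id] at this
    exact this.congr_deriv (by ring)
  · intro i v hv
    rw [norm_neg, Real.norm_eq_abs, abs_mul, abs_mul, abs_of_nonneg (he i), Real.abs_exp]
    have hv : u / 2 < v := hv
    gcongr
    · exact mul_nonneg (abs_nonneg _) (he i)
    · exact he i
  · exact half_lt_self hu
  · exact half_lt_self hu

section Jacobi

/-- The finite product `(q; q)_n`. -/
noncomputable def qPoch (q : ℝ) (n : ℕ) : ℝ := ∏ i ∈ Finset.range n, (1 - q ^ (i + 1))

variable {q : ℝ} (hq0 : 0 < q) (hq1 : q < 1)

include hq0 hq1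

lemma one_sub_pow_pos (i : ℕ) : 0 < 1 - q ^ (i + 1) :=
  sub_pos.2 (pow_lt_one₀ hq0.le hq1 (Nat.succ_ne_zero i))

lemma qPoch_pos (n : ℕ) : 0 < qPoch q n :=
  Finset.prod_pos fun i _ => one_sub_pow_pos hq0 hq1 i

omit hq0 hq1 in
lemma qPoch_succ (n : ℕ) : qPoch q (n + 1) = qPoch q n * (1 - q ^ (n + 1)) :=
  Finset.prod_range_succ _ _

/-- The finite `q`-binomial theorem. -/
lemma q_binomial (m : ℕ) (z : ℝ) : ∏ i ∈ Finset.range m, (1 + z * q ^ i) =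
    ∑ k ∈ Finset.range (m + 1),
      q ^ (k.choose 2) * qPoch q m / (qPoch q k * qPoch q (m - k)) * z ^ k := by
  have hP := fun n => (qPoch_pos hq0 hq1 n).ne'
  induction m generalizing z with
  | zero => simp [qPoch]
  | succ m ih =>
    have h0 : qPoch q 0 = 1 := by simp [qPoch]
    have e : ∏ i ∈ Finset.range (m + 1), (1 + z * q ^ i) =
        (1 + z) * ∏ i ∈ Finset.range m, (1 + (z * q) * q ^ i) := by
      rw [Finset.prod_range_succ', mul_comm, pow_zero, mul_one]
      congr 1
      exact Finset.prod_congr rfl fun i _ => by rw [pow_succ]; ring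
    rw [e, ih, add_mul, one_mul]
    nth_rewrite 1 [Finset.sum_range_succ']
    rw [Finset.sum_range_succ, Finset.sum_range_succ (n := m + 1), Finset.sum_range_succ', mul_add,
      Finset.mul_sum]
    have hmid : ∀ k ∈ Finset.range m,
        q ^ ((k + 1).choose 2) * qPoch q (m + 1) / (qPoch q (k + 1) * qPoch q (m + 1 - (k + 1))) *
          z ^ (k + 1) =
        q ^ ((k + 1).choose 2) * qPoch q m / (qPoch q (k + 1) * qPoch q (m - (k + 1))) *
          (z * q) ^ (k + 1) +
        z * (q ^ (k.choose 2) * qPoch q m / (qPoch q k * qPoch q (m - k)) * (z * q) ^ k) := by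
      intro k hk
      obtain ⟨r, rfl⟩ := Nat.exists_eq_add_of_lt (Finset.mem_range.1 hk)
      have e1 : k + r + 1 + 1 - (k + 1) = r + 1 := by omega
      have e2 : k + r + 1 - (k + 1) = r := by omega
      have e3 : k + r + 1 - k = r + 1 := by omega
      have e4 : (k + 1).choose 2 = k + k.choose 2 := by
        rw [Nat.choose_succ_succ' k 1, Nat.choose_one_right]
      rw [e1, e2, e3, e4, qPoch_succ (k + r + 1), qPoch_succ k, qPoch_succ r]
      have h1 := hP k
      have h2 := hP r
      have h3 := (one_sub_pow_pos hq0 hq1 k).ne'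
      have h4 := (one_sub_pow_pos hq0 hq1 r).ne'
      field_simp
      ring
    rw [Finset.sum_congr rfl hmid, Finset.sum_add_distrib]
    have e4 : (m + 1).choose 2 = m + m.choose 2 := by
      rw [Nat.choose_succ_succ' m 1, Nat.choose_one_right]
    simp only [Nat.sub_self, Nat.sub_zero, h0, pow_zero, mul_one, e4, one_mul]
    have h1 := hP m
    have h2 := hP (m + 1)
    simp only [mul_div_assoc, div_self h1, div_self h2, show Nat.choose 0 2 = 0 from rfl, pow_zero,
      mul_one, mul_pow, pow_add]
    ring1

omit hq1 in
lemma prod_q_div (n : ℕ) : ∏ i ∈ Finset.range n, (1 - q ^ i / q ^ n) =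
    (-1) ^ n * qPoch q n / q ^ ((n + 1).choose 2) := by
  have hq := hq0.ne'
  rw [← Finset.prod_range_reflect]
  have h1 : ∀ j ∈ Finset.range n, 1 - q ^ (n - 1 - j) / q ^ n = -(1 - q ^ (j + 1)) / q ^ (j + 1) := by
    intro j hj
    have : q ^ n = q ^ (n - 1 - j) * q ^ (j + 1) := by
      rw [← pow_add]; congr 1
      have := Finset.mem_range.1 hj
      omega
    rw [this]
    field_simp
    ring
  have h2 : ∀ n : ℕ, ∏ j ∈ Finset.range n, q ^ (j + 1) = q ^ ((n + 1).choose 2) := fun n => by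
    induction n with
    | zero => simp
    | succ n ih =>
      rw [Finset.prod_range_succ, ih, ← pow_add, Nat.choose_succ_succ' (n + 1) 1,
        Nat.choose_one_right, add_comm]
  rw [Finset.prod_congr rfl h1, Finset.prod_div_distrib, h2, Finset.prod_neg, Finset.card_range]
  rfl

/-- A finite form of Jacobi's identity for the cube of the Euler product. -/
lemma jacobi_finite (n : ℕ) : qPoch q n ^ 2 = ∑ j ∈ Finset.range (n + 1),
    (-1) ^ j * (2 * j + 1) * q ^ ((j + 1).choose 2) *
      (qPoch q (2 * n + 1) / (qPoch q (n - j) * qPoch q (n + 1 + j))) := by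
  have hq := hq0.ne'
  have hP := fun n => (qPoch_pos hq0 hq1 n).ne'
  set t : ℕ → ℝ := fun k => q ^ (k.choose 2) * qPoch q (2 * n + 1) /
    (qPoch q k * qPoch q (2 * n + 1 - k)) * (-1 / q ^ n) ^ k with ht
  have h1 : ∀ w : ℝ, (1 - w) * ((∏ i ∈ Finset.range n, (1 - w * (q ^ i / q ^ n))) *
      ∏ i ∈ Finset.range n, (1 - w * q ^ (i + 1))) =
      ∑ k ∈ Finset.range (2 * n + 2), t k * w ^ k := by
    intro w
    have h := q_binomial hq0 hq1 (2 * n + 1) (w * (-1 / q ^ n))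
    have h2 : ∏ i ∈ Finset.range (2 * n + 1), (1 + w * (-1 / q ^ n) * q ^ i) =
        (1 - w) * ((∏ i ∈ Finset.range n, (1 - w * (q ^ i / q ^ n))) *
      ∏ i ∈ Finset.range n, (1 - w * q ^ (i + 1))) := by
      rw [show 2 * n + 1 = n + (n + 1) by ring, Finset.prod_range_add, Finset.prod_range_succ']
      have : (1 + w * (-1 / q ^ n) * q ^ (n + 0)) = 1 - w := by
        rw [add_zero]; field_simp; ring
      rw [this, mul_comm (1 - w) _, mul_assoc]
      congr 1
      · exact Finset.prod_congr rfl fun i _ => by ring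
      · congr 1
        refine Finset.prod_congr rfl fun i _ => ?_
        rw [pow_add]; field_simp; ring
    rw [← h2, h]
    refine Finset.sum_congr rfl fun k _ => ?_
    rw [ht, mul_pow]; ring
  have hd1 : HasDerivAt (fun w : ℝ => (1 - w) * ((∏ i ∈ Finset.range n, (1 - w * (q ^ i / q ^ n))) *
      ∏ i ∈ Finset.range n, (1 - w * q ^ (i + 1)))) (-((∏ i ∈ Finset.range n, (1 - q ^ i / q ^ n)) *
        qPoch q n)) 1 := by
    have hdiff : DifferentiableAt ℝ (fun w : ℝ => (∏ i ∈ Finset.range n, (1 - w * (q ^ i / q ^ n))) *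
      ∏ i ∈ Finset.range n, (1 - w * q ^ (i + 1))) 1 := by fun_prop
    have := ((hasDerivAt_id (1 : ℝ)).const_sub 1).fun_mul hdiff.hasDerivAt
    simpa [qPoch] using this
  have hd2 : HasDerivAt (fun w : ℝ => ∑ k ∈ Finset.range (2 * n + 2), t k * w ^ k)
      (∑ k ∈ Finset.range (2 * n + 2), t k * k) 1 := by
    refine HasDerivAt.fun_sum fun k _ => ?_
    simpa using (hasDerivAt_pow k (1 : ℝ)).const_mul (t k)
  have h3 : -((∏ i ∈ Finset.range n, (1 - q ^ i / q ^ n)) * qPoch q n) =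
      ∑ k ∈ Finset.range (2 * n + 2), t k * k := by
    simp only [h1] at hd1
    exact hd1.unique hd2
  rw [prod_q_div hq0, show 2 * n + 2 = (n + 1) + (n + 1) by ring, Finset.sum_range_add,
    ← Finset.sum_range_reflect, ← Finset.sum_add_distrib] at h3
  have h4 : ∀ j ∈ Finset.range (n + 1), t (n + 1 - 1 - j) * (n + 1 - 1 - j : ℕ) +
      t (n + 1 + j) * (n + 1 + j : ℕ) = -((-1) ^ n / q ^ ((n + 1).choose 2)) *
      ((-1) ^ j * (2 * j + 1) * q ^ ((j + 1).choose 2) *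
      (qPoch q (2 * n + 1) / (qPoch q (n - j) * qPoch q (n + 1 + j)))) := by
    intro j hj
    obtain ⟨r, rfl⟩ := Nat.exists_eq_add_of_le (Nat.lt_succ_iff.1 (Finset.mem_range.1 hj))
    have e1 : j + r + 1 - 1 - j = r := by omega
    have e2 : j + r - j = r := by omega
    have e3 : 2 * (j + r) + 1 - r = j + r + 1 + j := by omega
    have e4 : 2 * (j + r) + 1 - (j + r + 1 + j) = r := by omega
    have c1 : r.choose 2 + (j + r + 1).choose 2 = (j + r) * r + (j + 1).choose 2 := by
      have : ((r.choose 2 + (j + r + 1).choose 2 : ℕ) : ℚ) =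
        (((j + r) * r + (j + 1).choose 2 : ℕ) : ℚ) := by
        push_cast [Nat.cast_choose_two]; ring
      exact_mod_cast this
    have c2 : (j + r + 1 + j).choose 2 + (j + r + 1).choose 2 =
        (j + r) * (j + r + 1 + j) + (j + 1).choose 2 := by
      have : (((j + r + 1 + j).choose 2 + (j + r + 1).choose 2 : ℕ) : ℚ) =
        (((j + r) * (j + r + 1 + j) + (j + 1).choose 2 : ℕ) : ℚ) := by
        push_cast [Nat.cast_choose_two]; ring
      exact_mod_cast this
    simp only [ht]
    rw [e1, e2, e3, e4, div_pow, div_pow, ← pow_mul, ← pow_mul]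
    have d1 : q ^ r.choose 2 = q ^ ((j + r) * r) * q ^ (j + 1).choose 2 / q ^ (j + r + 1).choose 2 := by
      rw [eq_div_iff (pow_ne_zero _ hq), ← pow_add, ← pow_add, c1]
    have d2 : q ^ (j + r + 1 + j).choose 2 =
        q ^ ((j + r) * (j + r + 1 + j)) * q ^ (j + 1).choose 2 / q ^ (j + r + 1).choose 2 := by
      rw [eq_div_iff (pow_ne_zero _ hq), ← pow_add, ← pow_add, c2]
    rw [d1, d2]
    have p1 := hP r
    have p2 := hP (j + r + 1 + j)
    have s1 : (-1 : ℝ) ^ (j + r + 1 + j) = -(-1) ^ r := by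
      rw [show j + r + 1 + j = r + 1 + (j + j) by ring, pow_add, Even.neg_one_pow ⟨j, rfl⟩, pow_succ]
      ring
    have s2 : (-1 : ℝ) ^ (j + r) * (-1) ^ j = (-1) ^ r := by
      rw [← pow_add, show j + r + j = r + (j + j) by ring, pow_add, Even.neg_one_pow ⟨j, rfl⟩, mul_one]
    rw [s1]
    push_cast
    have s3 : (-1 : ℝ) ^ r = (-1 : ℝ) ^ (j + r) * (-1) ^ j := s2.symm
    rw [s3]
    field_simp
    ring
  rw [Finset.sum_congr rfl h4, ← Finset.mul_sum] at h3
  have hne : -((-1 : ℝ) ^ n / q ^ ((n + 1).choose 2)) ≠ 0 :=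
    neg_ne_zero.2 (div_ne_zero (pow_ne_zero _ (by norm_num)) (pow_ne_zero _ hq))
  refine mul_left_cancel₀ hne ?_
  rw [← h3]
  ring

/-- The Euler product. -/
lemma summable_geom_shift : Summable fun i : ℕ => -q ^ (i + 1) :=
  ((summable_nat_add_iff 1).2 (summable_geometric_of_lt_one hq0.le hq1)).neg

lemma tendsto_qPoch : Tendsto (qPoch q) atTop (𝓝 (∏' n : ℕ, (1 - q ^ (n + 1)))) := by
  have := (Real.multipliable_one_add_of_summable (summable_geom_shift hq0 hq1)).hasProd.tendsto_prod_nat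
  simp only [← sub_eq_add_neg] at this
  exact this

lemma euler_pos : 0 < ∏' n : ℕ, (1 - q ^ (n + 1)) := by
  have h := Real.rexp_tsum_eq_tprod (f := fun n : ℕ => 1 + -q ^ (n + 1)) (fun i => by
    simpa [sub_eq_add_neg] using one_sub_pow_pos hq0 hq1 i)
    (Real.summable_log_one_add_of_summable (summable_geom_shift hq0 hq1))
  simp only [← sub_eq_add_neg] at h
  rw [← h]
  exact Real.exp_pos _

lemma qPoch_le_one (n : ℕ) : qPoch q n ≤ 1 :=
  Finset.prod_le_one (fun i _ => (one_sub_pow_pos hq0 hq1 i).le) fun i _ => by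
    linarith [pow_pos hq0 (i + 1)]

lemma euler_le_qPoch (n : ℕ) : ∏' n : ℕ, (1 - q ^ (n + 1)) ≤ qPoch q n := by
  refine le_of_tendsto (tendsto_qPoch hq0 hq1) ?_
  filter_upwards [eventually_ge_atTop n] with m hm
  refine antitone_nat_of_succ_le (fun k => ?_) hm
  rw [qPoch_succ]
  have := qPoch_pos hq0 hq1 k
  nlinarith [pow_pos hq0 (k + 1)]

lemma summable_jacobi : Summable fun j : ℕ => (2 * j + 1) * q ^ ((j + 1).choose 2) := by
  have h1 : Summable fun j : ℕ => ((j : ℝ) ^ 1 * q ^ j) :=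
    summable_pow_mul_geometric_of_norm_lt_one 1 (by rwa [Real.norm_eq_abs, abs_of_pos hq0])
  have h2 := (h1.mul_left 2).add (summable_geometric_of_lt_one hq0.le hq1)
  refine Summable.of_nonneg_of_le (fun j => by positivity) (fun j => ?_) h2
  have h3 : q ^ ((j + 1).choose 2) ≤ q ^ j := by
    refine pow_le_pow_of_le_one hq0.le hq1.le ?_
    rw [Nat.choose_succ_succ' j 1, Nat.choose_one_right]
    exact Nat.le_add_right _ _
  calc _ ≤ (2 * j + 1) * q ^ j := by gcongr
    _ = _ := by ring

/-- Jacobi's identity. -/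
lemma jacobi_cube : (∏' n : ℕ, (1 - q ^ (n + 1))) ^ 3 =
    ∑' j : ℕ, (-1) ^ j * (2 * j + 1) * q ^ ((j + 1).choose 2) := by
  set E := ∏' n : ℕ, (1 - q ^ (n + 1)) with hE
  have hEpos : 0 < E := euler_pos hq0 hq1
  have hlim := tendsto_qPoch hq0 hq1
  rw [← hE] at hlim
  have hP := qPoch_pos hq0 hq1
  have hPE := euler_le_qPoch hq0 hq1
  rw [← hE] at hPE
  set f : ℕ → ℕ → ℝ := fun n j => if j ∈ Finset.range (n + 1) then
    (-1) ^ j * (2 * j + 1) * q ^ ((j + 1).choose 2) *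
      (qPoch q (2 * n + 1) / (qPoch q (n - j) * qPoch q (n + 1 + j))) else 0 with hf
  have h1 : ∀ n, ∑' j, f n j = qPoch q n ^ 2 := fun n => by
    rw [jacobi_finite hq0 hq1, tsum_eq_sum (s := Finset.range (n + 1))]
    · exact Finset.sum_congr rfl fun j hj => by simp only [hf, if_pos hj]
    · intro j hj; simp only [hf, if_neg hj]
  have h2 : Tendsto (fun n => ∑' j, f n j) atTop
      (𝓝 (∑' j : ℕ, (-1) ^ j * (2 * j + 1) * q ^ ((j + 1).choose 2) * (E / (E * E)))) := by
    refine tendsto_tsum_of_dominated_convergence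
      ((summable_jacobi hq0 hq1).mul_right (1 / (E * E))) (fun j => ?_) ?_
    · have a1 : Tendsto (fun n => qPoch q (2 * n + 1)) atTop (𝓝 E) :=
        hlim.comp (tendsto_atTop_mono (fun n => by simp only [id]; omega) tendsto_id)
      have a2 : Tendsto (fun n => qPoch q (n - j)) atTop (𝓝 E) :=
        hlim.comp (tendsto_sub_atTop_nat j)
      have a3 : Tendsto (fun n => qPoch q (n + 1 + j)) atTop (𝓝 E) :=
        hlim.comp (tendsto_atTop_mono (fun n => by simp only [id]; omega) tendsto_id)
      refine ((a1.div (a2.mul a3) (mul_pos hEpos hEpos).ne').const_mul _).congr' ?_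
      filter_upwards [eventually_ge_atTop j] with n hn
      have : j ∈ Finset.range (n + 1) := Finset.mem_range.2 (by omega)
      simp only [hf, if_pos this, Pi.div_apply]
    · refine Eventually.of_forall fun n j => ?_
      simp only [hf]
      split_ifs
      · rw [Real.norm_eq_abs, abs_mul, abs_mul, abs_mul, abs_pow, abs_neg, abs_one, one_pow, one_mul,
          abs_of_pos (by positivity : (0 : ℝ) < 2 * j + 1), abs_of_pos (pow_pos hq0 _),
          abs_of_pos (div_pos (hP _) (mul_pos (hP _) (hP _)))]
        refine mul_le_mul_of_nonneg_left ?_ (by positivity)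
        exact div_le_div₀ zero_le_one (qPoch_le_one hq0 hq1 _) (mul_pos hEpos hEpos)
          (mul_le_mul (hPE _) (hPE _) hEpos.le (hP _).le)
      · rw [norm_zero]; positivity
  simp only [h1] at h2
  have h3 := tendsto_nhds_unique h2 (hlim.pow 2)
  rw [tsum_mul_right] at h3
  have : E / (E * E) = 1 / E := by field_simp
  rw [this, mul_one_div, div_eq_iff hEpos.ne'] at h3
  rw [h3]; ring

end Jacobi

lemma summable_exp_neg_half_int : Summable fun n : ℤ => Real.exp (-|(n : ℝ) + 1 / 2|) := by
  have h0 : Summable fun n : ℕ => Real.exp (-((n : ℝ) + 1 / 2)) := by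
    have := (Real.summable_exp_neg_nat).mul_right (Real.exp (-(1 / 2)))
    refine this.congr fun n => ?_
    rw [← Real.exp_add]; congr 1; ring
  refine Summable.of_nat_of_neg_add_one ?_ ?_
  · refine h0.congr fun n => ?_
    rw [abs_of_pos (by positivity)]
    norm_num
  · refine h0.congr fun n => ?_
    have : ((-((n : ℤ) + 1) : ℤ) : ℝ) + 1 / 2 = -((n : ℝ) + 1 / 2) := by push_cast; ring
    rw [this, abs_neg, abs_of_pos (by positivity)]

lemma summable_gauss {a : ℝ} (ha : 0 < a) (C : ℝ) : Summable fun n : ℤ =>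
    Real.exp (-(a * ((n : ℝ) + 1 / 2) ^ 2)) * Real.exp (C * |(n : ℝ) + 1 / 2|) := by
  refine Summable.of_nonneg_of_le (fun _ => by positivity) (fun n => ?_)
    (summable_exp_neg_half_int.mul_left (Real.exp ((C + 1) ^ 2 / (4 * a))))
  rw [← Real.exp_add, ← Real.exp_add]
  apply Real.exp_le_exp.2
  set y := |(n : ℝ) + 1 / 2| with hy
  have h1 : ((n : ℝ) + 1 / 2) ^ 2 = y ^ 2 := (sq_abs _).symm
  rw [h1]
  have h2 : (C + 1) ^ 2 / (4 * a) - (C + 1) * y + a * y ^ 2 = (2 * a * y - (C + 1)) ^ 2 / (4 * a) := by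
    field_simp; ring
  have h3 : 0 ≤ (2 * a * y - (C + 1)) ^ 2 / (4 * a) := by positivity
  linarith

/-- Coefficients of the odd theta function. -/
noncomputable def thetaCoeff (u : ℝ) (n : ℤ) : ℝ :=
  (-1) ^ n * Real.exp (-(u / 2 * ((n : ℝ) + 1 / 2) ^ 2))

lemma abs_thetaCoeff (u : ℝ) (n : ℤ) :
    |thetaCoeff u n| = Real.exp (-(u / 2 * ((n : ℝ) + 1 / 2) ^ 2)) := by
  rw [thetaCoeff, abs_mul, Real.abs_exp, abs_zpow, abs_neg, abs_one, one_zpow, one_mul]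

/-- The odd theta function. -/
noncomputable def oddTheta (u x : ℝ) : ℝ :=
  ∑' n : ℕ, thetaCoeff u n * (2 * Real.sinh (((n : ℝ) + 1 / 2) * x))

lemma oddTheta_neg (u x : ℝ) : oddTheta u (-x) = -oddTheta u x := by
  rw [oddTheta, oddTheta, ← tsum_neg]
  exact tsum_congr fun n => by rw [mul_neg, Real.sinh_neg]; ring

/-- The derivative of the odd theta function at the origin. -/
noncomputable def thetaNull (u : ℝ) : ℝ :=
  ∑' n : ℕ, (-1) ^ n * (2 * (n : ℝ) + 1) * Real.exp (-(u * ((2 * (n : ℝ) + 1) ^ 2 / 8)))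

/-- The negative logarithmic derivative of `thetaNull`. -/
noncomputable def thetaLog (u : ℝ) : ℝ :=
  (∑' n : ℕ, (-1) ^ n * (2 * (n : ℝ) + 1) * ((2 * (n : ℝ) + 1) ^ 2 / 8) *
    Real.exp (-(u * ((2 * (n : ℝ) + 1) ^ 2 / 8)))) / thetaNull u

lemma thetaCoeff_nat (u : ℝ) (n : ℕ) :
    thetaCoeff u n = (-1) ^ n * Real.exp (-(u * ((2 * (n : ℝ) + 1) ^ 2 / 8))) := by
  rw [thetaCoeff, zpow_natCast]
  congr 3
  push_cast; ring

section

variable {u : ℝ} (hu : 0 < u)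

include hu

lemma summable_thetaCoeff (C : ℝ) :
    Summable fun n : ℤ => |thetaCoeff u n| * Real.exp (C * |(n : ℝ) + 1 / 2|) := by
  simp only [abs_thetaCoeff]
  exact summable_gauss (half_pos hu) C

lemma summable_thetaCoeff_nat (C : ℝ) :
    Summable fun n : ℕ => |thetaCoeff u n| * Real.exp (C * (2 * (n : ℝ) + 1)) := by
  have := (summable_thetaCoeff hu (2 * C)).comp_injective Nat.cast_injective
  refine this.congr fun n => ?_
  simp only [Function.comp]
  congr 2
  rw [Int.cast_natCast, abs_of_pos (by positivity)]
  ring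

lemma summable_thetaCoeff_exp (x : ℝ) :
    Summable fun n : ℤ => |thetaCoeff u n * Real.exp (((n : ℝ) + 1 / 2) * x)| := by
  refine Summable.of_nonneg_of_le (fun _ => abs_nonneg _) (fun n => ?_) (summable_thetaCoeff hu |x|)
  rw [abs_mul, Real.abs_exp]
  refine mul_le_mul_of_nonneg_left (Real.exp_le_exp.2 ?_) (abs_nonneg _)
  rw [mul_comm |x|, ← abs_mul]
  exact le_abs_self _

lemma tsum_thetaCoeff_exp (x : ℝ) :
    ∑' n : ℤ, thetaCoeff u n * Real.exp (((n : ℝ) + 1 / 2) * x) = oddTheta u x := by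
  have hs := (summable_thetaCoeff_exp hu x).of_abs
  have h1 : Summable fun n : ℕ => thetaCoeff u n * Real.exp ((((n : ℕ) : ℝ) + 1 / 2) * x) := by
    simpa [Function.comp_def] using hs.comp_injective Nat.cast_injective
  have hinj : Function.Injective fun n : ℕ => -((n : ℤ) + 1) := fun a b h => by
    simpa using h
  have e : ∀ n : ℕ, thetaCoeff u (-((n : ℤ) + 1)) *
      Real.exp ((((-((n : ℤ) + 1) : ℤ) : ℝ) + 1 / 2) * x) =
      -(thetaCoeff u n * Real.exp (-(((n : ℝ) + 1 / 2) * x))) := fun n => by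
    have : ((-((n : ℤ) + 1) : ℤ) : ℝ) + 1 / 2 = -((n : ℝ) + 1 / 2) := by push_cast; ring
    rw [thetaCoeff, thetaCoeff, this, neg_sq, zpow_neg, zpow_add₀ (by norm_num), mul_inv,
      ← inv_zpow, neg_mul, inv_neg, inv_one, zpow_one, inv_neg, inv_one, Int.cast_natCast]
    ring
  have h2 : Summable fun n : ℕ => thetaCoeff u (-((n : ℤ) + 1)) *
      Real.exp ((((-((n : ℤ) + 1) : ℤ) : ℝ) + 1 / 2) * x) := hs.comp_injective hinj
  have h3 := (HasSum.of_nat_of_neg_add_one (f := fun n : ℤ =>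
    thetaCoeff u n * Real.exp (((n : ℝ) + 1 / 2) * x)) (m := ∑' n : ℕ, thetaCoeff u n * Real.exp ((((n : ℕ) : ℝ) + 1 / 2) * x))
    (by simpa using h1.hasSum) h2.hasSum).tsum_eq
  rw [h3, ← h1.tsum_add h2, oddTheta]
  refine tsum_congr fun n => ?_
  rw [e, Real.sinh_eq]
  ring

lemma summable_sinh_hyp (x : ℝ) : Summable fun n : ℕ => |thetaCoeff u n| *
    Real.exp (2 * ∑ _a ∈ ({()} : Finset Unit), |(2 * (n : ℝ) + 1) * x|) := by
  refine (summable_thetaCoeff_nat hu (2 * |x|)).congr fun n => ?_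
  rw [Finset.sum_singleton, abs_mul, abs_of_pos (by positivity : 0 < 2 * (n : ℝ) + 1)]
  congr 2
  ring

omit hu in
lemma oddTheta_div (s x : ℝ) : oddTheta u (s * x) / s = ∑' n : ℕ, thetaCoeff u n *
    ∏ _a ∈ ({()} : Finset Unit), 2 * Real.sinh (s * ((2 * (n : ℝ) + 1) * x) / 2) / s := by
  rw [oddTheta, ← tsum_div_const]
  refine tsum_congr fun n => ?_
  rw [Finset.prod_singleton, ← mul_div_assoc, show ((n : ℝ) + 1 / 2) * (s * x) =
    s * ((2 * (n : ℝ) + 1) * x) / 2 by ring]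

omit hu in
lemma thetaNull_mul (x : ℝ) : thetaNull u * x = ∑' n : ℕ, thetaCoeff u n *
    ∏ _a ∈ ({()} : Finset Unit), (2 * (n : ℝ) + 1) * x := by
  rw [thetaNull, ← tsum_mul_right]
  refine tsum_congr fun n => ?_
  rw [Finset.prod_singleton, thetaCoeff_nat]
  ring

lemma tendsto_oddTheta (x : ℝ) :
    Tendsto (fun s => oddTheta u (s * x) / s) (𝓝[>] 0) (𝓝 (thetaNull u * x)) := by
  simp only [oddTheta_div, thetaNull_mul]
  exact tendsto_tsum_sinh (summable_sinh_hyp hu x)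

lemma eta_pos : 0 < eta (Real.exp (-u)) :=
  mul_pos (Real.rpow_pos_of_pos (Real.exp_pos _) _)
    (euler_pos (Real.exp_pos _) (Real.exp_lt_one_iff.2 (neg_neg_iff_pos.2 hu)))

lemma eta_cube : eta (Real.exp (-u)) ^ 3 = thetaNull u := by
  rw [eta, mul_pow, jacobi_cube (Real.exp_pos _) (Real.exp_lt_one_iff.2 (neg_neg_iff_pos.2 hu)),
    ← Real.exp_mul, ← Real.exp_nat_mul, thetaNull, ← tsum_mul_left]
  refine tsum_congr fun n => ?_
  rw [← Real.exp_nat_mul, mul_comm, mul_assoc, ← Real.exp_add]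
  congr 2
  push_cast [Nat.cast_choose_two]
  ring

lemma thetaNull_pos : 0 < thetaNull u := by
  rw [← eta_cube hu]; exact pow_pos (eta_pos hu) 3

lemma tendsto_oddTheta_sub (x : ℝ) :
    Tendsto (fun s => (oddTheta u (s * x) / s - thetaNull u * x) / s ^ 2) (𝓝[>] 0)
      (𝓝 (thetaNull u * x * (thetaLog u / 3 * x ^ 2))) := by
  have h := tendsto_tsum_sinh_sub (summable_sinh_hyp hu x)
  simp only [oddTheta_div]
  nth_rewrite 1 [thetaNull_mul]
  refine h.trans_eq ?_
  congr 1
  have h0 := (thetaNull_pos hu).ne'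
  have : thetaNull u * x * (thetaLog u / 3 * x ^ 2) = (∑' n : ℕ, (-1) ^ n * (2 * (n : ℝ) + 1) *
      ((2 * (n : ℝ) + 1) ^ 2 / 8) * Real.exp (-(u * ((2 * (n : ℝ) + 1) ^ 2 / 8)))) * (x ^ 3 / 3) := by
    rw [thetaLog]
    generalize (∑' n : ℕ, (-1) ^ n * (2 * (n : ℝ) + 1) *
      ((2 * (n : ℝ) + 1) ^ 2 / 8) * Real.exp (-(u * ((2 * (n : ℝ) + 1) ^ 2 / 8)))) = A
    field_simp
  rw [this, ← tsum_mul_right]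
  refine tsum_congr fun n => ?_
  rw [Finset.prod_singleton, Finset.sum_singleton, thetaCoeff_nat]
  ring

lemma summable_thetaNull_pow (k : ℕ) : Summable fun n : ℕ =>
    (2 * (n : ℝ) + 1) ^ k * Real.exp (-(u * ((2 * (n : ℝ) + 1) ^ 2 / 8))) := by
  refine Summable.of_nonneg_of_le (fun _ => by positivity) (fun n => ?_)
    (summable_thetaCoeff_nat hu k)
  rw [thetaCoeff_nat, abs_mul, abs_pow, abs_neg, abs_one, one_pow, one_mul, Real.abs_exp, mul_comm,
    Real.exp_nat_mul]
  gcongr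
  linarith [Real.add_one_le_exp (2 * (n : ℝ) + 1)]

lemma hasDerivAt_thetaNull : HasDerivAt thetaNull (-(thetaNull u * thetaLog u)) u := by
  have h := hasDerivAt_tsum_exp (d := fun n : ℕ => (-1) ^ n * (2 * (n : ℝ) + 1))
    (e := fun n : ℕ => (2 * (n : ℝ) + 1) ^ 2 / 8) (fun n => by positivity)
    (fun v hv => Summable.of_abs ((summable_thetaNull_pow hv 1).congr fun n => by
      rw [abs_mul, abs_mul, abs_pow, abs_neg, abs_one, one_pow, one_mul, Real.abs_exp,
        abs_of_pos (by positivity), pow_one]))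
    (fun v hv => ((summable_thetaNull_pow hv 3).div_const 8).congr fun n => by
      rw [abs_mul, abs_pow, abs_neg, abs_one, one_pow, one_mul,
        abs_of_pos (by positivity)]
      ring) hu
  refine h.congr_deriv ?_
  rw [tsum_neg, thetaLog, mul_div_cancel₀ _ (thetaNull_pos hu).ne']

end

/-- The constant term of an exponential series dominates at infinity. -/
lemma tendsto_tsum_exp_atTop {ι : Type*} {d e : ι → ℝ} (i₀ : ι) (he : ∀ i, i ≠ i₀ → 0 < e i)
    (he₀ : e i₀ = 0) (hs : Summable fun i => |d i| * Real.exp (-(1 * e i))) :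
    Tendsto (fun u => ∑' i, d i * Real.exp (-(u * e i))) atTop (𝓝 (d i₀)) := by
  have h : Tendsto (fun u => ∑' i, d i * Real.exp (-(u * e i))) atTop
      (𝓝 (∑' i, if i = i₀ then d i₀ else 0)) := by
    refine tendsto_tsum_of_dominated_convergence hs (fun i => ?_) ?_
    · split_ifs with hi
      · subst hi
        simp [he₀]
      · have h1 : Tendsto (fun u : ℝ => u * e i) atTop atTop :=
          tendsto_id.atTop_mul_const (he i hi)
        simpa using (Real.tendsto_exp_neg_atTop_nhds_zero.comp h1).const_mul (d i)
    · filter_upwards [eventually_ge_atTop (1 : ℝ)] with u hu i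
      rw [Real.norm_eq_abs, abs_mul, Real.abs_exp]
      have : 0 ≤ e i := by
        by_cases hi : i = i₀
        · rw [hi, he₀]
        · exact (he i hi).le
      gcongr
  rwa [tsum_ite_eq] at h

lemma tendsto_thetaNull_atTop :
    Tendsto (fun u => thetaNull u * Real.exp (u / 8)) atTop (𝓝 1) := by
  have h := tendsto_tsum_exp_atTop (d := fun n : ℕ => (-1) ^ n * (2 * (n : ℝ) + 1))
    (e := fun n : ℕ => (2 * (n : ℝ) + 1) ^ 2 / 8 - 1 / 8) 0 (fun n hn => by
      have : (1 : ℝ) ≤ n := by exact_mod_cast Nat.one_le_iff_ne_zero.2 hn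
      nlinarith) (by norm_num) (by
      have := ((summable_thetaNull_pow one_pos 1).mul_right (Real.exp (1 / 8)))
      refine this.congr fun n => ?_
      rw [abs_mul, abs_pow, abs_neg, abs_one, one_pow, one_mul, abs_of_pos (by positivity), pow_one,
        mul_assoc, ← Real.exp_add]
      rw [one_mul, one_mul, neg_sub, sub_eq_neg_add])
  have h1 : ((-1 : ℝ) ^ 0 * (2 * ((0 : ℕ) : ℝ) + 1)) = 1 := by norm_num
  rw [h1] at h
  refine h.congr fun u => ?_
  rw [thetaNull, ← tsum_mul_right]
  refine tsum_congr fun n => ?_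
  rw [mul_assoc _ (Real.exp _), ← Real.exp_add]
  congr 2
  ring

/-- Summability and factorisation of products over all integer vectors. -/
def PiProdProp (ι : Type) [Fintype ι] : Prop := ∀ f : ι → ℤ → ℝ, (∀ i, Summable fun n => |f i n|) →
    (Summable fun m : ι → ℤ => |∏ i, f i (m i)|) ∧
      ∑' m : ι → ℤ, ∏ i, f i (m i) = ∏ i, ∑' n, f i n

lemma PiProdProp.of_equiv {α β : Type} [Fintype α] [Fintype β] (e : α ≃ β) (ih : PiProdProp α) :
    PiProdProp β := fun f hf => by
  have h := ih (fun a => f (e a)) (fun a => hf (e a))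
  let E : (β → ℤ) ≃ (α → ℤ) :=
    ⟨fun m a => m (e a), fun m b => m (e.symm b), fun m => by simp, fun m => by simp⟩
  have hp : ∀ m : β → ℤ, ∏ a : α, f (e a) (E m a) = ∏ b, f b (m b) := fun m =>
    e.prod_comp (fun b => f b (m b))
  constructor
  · have h1 := Summable.comp_injective h.1 E.injective
    refine h1.congr fun m => ?_
    rw [← hp, Function.comp]
  · have h1 := E.tsum_eq (fun m => ∏ a : α, f (e a) (m a))
    rw [← tsum_congr hp, h1, h.2]
    exact e.prod_comp (fun b => ∑' n, f b n)

lemma PiProdProp.of_empty : PiProdProp PEmpty := fun f _ =>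
  ⟨(hasSum_fintype _).summable, by simp⟩

lemma PiProdProp.option {α : Type} [Fintype α] (ih : PiProdProp α) : PiProdProp (Option α) :=
    fun f hf => by
  have h := ih (fun a => f (some a)) (fun a => hf _)
  let E : (Option α → ℤ) ≃ ℤ × (α → ℤ) := Equiv.piOptionEquivProd (β := fun _ : Option α => ℤ)
  have hp : ∀ m : Option α → ℤ, f none (E m).1 * ∏ i, f (some i) ((E m).2 i) =
      ∏ i, f i (m i) := fun m => by rw [Fintype.prod_option]; rfl
  have hs := Summable.mul_norm (f := f none) (g := fun m : α → ℤ => ∏ i, f (some i) (m i))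
    (hf none) h.1
  constructor
  · have h1 := Summable.comp_injective hs E.injective
    refine h1.congr fun m => ?_
    rw [← hp, Function.comp, Real.norm_eq_abs]
  · have h1 := E.tsum_eq (fun z => f none z.1 * ∏ i, f (some i) (z.2 i))
    have h2 := tsum_mul_tsum_of_summable_norm (f := f none)
      (g := fun m : α → ℤ => ∏ i, f (some i) (m i)) (hf none) h.1
    rw [Fintype.prod_option, ← h.2, h2, ← h1]
    exact tsum_congr fun m => (hp m).symm

lemma tsum_pi_prod (ι : Type) [Fintype ι] : PiProdProp ι := by
  refine Fintype.induction_empty_option (P := fun ι _ => PiProdProp ι) ?_ ?_ ?_ ι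
  · intro α β hβ e ih
    exact @PiProdProp.of_equiv α β (Fintype.ofEquiv β e.symm) hβ e ih
  · exact PiProdProp.of_empty
  · intro α _ ih
    exact ih.option

lemma thetaCoeff_reflect (u : ℝ) (n : ℤ) : thetaCoeff u (-1 - n) = -thetaCoeff u n := by
  rw [thetaCoeff, thetaCoeff, zpow_sub₀ (by norm_num)]
  have h : (((-1 - n : ℤ) : ℝ) + 1 / 2) ^ 2 = ((n : ℝ) + 1 / 2) ^ 2 := by push_cast; ring
  rw [h, div_eq_mul_inv, ← inv_zpow]
  norm_num

lemma thetaCoeff_ne_zero (u : ℝ) (n : ℤ) : thetaCoeff u n ≠ 0 :=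
  mul_ne_zero (zpow_ne_zero _ (by norm_num)) (Real.exp_ne_zero _)

namespace Base

variable {V : Type} [AddCommGroup V] [Module ℝ V] {S : RootSys V} (B : Base S)

/-- The weight attached to an integer vector indexed by the positive roots. -/
noncomputable def latSum (m : {x // x ∈ B.Pos} → ℤ) : V :=
  ∑ x : {x // x ∈ B.Pos}, ((m x : ℝ) + 1 / 2) • (x : V)

/-- The coefficient attached to an integer vector indexed by the positive roots. -/
noncomputable def multiCoeff (v : ℝ) (m : {x // x ∈ B.Pos} → ℤ) : ℝ :=
  ∏ x : {x // x ∈ B.Pos}, thetaCoeff (S.I (x : V) x * v) (m x)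

lemma multiCoeff_ne_zero (v : ℝ) (m : {x // x ∈ B.Pos} → ℤ) : B.multiCoeff v m ≠ 0 :=
  Finset.prod_ne_zero_iff.2 fun _ _ => thetaCoeff_ne_zero _ _

lemma I_latSum (m : {x // x ∈ B.Pos} → ℤ) (y : V) :
    S.I (B.latSum m) y = ∑ x : {x // x ∈ B.Pos}, ((m x : ℝ) + 1 / 2) * S.I (x : V) y := by
  simp [latSum, map_sum, LinearMap.sum_apply]

lemma latSum_zero : B.latSum 0 = weylVec B := by
  rw [latSum, weylVec, Finset.smul_sum, ← Finset.sum_coe_sort B.Pos]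
  exact Finset.sum_congr rfl fun x _ => by norm_num

section

variable {a : V} (ha : a ∈ B.Pi)

/-- The permutation of the positive roots other than `a` induced by the reflection in `a`. -/
noncomputable def simplePerm (x : {x // x ∈ B.Pos}) : {x // x ∈ B.Pos} :=
  if h : (x : V) = a then x else ⟨S.refl a x, B.refl_mem_pos x.2 ha h⟩

lemma simplePerm_self {x : {x // x ∈ B.Pos}} (h : (x : V) = a) : B.simplePerm ha x = x :=
  dif_pos h

lemma simplePerm_coe {x : {x // x ∈ B.Pos}} (h : (x : V) ≠ a) :
    (B.simplePerm ha x : V) = S.refl a x := by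
  rw [simplePerm, dif_neg h]

lemma simplePerm_ne {x : {x // x ∈ B.Pos}} (h : (x : V) ≠ a) : (B.simplePerm ha x : V) ≠ a := by
  rw [B.simplePerm_coe ha h]
  intro h1
  have h2 : (x : V) = -a := by
    rw [← RootSys.refl_refl (B.pi_mem_R ha) (x : V), h1, RootSys.refl_self (B.pi_mem_R ha)]
  exact B.not_both a (B.pi_sub ha) (h2 ▸ x.2)

lemma simplePerm_involutive : Function.Involutive (B.simplePerm ha) := fun x => by
  by_cases h : (x : V) = a
  · rw [B.simplePerm_self ha h, B.simplePerm_self ha h]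
  · apply Subtype.ext
    rw [B.simplePerm_coe ha (B.simplePerm_ne ha h), B.simplePerm_coe ha h,
      RootSys.refl_refl (B.pi_mem_R ha)]

/-- The action of a simple reflection on integer vectors. -/
noncomputable def simpleMove (m : {x // x ∈ B.Pos} → ℤ) (x : {x // x ∈ B.Pos}) : ℤ :=
  if (x : V) = a then -1 - m x else m (B.simplePerm ha x)

lemma simpleMove_involutive : Function.Involutive (B.simpleMove ha) := fun m => by
  funext x
  by_cases h : (x : V) = a
  · rw [simpleMove, if_pos h, simpleMove, if_pos h]; ring
  · rw [simpleMove, if_neg h, simpleMove, if_neg (B.simplePerm_ne ha h),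
      B.simplePerm_involutive ha]

lemma latSum_simpleMove (m : {x // x ∈ B.Pos} → ℤ) :
    B.latSum (B.simpleMove ha m) = S.refl a (B.latSum m) := by
  rw [latSum, latSum, map_sum, ← Equiv.sum_comp (B.simplePerm_involutive ha).toPerm
    (fun x : {x // x ∈ B.Pos} => S.refl a (((m x : ℝ) + 1 / 2) • (x : V)))]
  refine Finset.sum_congr rfl fun x _ => ?_
  rw [Function.Involutive.coe_toPerm, map_smul]
  by_cases h : (x : V) = a
  · rw [B.simplePerm_self ha h, simpleMove, if_pos h, h, RootSys.refl_self (B.pi_mem_R ha)]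
    push_cast
    module
  · have h1 : S.refl a (B.simplePerm ha x : V) = x := by
      rw [B.simplePerm_coe ha h, RootSys.refl_refl (B.pi_mem_R ha)]
    rw [h1, simpleMove, if_neg h]

lemma multiCoeff_simpleMove (v : ℝ) (m : {x // x ∈ B.Pos} → ℤ) :
    B.multiCoeff v (B.simpleMove ha m) = -B.multiCoeff v m := by
  have h1 : (∏ x : {x // x ∈ B.Pos}, if x = ⟨a, B.pi_sub ha⟩ then (-1 : ℝ) else 1) = -1 := by
    rw [Finset.prod_ite_eq' Finset.univ, if_pos (Finset.mem_univ _)]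
  rw [multiCoeff, multiCoeff, neg_eq_neg_one_mul, ← h1, ← Equiv.prod_comp
    (B.simplePerm_involutive ha).toPerm (fun x : {x // x ∈ B.Pos} =>
      thetaCoeff (S.I (x : V) x * v) (m x)), ← Finset.prod_mul_distrib]
  refine Finset.prod_congr rfl fun x _ => ?_
  rw [Function.Involutive.coe_toPerm]
  by_cases h : (x : V) = a
  · rw [B.simplePerm_self ha h, simpleMove, if_pos h, if_pos (Subtype.ext h), thetaCoeff_reflect,
      neg_one_mul]
  · rw [simpleMove, if_neg h, if_neg (fun h1 => h (congrArg Subtype.val h1)), one_mul,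
      B.simplePerm_coe ha h, RootSys.I_refl_refl (B.pi_mem_R ha)]

end

/-- The total coefficient of a weight. -/
noncomputable def wtCoeff (v : ℝ) (y : V) : ℝ :=
  ∑' m : {x // x ∈ B.Pos} → ℤ, if B.latSum m = y then B.multiCoeff v m else 0

lemma wtCoeff_simple {a : V} (ha : a ∈ B.Pi) (v : ℝ) (y : V) :
    B.wtCoeff v (S.refl a y) = -B.wtCoeff v y := by
  rw [wtCoeff, wtCoeff, ← tsum_neg, ← (B.simpleMove_involutive ha).toPerm.tsum_eq]
  refine tsum_congr fun m => ?_
  rw [Function.Involutive.coe_toPerm, latSum_simpleMove, multiCoeff_simpleMove]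
  have : S.refl a (B.latSum m) = S.refl a y ↔ B.latSum m = y := by
    refine ⟨fun h => ?_, fun h => by rw [h]⟩
    rw [← RootSys.refl_refl (B.pi_mem_R ha) (B.latSum m), h, RootSys.refl_refl (B.pi_mem_R ha)]
  simp only [this]
  split_ifs <;> simp

lemma wtCoeff_refl {α : V} (hα : α ∈ S.R) (v : ℝ) (y : V) :
    B.wtCoeff v (S.refl α y) = -B.wtCoeff v y := by
  refine B.root_induction (P := fun α => ∀ y, B.wtCoeff v (S.refl α y) = -B.wtCoeff v y)
    (fun a ha y => B.wtCoeff_simple ha v y) (fun a ha β _ ih y => ?_) (fun β _ ih y => ?_) α hα y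
  · rw [RootSys.refl_conj (B.pi_mem_R ha), B.wtCoeff_simple ha, ih, B.wtCoeff_simple ha, neg_neg]
  · rw [RootSys.refl_neg, ih]

lemma wtCoeff_eq_zero_of_co {α : V} (hα : α ∈ S.R) (v : ℝ) {y : V} (h : S.co α y = 0) :
    B.wtCoeff v y = 0 := by
  have := B.wtCoeff_refl hα v y
  rw [RootSys.refl_apply, h, zero_smul, sub_zero] at this
  linarith

end Base

lemma thetaCoeff_add (u : ℝ) (n k : ℤ) : thetaCoeff u (n + k) =
    (-1) ^ k * Real.exp (-(u / 2 * (2 * ((n : ℝ) + 1 / 2) * k + k ^ 2))) * thetaCoeff u n := by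
  rw [thetaCoeff, thetaCoeff, zpow_add₀ (by norm_num)]
  have h : -(u / 2 * (((n + k : ℤ) : ℝ) + 1 / 2) ^ 2) =
      -(u / 2 * (2 * ((n : ℝ) + 1 / 2) * k + k ^ 2)) + -(u / 2 * ((n : ℝ) + 1 / 2) ^ 2) := by
    push_cast; ring
  rw [h, Real.exp_add]
  ring

namespace Base

variable {V : Type} [AddCommGroup V] [Module ℝ V] {S : RootSys V} (B : Base S)

lemma summable_multiCoeff {v : ℝ} (hv : 0 < v) (C : ℝ) :
    Summable fun m : {x // x ∈ B.Pos} → ℤ =>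
      |B.multiCoeff v m| * Real.exp (C * ∑ x, |(m x : ℝ) + 1 / 2|) := by
  have h := (tsum_pi_prod {x // x ∈ B.Pos} (fun x n => thetaCoeff (S.I (x : V) x * v) n *
    Real.exp (C * |(n : ℝ) + 1 / 2|)) fun x => ?_).1
  · refine h.congr fun m => ?_
    rw [Finset.prod_mul_distrib, abs_mul, ← Real.exp_sum, Real.abs_exp, Finset.mul_sum, multiCoeff]
  · have hx : 0 < S.I (x : V) x * v := mul_pos (RootSys.I_self_pos (B.pos_sub x.2)) hv
    refine (summable_thetaCoeff hx C).congr fun n => ?_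
    rw [abs_mul, Real.abs_exp]

/-- A bound for the pairings of `latSum m` with the positive roots. -/
lemma exists_sum_abs_I_latSum_le : ∃ C : ℝ, 0 ≤ C ∧ ∀ m : {x // x ∈ B.Pos} → ℤ,
    ∑ α ∈ B.Pos, |S.I α (B.latSum m)| ≤ C * ∑ x, |(m x : ℝ) + 1 / 2| := by
  refine ⟨∑ x : {x // x ∈ B.Pos}, ∑ α ∈ B.Pos, |S.I (x : V) α|, by positivity, fun m => ?_⟩
  calc ∑ α ∈ B.Pos, |S.I α (B.latSum m)|
      ≤ ∑ α ∈ B.Pos, ∑ x : {x // x ∈ B.Pos}, |(m x : ℝ) + 1 / 2| * |S.I (x : V) α| := by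
        refine Finset.sum_le_sum fun α _ => ?_
        rw [S.symm, I_latSum]
        refine (Finset.abs_sum_le_sum_abs _ _).trans_eq ?_
        simp only [abs_mul]
    _ = ∑ x : {x // x ∈ B.Pos}, |(m x : ℝ) + 1 / 2| * ∑ α ∈ B.Pos, |S.I (x : V) α| := by
        rw [Finset.sum_comm]
        simp only [Finset.mul_sum]
    _ ≤ ∑ x : {x // x ∈ B.Pos}, |(m x : ℝ) + 1 / 2| *
          ∑ y : {x // x ∈ B.Pos}, ∑ α ∈ B.Pos, |S.I (y : V) α| := by
        refine Finset.sum_le_sum fun x _ => mul_le_mul_of_nonneg_left ?_ (abs_nonneg _)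
        exact Finset.single_le_sum (f := fun y : {x // x ∈ B.Pos} => ∑ α ∈ B.Pos, |S.I (y : V) α|)
          (fun y _ => by positivity) (Finset.mem_univ x)
    _ = _ := by rw [← Finset.sum_mul, mul_comm]

lemma summable_multiCoeff_exp {v : ℝ} (hv : 0 < v) (D : ℝ) :
    Summable fun m : {x // x ∈ B.Pos} → ℤ =>
      |B.multiCoeff v m| * Real.exp (D * ∑ α ∈ B.Pos, |S.I α (B.latSum m)|) := by
  obtain ⟨C, hC, h⟩ := B.exists_sum_abs_I_latSum_le
  refine Summable.of_nonneg_of_le (fun _ => by positivity) (fun m => ?_)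
    (B.summable_multiCoeff hv (|D| * C))
  refine mul_le_mul_of_nonneg_left (Real.exp_le_exp.2 ?_) (abs_nonneg _)
  rw [mul_assoc]
  exact (mul_le_mul_of_nonneg_right (le_abs_self D) (Finset.sum_nonneg fun _ _ => abs_nonneg _)).trans
    (mul_le_mul_of_nonneg_left (h m) (abs_nonneg D))

lemma prod_oddTheta {v : ℝ} (hv : 0 < v) (s : ℝ) (y : V) :
    (Summable fun m : {x // x ∈ B.Pos} → ℤ =>
      B.multiCoeff v m * Real.exp (S.I (B.latSum m) y * s)) ∧
    ∑' m : {x // x ∈ B.Pos} → ℤ, B.multiCoeff v m * Real.exp (S.I (B.latSum m) y * s) =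
      ∏ α ∈ B.Pos, oddTheta (S.I α α * v) (s * S.I y α) := by
  have h0 : ∀ x : {x // x ∈ B.Pos}, 0 < S.I (x : V) x * v := fun x =>
    mul_pos (RootSys.I_self_pos (B.pos_sub x.2)) hv
  have h := tsum_pi_prod {x // x ∈ B.Pos} (fun x n => thetaCoeff (S.I (x : V) x * v) n *
    Real.exp (((n : ℝ) + 1 / 2) * (s * S.I y x)))
    (fun x => summable_thetaCoeff_exp (h0 x) _)
  have e : ∀ m : {x // x ∈ B.Pos} → ℤ, (∏ x : {x // x ∈ B.Pos},
      (thetaCoeff (S.I (x : V) x * v) (m x) *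
        Real.exp (((m x : ℝ) + 1 / 2) * (s * S.I y x)))) =
      B.multiCoeff v m * Real.exp (S.I (B.latSum m) y * s) := fun m => by
    rw [Finset.prod_mul_distrib, ← Real.exp_sum, multiCoeff, I_latSum, Finset.sum_mul]
    congr 2
    exact Finset.sum_congr rfl fun x _ => by rw [S.symm y]; ring
  simp only [e] at h
  refine ⟨h.1.of_abs, h.2.trans ?_⟩
  rw [← Finset.prod_coe_sort B.Pos]
  exact Finset.prod_congr rfl fun x _ => tsum_thetaCoeff_exp (h0 x) _

lemma prod_oddTheta_refl {a : V} (ha : a ∈ B.Pi) (v s : ℝ) (y : V) :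
    ∏ α ∈ B.Pos, oddTheta (S.I α α * v) (s * S.I (S.refl a y) α) =
      -∏ α ∈ B.Pos, oddTheta (S.I α α * v) (s * S.I y α) := by
  have haR := B.pi_mem_R ha
  rw [← Finset.mul_prod_erase _ _ (B.pi_sub ha),
    ← Finset.mul_prod_erase _ (fun α => oddTheta (S.I α α * v) (s * S.I y α)) (B.pi_sub ha),
    ← B.prod_erase_refl ha (fun α => oddTheta (S.I α α * v) (s * S.I y α)), ← neg_mul,
    ← oddTheta_neg]
  congr 1
  · rw [RootSys.I_refl_left haR, RootSys.refl_self haR, map_neg, mul_neg]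
  · refine Finset.prod_congr rfl fun α _ => ?_
    rw [RootSys.I_refl_left haR, RootSys.I_refl_refl haR]

/-- The multivariable theta identity obtained by antisymmetrisation. -/
lemma exists_multi_identity : ∃ M : ℝ, 0 < M ∧ ∀ v : ℝ, 0 < v → ∀ s : ℝ,
    M * ∏ α ∈ B.Pos, oddTheta (S.I α α * v) (s * S.I (weylVec B) α) =
      ∑' m : {x // x ∈ B.Pos} → ℤ, B.multiCoeff v m *
        ∏ α ∈ B.Pos, 2 * Real.sinh (s * S.I α (B.latSum m) / 2) := by
  obtain ⟨M, hM, h⟩ := B.exists_altSum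
  refine ⟨M, hM, fun v hv s => ?_⟩
  rw [← h (fun y => ∏ α ∈ B.Pos, oddTheta (S.I α α * v) (s * S.I y α))
    fun a ha x => B.prod_oddTheta_refl ha v s x]
  have e : ∀ m : {x // x ∈ B.Pos} → ℤ,
      ∏ α ∈ B.Pos, 2 * Real.sinh (s * S.I α (B.latSum m) / 2) =
      B.altSum fun x => Real.exp (S.I (B.latSum m) x * s) := fun m => by
    have := B.prod_sinh (s • B.latSum m)
    simp only [map_smul, smul_eq_mul] at this
    rw [this]
    congr 1
    funext x
    rw [S.symm x, mul_comm]
  simp only [e]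
  simp only [altSum]
  simp only [← (B.prod_oddTheta hv s _).2, Finset.mul_sum, ← tsum_mul_left]
  rw [← Summable.tsum_finsetSum fun E _ => ?_]
  · exact tsum_congr fun m => Finset.sum_congr rfl fun E _ => by ring
  · exact (B.prod_oddTheta hv s _).1.mul_left _

end Base

namespace RootSys

variable {V : Type} [AddCommGroup V] [Module ℝ V] {S : RootSys V}

lemma co_int_of_mem_rootLat {α γ : V} (hα : α ∈ S.R) (hγ : γ ∈ rootLat S) :
    ∃ n : ℤ, S.co α γ = n := by
  induction hγ using AddSubgroup.closure_induction with
  | mem x hx => exact co_int hα hx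
  | zero => exact ⟨0, by simp⟩
  | add x y _ _ hx hy =>
    obtain ⟨m, hm⟩ := hx
    obtain ⟨n, hn⟩ := hy
    exact ⟨m + n, by rw [map_add, hm, hn]; push_cast; rfl⟩
  | neg x _ hx =>
    obtain ⟨m, hm⟩ := hx
    exact ⟨-m, by rw [map_neg, hm]; push_cast; rfl⟩

lemma refl_mem_rootLat {α γ : V} (hα : α ∈ S.R) (hγ : γ ∈ rootLat S) :
    S.refl α γ ∈ rootLat S := by
  obtain ⟨n, hn⟩ := co_int_of_mem_rootLat hα hγ
  rw [refl_apply, hn, Int.cast_smul_eq_zsmul]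
  exact sub_mem hγ (zsmul_mem (AddSubgroup.subset_closure hα) n)

end RootSys

namespace Base

variable {V : Type} [AddCommGroup V] [Module ℝ V] {S : RootSys V} (B : Base S)

lemma sum_co_simple {a : V} (ha : a ∈ B.Pi) : ∑ α ∈ B.Pos, S.co α a = 2 := by
  have haR := B.pi_mem_R ha
  have h := B.sum_erase_refl ha (fun α => S.co α a)
  have h1 : ∀ α ∈ B.Pos.erase a, S.co (S.refl a α) a = -S.co α a := fun α _ => by
    rw [RootSys.co_refl_left haR, RootSys.refl_self haR, map_neg]
  rw [Finset.sum_congr rfl h1, Finset.sum_neg_distrib] at h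
  rw [← Finset.add_sum_erase _ _ (B.pi_sub ha), RootSys.co_self haR]
  linarith

lemma exists_sum_co_eq_two_mul {γ : V} (hγ : γ ∈ rootLat S) :
    ∃ n : ℤ, ∑ α ∈ B.Pos, S.co α γ = ((2 * n : ℤ) : ℝ) := by
  have h : γ ∈ AddSubgroup.closure (B.Pi : Set V) := by
    refine (AddSubgroup.closure_le _).2 (fun α hα => ?_) hγ
    exact B.root_mem_closure hα
  clear hγ
  induction h using AddSubgroup.closure_induction with
  | mem x hx => exact ⟨1, by rw [B.sum_co_simple hx]; norm_num⟩
  | zero => exact ⟨0, by simp⟩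
  | add x y _ _ hx hy =>
    obtain ⟨m, hm⟩ := hx
    obtain ⟨n, hn⟩ := hy
    exact ⟨m + n, by simp only [map_add, Finset.sum_add_distrib, hm, hn]; push_cast; ring⟩
  | neg x _ hx =>
    obtain ⟨m, hm⟩ := hx
    exact ⟨-m, by simp only [map_neg, Finset.sum_neg_distrib, hm]; push_cast; ring⟩

/-- The pairings of a lattice vector with the positive coroots. -/
noncomputable def pairVec (γ : V) (x : {x // x ∈ B.Pos}) : ℤ := ⌊S.co (x : V) γ⌋

lemma pairVec_cast {γ : V} (hγ : γ ∈ rootLat S) (x : {x // x ∈ B.Pos}) :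
    (B.pairVec γ x : ℝ) = S.co (x : V) γ := by
  obtain ⟨n, hn⟩ := RootSys.co_int_of_mem_rootLat (B.pos_sub x.2) hγ
  rw [pairVec, hn, Int.floor_intCast]

lemma even_sum_pairVec {γ : V} (hγ : γ ∈ rootLat S) : Even (∑ x, B.pairVec γ x) := by
  obtain ⟨n, hn⟩ := B.exists_sum_co_eq_two_mul hγ
  rw [← Finset.sum_coe_sort B.Pos, ← Finset.sum_congr rfl fun x _ => B.pairVec_cast hγ x] at hn
  exact ⟨n, by have : ∑ x, B.pairVec γ x = 2 * n := by exact_mod_cast hn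
               omega⟩

section

variable {c : ℝ} (hop : ∀ x, B.sumOp (fun α => 2 / S.I α α) x = c • x)

include hop

lemma sum_co_smul (γ : V) : ∑ x : {x // x ∈ B.Pos}, S.co (x : V) γ • (x : V) = c • γ := by
  rw [← hop, sumOp_apply, ← Finset.sum_coe_sort B.Pos]
  exact Finset.sum_congr rfl fun x _ => by rw [RootSys.co_apply]

lemma latSum_add {γ : V} (hγ : γ ∈ rootLat S) (m : {x // x ∈ B.Pos} → ℤ) :
    B.latSum (m + B.pairVec γ) = B.latSum m + c • γ := by
  rw [← B.sum_co_smul hop, latSum, latSum, ← Finset.sum_add_distrib]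
  refine Finset.sum_congr rfl fun x _ => ?_
  rw [← B.pairVec_cast hγ, ← add_smul, Pi.add_apply]
  push_cast
  congr 1
  ring

lemma multiCoeff_add (hc : c ≠ 0) {γ : V} (hγ : γ ∈ rootLat S) (v : ℝ)
    (m : {x // x ∈ B.Pos} → ℤ) :
    B.multiCoeff v (m + B.pairVec γ) =
      Real.exp (-(v / c * (S.I (B.latSum m + c • γ) (B.latSum m + c • γ) -
        S.I (B.latSum m) (B.latSum m)))) * B.multiCoeff v m := by
  simp only [multiCoeff, Pi.add_apply, thetaCoeff_add]
  rw [Finset.prod_mul_distrib, Finset.prod_mul_distrib]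
  congr 1
  have h1 : ∏ x : {x // x ∈ B.Pos}, (-1 : ℝ) ^ B.pairVec γ x = 1 := by
    have h2 : ∀ T : Finset {x // x ∈ B.Pos}, ∏ x ∈ T, (-1 : ℝ) ^ B.pairVec γ x =
        (-1) ^ ∑ x ∈ T, B.pairVec γ x := fun T => by
      induction T using Finset.induction_on with
      | empty => simp
      | insert x T hx ih =>
        rw [Finset.prod_insert hx, Finset.sum_insert hx, zpow_add₀ (by norm_num), ih]
    rw [h2, (B.even_sum_pairVec hγ).neg_one_zpow]
  rw [h1, one_mul, ← Real.exp_sum, Finset.sum_neg_distrib]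
  congr 2
  have h3 : ∀ x : {x // x ∈ B.Pos}, S.I (x : V) x * v / 2 *
      (2 * ((m x : ℝ) + 1 / 2) * (B.pairVec γ x : ℝ) + (B.pairVec γ x : ℝ) ^ 2) =
      v * (2 * (((m x : ℝ) + 1 / 2) * S.I (x : V) γ) + S.co (x : V) γ * S.I (x : V) γ) := fun x => by
    have := (RootSys.I_self_pos (B.pos_sub x.2)).ne'
    rw [B.pairVec_cast hγ, RootSys.co_apply]
    field_simp
  have h4 : ∑ x : {x // x ∈ B.Pos}, S.co (x : V) γ * S.I (x : V) γ = c * S.I γ γ := by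
    have := congrArg (fun y => S.I y γ) (B.sum_co_smul hop γ)
    simpa [map_sum, LinearMap.sum_apply] using this
  rw [Finset.sum_congr rfl fun x _ => h3 x, ← Finset.mul_sum, Finset.sum_add_distrib,
    ← Finset.mul_sum, ← I_latSum, h4]
  simp only [map_add, map_smul, LinearMap.add_apply, LinearMap.smul_apply, smul_eq_mul,
    S.symm γ (B.latSum m)]
  field_simp
  ring

lemma wtCoeff_add (hc : c ≠ 0) {γ : V} (hγ : γ ∈ rootLat S) (v : ℝ) (y : V) :
    B.wtCoeff v (y + c • γ) =
      Real.exp (-(v / c * (S.I (y + c • γ) (y + c • γ) - S.I y y))) * B.wtCoeff v y := by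
  rw [wtCoeff, wtCoeff, ← tsum_mul_left, ← (Equiv.addRight (B.pairVec γ)).tsum_eq]
  refine tsum_congr fun m => ?_
  rw [Equiv.coe_addRight, B.latSum_add hop hγ, B.multiCoeff_add hop hc hγ]
  simp only [add_left_inj]
  split_ifs with h
  · rw [h]
  · rw [mul_zero]

end

end Base

namespace Base

variable {V : Type} [AddCommGroup V] [Module ℝ V] {S : RootSys V} (B : Base S)

/-- The orbit of the Weyl vector under the simple reflections and the translations by the dilated
root lattice. -/
inductive Reach (c : ℝ) : V → Prop
  | base : Reach c (weylVec B)
  | refl {a y : V} (ha : a ∈ B.Pi) (hy : Reach c y) : Reach c (S.refl a y)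
  | shift {γ y : V} (hγ : γ ∈ rootLat S) (hy : Reach c y) : Reach c (y + c • γ)

lemma Reach.refl_root {c : ℝ} {α y : V} (hα : α ∈ S.R) (hy : B.Reach c y) :
    B.Reach c (S.refl α y) := by
  refine B.root_induction (P := fun α => ∀ y, B.Reach c y → B.Reach c (S.refl α y))
    (fun a ha y h => .refl ha h) (fun a ha β _ ih y h => ?_) (fun β _ ih y h => ?_) α hα y hy
  · rw [RootSys.refl_conj (B.pi_mem_R ha)]
    exact .refl ha (ih _ (.refl ha h))
  · rw [RootSys.refl_neg]; exact ih _ h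

lemma mem_rootLat_of_wtCoeff {v : ℝ} {y : V} (h : B.wtCoeff v y ≠ 0) :
    y - weylVec B ∈ rootLat S := by
  have : ∃ m, B.latSum m = y := by
    by_contra! hm
    apply h
    rw [wtCoeff]
    simp [hm]
  obtain ⟨m, rfl⟩ := this
  rw [← latSum_zero, latSum, latSum, ← Finset.sum_sub_distrib]
  refine sum_mem fun x _ => ?_
  rw [← sub_smul]
  have : ((m x : ℝ) + 1 / 2) - (((0 : {x // x ∈ B.Pos} → ℤ) x : ℝ) + 1 / 2) = (m x : ℝ) := by
    simp
  rw [this, Int.cast_smul_eq_zsmul]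
  exact zsmul_mem (AddSubgroup.subset_closure (B.pos_sub x.2)) _

section

variable {θs : V} (hθsR : θs ∈ S.R)
  (hθshigh : ∀ α ∈ S.R, S.I α α = S.I θs θs →
    ∃ c : V → ℕ, θs - α = ∑ b ∈ B.Pi, (c b : ℝ) • b)

include hθsR hθshigh

lemma eq_zero_of_dominant_of_highest {μ : V} (h1 : ∀ a ∈ B.Pi, 0 ≤ S.I μ a)
    (h2 : S.I μ θs ≤ 0) : μ = 0 := by
  have h3 : ∀ α ∈ S.R, S.I α α = S.I θs θs → S.I μ α ≤ 0 := fun α hα hl => by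
    refine le_trans ?_ h2
    rw [B.I_eq_sum_coord, B.I_eq_sum_coord μ θs]
    exact Finset.sum_le_sum fun b _ =>
      mul_le_mul_of_nonneg_right (B.coord_le_highest hθsR hθshigh hα hl b) (h1 b b.2)
  have h4 : ∀ α ∈ S.R, S.I α α = S.I θs θs → S.I μ α = 0 := fun α hα hl => by
    have := h3 (-α) (RootSys.neg_mem hα) (by simpa using hl)
    rw [map_neg] at this
    linarith [h3 α hα hl]
  obtain ⟨k, hk⟩ := B.sumOp_scalar (f := fun α => if S.I α α = S.I θs θs then 1 else 0)
    (fun α hα β _ => by rw [RootSys.I_refl_refl hα])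
  have h5 := B.sumOp_quad hk μ μ
  have h6 := B.sumOp_trace hk
  have h7 : 0 < ∑ α ∈ B.Pos, (if S.I α α = S.I θs θs then (1 : ℝ) else 0) * S.I α α := by
    refine Finset.sum_pos' (fun α _ => mul_nonneg (by split_ifs <;> norm_num)
      (RootSys.I_self_nonneg α)) ⟨θs, B.highest_pos hθsR hθshigh, ?_⟩
    rw [if_pos rfl, one_mul]
    exact RootSys.I_self_pos hθsR
  rw [← h6] at h7
  have h8 : k ≠ 0 := by rintro rfl; simp at h7
  rw [Finset.sum_eq_zero fun α hα => ?_, eq_comm, mul_eq_zero, or_iff_right h8] at h5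
  · exact RootSys.eq_zero_of_I_self h5
  · split_ifs with hl
    · rw [S.symm α, h4 α (B.pos_sub hα) hl]; ring
    · ring

variable (hmin : ∀ α ∈ S.R, S.I θs θs ≤ S.I α α)

include hmin

lemma reach_of_wtCoeff {v : ℝ} {y : V} (h : B.wtCoeff v y ≠ 0) :
    B.Reach (1 + S.co θs (weylVec B)) y := by
  set c := 1 + S.co θs (weylVec B) with hc
  have hop := B.sumOp_coroot hθsR hθshigh hmin
  rw [← hc] at hop
  have hr := RootSys.I_self_pos hθsR
  have hθpos := B.highest_pos hθsR hθshigh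
  have hcI : S.I (weylVec B) θs = (c - 1) * S.I θs θs / 2 := by
    rw [hc, RootSys.co_apply, S.symm]
    field_simp
    ring
  have hc0 : 0 < c := by
    have := B.I_weylVec_pos hθpos
    rw [hcI] at this
    nlinarith
  suffices H : ∀ N : ℕ, ∀ y, B.wtCoeff v y ≠ 0 →
      S.I (y - weylVec B) (y - weylVec B) < N * S.I θs θs → B.Reach c y by
    obtain ⟨N, hN⟩ := exists_nat_gt (S.I (y - weylVec B) (y - weylVec B) / S.I θs θs)
    exact H N y h ((div_lt_iff₀ hr).1 hN)
  intro N
  induction N with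
  | zero =>
    intro y _ hy
    have := RootSys.I_self_nonneg (S := S) (y - weylVec B)
    rw [Nat.cast_zero, zero_mul] at hy
    linarith
  | succ N ih =>
    intro y hy hN
    push_cast at hN
    have hmem := B.mem_rootLat_of_wtCoeff hy
    have hcoint : ∀ α ∈ S.R, ∃ n : ℤ, S.co α y = n := fun α hα => by
      obtain ⟨m, hm⟩ := RootSys.co_int_of_mem_rootLat hα hmem
      obtain ⟨n, hn⟩ := B.co_weylVec_int hα
      refine ⟨m + n, ?_⟩
      rw [map_sub] at hm
      push_cast
      linarith
    by_cases h1 : ∃ a ∈ B.Pi, S.co a y ≤ 0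
    · obtain ⟨a, ha, hay⟩ := h1
      have haR := B.pi_mem_R ha
      obtain ⟨n, hn⟩ := hcoint a haR
      have hn0 : n ≠ 0 := fun h0 => hy (B.wtCoeff_eq_zero_of_co haR v (by rw [hn, h0]; simp))
      have hn1 : n ≤ -1 := by
        have : (n : ℝ) ≤ 0 := hn ▸ hay
        have : n ≤ 0 := by exact_mod_cast this
        omega
      have hn2 : (n : ℝ) ≤ -1 := by exact_mod_cast hn1
      rw [← RootSys.refl_refl haR y]
      refine .refl ha (ih _ (by rwa [B.wtCoeff_simple ha, neg_ne_zero]) ?_)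
      have e1 : S.I a y = n * S.I a a / 2 := by
        rw [← hn, RootSys.co_apply]
        have := (RootSys.I_self_pos haR).ne'
        field_simp
      have e2 := B.I_weylVec_pi ha
      have e3 := hmin a haR
      have e4 : S.I (S.refl a y - weylVec B) (S.refl a y - weylVec B) =
          S.I (y - weylVec B) (y - weylVec B) + n * S.I a a := by
        rw [RootSys.refl_apply, hn]
        simp only [map_sub, map_smul, LinearMap.sub_apply, LinearMap.smul_apply, smul_eq_mul,
          S.symm y a, S.symm a (weylVec B), e1, e2]
        ring
      rw [e4]
      nlinarith
    push Not at h1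
    obtain ⟨n, hn⟩ := hcoint θs hθsR
    obtain ⟨k, hk⟩ := B.co_weylVec_int hθsR
    have hck : c = 1 + k := by rw [hc, hk]
    by_cases h2 : c ≤ S.co θs y
    · have e0 : S.I θs y = n * S.I θs θs / 2 := by
        rw [← hn, RootSys.co_apply]
        field_simp
      have hne : n ≠ 1 + k := fun h0 => by
        apply hy
        have hnc : S.co θs y = c := by rw [hn, hck, h0]; push_cast; rfl
        have w1 := B.wtCoeff_refl hθsR v y
        have w2 := B.wtCoeff_add hop hc0.ne' (neg_mem (AddSubgroup.subset_closure hθsR)) v y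
        have e5 : y + c • -θs = S.refl θs y := by
          rw [RootSys.refl_apply, hnc, smul_neg, sub_eq_add_neg]
        rw [e5, w1, RootSys.I_refl_refl hθsR, sub_self, mul_zero, neg_zero, Real.exp_zero] at w2
        linarith
      have hn1 : 1 + k + 1 ≤ n := by
        have : ((1 + k : ℤ) : ℝ) ≤ n := by rw [← hn]; push_cast; rw [← hck]; exact h2
        have : 1 + k ≤ n := by exact_mod_cast this
        omega
      have hn2 : c + 1 ≤ n := by rw [hck]; exact_mod_cast hn1
      set z := S.refl θs y + c • θs with hz
      have hzw : B.wtCoeff v z ≠ 0 := by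
        rw [hz, B.wtCoeff_add hop hc0.ne' (AddSubgroup.subset_closure hθsR), B.wtCoeff_refl hθsR]
        exact mul_ne_zero (Real.exp_ne_zero _) (neg_ne_zero.2 hy)
      have e6 : z = y - ((n : ℝ) - c) • θs := by
        rw [hz, RootSys.refl_apply, hn]
        module
      have e7 : y = S.refl θs z + c • θs := by
        rw [hz, map_add, RootSys.refl_refl hθsR, map_smul, RootSys.refl_self hθsR]
        module
      rw [e7]
      refine .shift (AddSubgroup.subset_closure hθsR) (.refl_root B hθsR (ih _ hzw ?_))
      have e4 : S.I (z - weylVec B) (z - weylVec B) =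
          S.I (y - weylVec B) (y - weylVec B) - (n - c) * S.I θs θs := by
        rw [e6]
        simp only [map_sub, map_smul, LinearMap.sub_apply, LinearMap.smul_apply, smul_eq_mul,
          S.symm y θs, S.symm θs (weylVec B), e0, hcI]
        ring
      rw [e4]
      nlinarith
    push Not at h2
    have h3 : y - weylVec B = 0 := by
      refine B.eq_zero_of_dominant_of_highest hθsR hθshigh (fun a ha => ?_) ?_
      · have haR := B.pi_mem_R ha
        obtain ⟨p, hp⟩ := hcoint a haR
        have hp0 := h1 a ha
        have hp1 : (1 : ℝ) ≤ p := by
          rw [hp] at hp0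
          have : 0 < p := by exact_mod_cast hp0
          exact_mod_cast this
        have haa := RootSys.I_self_pos haR
        have e1 : S.I y a = p * S.I a a / 2 := by
          rw [← hp, RootSys.co_apply, S.symm y]
          field_simp
        rw [map_sub, LinearMap.sub_apply, e1, B.I_weylVec_pi ha]
        nlinarith
      · have hn1 : (n : ℝ) ≤ c - 1 := by
          rw [hn, hck] at h2
          have : n < 1 + k := by exact_mod_cast h2
          have : n ≤ k := by omega
          rw [hck]
          have : (n : ℝ) ≤ k := by exact_mod_cast this
          linarith
        have e0 : S.I y θs = n * S.I θs θs / 2 := by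
          rw [← hn, RootSys.co_apply, S.symm y]
          field_simp
        rw [map_sub, LinearMap.sub_apply, e0, hcI]
        nlinarith
    rw [sub_eq_zero] at h3
    rw [h3]
    exact .base

end

end Base

/-- The root lattice dilated by `c`. -/
def scaledLat {V : Type} [AddCommGroup V] [Module ℝ V] (S : RootSys V) (c : ℝ) : AddSubgroup V where
  carrier := {x | ∃ y ∈ rootLat S, x = c • y}
  zero_mem' := ⟨0, zero_mem _, by simp⟩
  add_mem' := by
    rintro _ _ ⟨y, hy, rfl⟩ ⟨z, hz, rfl⟩
    exact ⟨y + z, add_mem hy hz, (smul_add _ _ _).symm⟩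
  neg_mem' := by
    rintro _ ⟨y, hy, rfl⟩
    exact ⟨-y, neg_mem hy, (smul_neg _ _).symm⟩

namespace Base

variable {V : Type} [AddCommGroup V] [Module ℝ V] {S : RootSys V} (B : Base S)

lemma refl_mem_scaledLat {α γ : V} {c : ℝ} (hα : α ∈ S.R) (hγ : γ ∈ scaledLat S c) :
    S.refl α γ ∈ scaledLat S c := by
  obtain ⟨y, hy, rfl⟩ := hγ
  exact ⟨S.refl α y, RootSys.refl_mem_rootLat hα hy, map_smul _ _ _⟩

/-- The identification of a coset of the dilated lattice with the lattice. -/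
noncomputable def cosetEquiv (c : ℝ) (y : V) :
    scaledLat S c ≃ ((QuotientAddGroup.mk : V → V ⧸ scaledLat S c) ⁻¹' {(y : V ⧸ scaledLat S c)}) where
  toFun γ := ⟨y + γ, by
    rw [Set.mem_preimage, Set.mem_singleton_iff, eq_comm, QuotientAddGroup.eq]
    simp⟩
  invFun z := ⟨-y + z, by
    have := z.2
    rwa [Set.mem_preimage, Set.mem_singleton_iff, eq_comm, QuotientAddGroup.eq] at this⟩
  left_inv γ := by simp
  right_inv z := by simp

/-- A function invariant under simple reflections has equal sums over the reachable cosets. -/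
lemma tsum_coset_eq {A : V → ℝ} (hA : ∀ a ∈ B.Pi, ∀ y, A (S.refl a y) = A y) {c : ℝ} {y : V}
    (hy : B.Reach c y) :
    ∑' γ : scaledLat S c, A (y + γ) = ∑' γ : scaledLat S c, A (weylVec B + γ) := by
  induction hy with
  | base => rfl
  | @refl a y ha _ ih =>
    have haR := B.pi_mem_R ha
    rw [← ih]
    let E : scaledLat S c ≃ scaledLat S c :=
      ⟨fun γ => ⟨S.refl a γ, refl_mem_scaledLat haR γ.2⟩,
        fun γ => ⟨S.refl a γ, refl_mem_scaledLat haR γ.2⟩,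
        fun γ => Subtype.ext (RootSys.refl_refl haR _),
        fun γ => Subtype.ext (RootSys.refl_refl haR _)⟩
    have h := E.tsum_eq (fun γ : scaledLat S c => A (S.refl a y + γ))
    rw [← h]
    refine tsum_congr fun γ => ?_
    rw [← hA a ha (y + γ), map_add]
    rfl
  | @shift γ y hγ _ ih =>
    rw [← ih]
    have h := (Equiv.addLeft (⟨c • γ, γ, hγ, rfl⟩ : scaledLat S c)).tsum_eq
      (fun γ : scaledLat S c => A (y + γ))
    rw [← h]
    refine tsum_congr fun δ => ?_
    rw [Equiv.coe_addLeft, AddSubgroup.coe_add, add_assoc]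

/-- The number of reachable cosets of the dilated lattice. -/
noncomputable def numCosets (c : ℝ) : ℕ :=
  Nat.card {C : V ⧸ scaledLat S c // ∃ y : V, (y : V ⧸ scaledLat S c) = C ∧ B.Reach c y}

lemma tsum_reach {A : V → ℝ} (hA : ∀ a ∈ B.Pi, ∀ y, A (S.refl a y) = A y) {c : ℝ}
    (hs : Summable A) (hr : ∀ y, A y ≠ 0 → B.Reach c y) :
    ∑' y, A y = B.numCosets c * ∑' γ : scaledLat S c, A (weylVec B + γ) := by
  have h1 := (hs.hasSum.tsum_fiberwise (QuotientAddGroup.mk : V → V ⧸ scaledLat S c)).tsum_eq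
  set P : Set (V ⧸ scaledLat S c) := {C | ∃ y : V, (y : V ⧸ scaledLat S c) = C ∧ B.Reach c y}
  have h2 : ∀ C : V ⧸ scaledLat S c,
      ∑' b : ((QuotientAddGroup.mk : V → V ⧸ scaledLat S c) ⁻¹' {C}), A b =
      P.indicator (fun _ => ∑' γ : scaledLat S c, A (weylVec B + γ)) C := fun C => by
    by_cases hC : C ∈ P
    · rw [Set.indicator_of_mem hC]
      obtain ⟨y, rfl, hy⟩ := hC
      rw [← B.tsum_coset_eq hA hy]
      exact ((cosetEquiv c y).tsum_eq (fun b => A b)).symm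
    · rw [Set.indicator_of_notMem hC]
      refine (tsum_congr fun b => ?_).trans tsum_zero
      by_contra h0
      exact hC ⟨b, b.2, hr _ h0⟩
  rw [← h1, tsum_congr h2, ← tsum_subtype, tsum_const, nsmul_eq_mul]
  rfl

section

variable {θs : V} (hθsR : θs ∈ S.R)
  (hθshigh : ∀ α ∈ S.R, S.I α α = S.I θs θs →
    ∃ c : V → ℕ, θs - α = ∑ b ∈ B.Pi, (c b : ℝ) • b)
  (hmin : ∀ α ∈ S.R, S.I θs θs ≤ S.I α α)

include hθsR hθshigh hmin

lemma tsum_multiCoeff_mul {c : ℝ} (hc : c = 1 + S.co θs (weylVec B)) (hc0 : 0 < c) {v : ℝ}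
    {φ : V → ℝ} (hφ : ∀ a ∈ B.Pi, ∀ y, φ (S.refl a y) = -φ y)
    (hs : Summable fun m => B.multiCoeff v m * φ (B.latSum m)) :
    ∑' m, B.multiCoeff v m * φ (B.latSum m) =
      B.numCosets c * (B.wtCoeff v (weylVec B) *
        Real.exp (v / c * S.I (weylVec B) (weylVec B))) *
      ∑' γ : scaledLat S c, φ (weylVec B + γ) *
        Real.exp (-(v * (S.I (weylVec B + γ) (weylVec B + γ) / c))) := by
  have hop := B.sumOp_coroot hθsR hθshigh hmin
  rw [← hc] at hop
  have h0 := hs.hasSum.tsum_fiberwise B.latSum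
  have h1 : ∀ y, ∑' b : (B.latSum ⁻¹' {y}), B.multiCoeff v b * φ (B.latSum b) =
      B.wtCoeff v y * φ y := fun y => by
    rw [tsum_subtype (B.latSum ⁻¹' {y}) (fun b => B.multiCoeff v b * φ (B.latSum b)), wtCoeff,
      ← tsum_mul_right]
    refine tsum_congr fun m => ?_
    rw [Set.indicator_apply]
    by_cases h : B.latSum m = y
    · rw [if_pos h, if_pos (by simpa using h), h]
    · rw [if_neg h, if_neg (by simpa using h), zero_mul]
  simp only [h1] at h0
  rw [← h0.tsum_eq, B.tsum_reach (c := c) (fun a ha y => by rw [B.wtCoeff_simple ha, hφ a ha]; ring)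
    h0.summable fun y hy => ?_, mul_assoc]
  · congr 1
    rw [← tsum_mul_left]
    refine tsum_congr fun γ => ?_
    obtain ⟨_, y, hy, rfl⟩ := γ
    rw [B.wtCoeff_add hop hc0.ne' hy]
    have : -(v / c * (S.I (weylVec B + c • y) (weylVec B + c • y) -
        S.I (weylVec B) (weylVec B))) = v / c * S.I (weylVec B) (weylVec B) +
        -(v * (S.I (weylVec B + c • y) (weylVec B + c • y) / c)) := by ring
    rw [this, Real.exp_add]
    ring
  · rw [hc]
    exact B.reach_of_wtCoeff hθsR hθshigh hmin (left_ne_zero_of_mul hy)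

lemma summable_scaledLat {c : ℝ} (hc : c = 1 + S.co θs (weylVec B)) (hc0 : 0 < c) {v : ℝ}
    {φ : V → ℝ} (hs : Summable fun m => |B.multiCoeff v m * φ (B.latSum m)|) :
    Summable fun γ : scaledLat S c => |φ (weylVec B + γ)| *
        Real.exp (-(v * (S.I (weylVec B + γ) (weylVec B + γ) / c))) := by
  have hop := B.sumOp_coroot hθsR hθshigh hmin
  rw [← hc] at hop
  have hcs : ∀ γ : scaledLat S c, c⁻¹ • (γ : V) ∈ rootLat S := by
    rintro ⟨_, y, hy, rfl⟩
    rwa [inv_smul_smul₀ hc0.ne']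
  have hinj : Function.Injective fun γ : scaledLat S c => B.pairVec (c⁻¹ • (γ : V)) := by
    intro γ δ h
    have h1 := B.latSum_add hop (hcs γ) 0
    have h2 := B.latSum_add hop (hcs δ) 0
    simp only at h
    rw [h, h2, smul_inv_smul₀ hc0.ne', smul_inv_smul₀ hc0.ne'] at h1
    exact Subtype.ext (add_left_cancel h1).symm
  have h := (hs.comp_injective hinj).mul_left
    (|B.multiCoeff v 0|⁻¹ * Real.exp (-(v / c * S.I (weylVec B) (weylVec B))))
  refine h.congr fun γ => ?_
  have h1 := B.latSum_add hop (hcs γ) 0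
  have h2 := B.multiCoeff_add hop hc0.ne' (hcs γ) v 0
  rw [zero_add] at h1 h2
  rw [smul_inv_smul₀ hc0.ne', latSum_zero] at h1 h2
  have h3 := abs_ne_zero.2 (B.multiCoeff_ne_zero v 0)
  rw [Function.comp, h1, h2, abs_mul, abs_mul, Real.abs_exp]
  have : -(v * (S.I (weylVec B + γ) (weylVec B + γ) / c)) =
    -(v / c * S.I (weylVec B) (weylVec B)) + -(v / c * (S.I (weylVec B + γ) (weylVec B + γ) -
        S.I (weylVec B) (weylVec B))) := by ring
  rw [this, Real.exp_add]
  field_simp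

end

end Base

namespace Base

variable {V : Type} [AddCommGroup V] [Module ℝ V] {S : RootSys V} (B : Base S)

/-- The product of the pairings with the positive roots. -/
noncomputable def rootProd (y : V) : ℝ := ∏ α ∈ B.Pos, S.I α y

lemma rootProd_refl {a : V} (ha : a ∈ B.Pi) (y : V) :
    B.rootProd (S.refl a y) = -B.rootProd y := by
  have haR := B.pi_mem_R ha
  have h : ∀ α, S.I α (S.refl a y) = S.I (S.refl a α) y := fun α =>
    (RootSys.I_refl_left haR α y).symm
  simp only [rootProd, h]
  rw [← Finset.mul_prod_erase _ _ (B.pi_sub ha),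
    ← Finset.mul_prod_erase _ (fun α => S.I α y) (B.pi_sub ha),
    B.prod_erase_refl ha (fun α => S.I α y), RootSys.refl_self haR]
  simp

lemma rootProd_weylVec_pos : 0 < B.rootProd (weylVec B) :=
  Finset.prod_pos fun α hα => by rw [S.symm]; exact B.I_weylVec_pos hα

lemma rootProd_add (γ : V) :
    B.rootProd (weylVec B + γ) = B.rootProd (weylVec B) * dFun B γ := by
  rw [dFun, Finset.prod_div_distrib]
  have h : ∏ α ∈ B.Pos, S.I (weylVec B) α = B.rootProd (weylVec B) :=
    Finset.prod_congr rfl fun α _ => S.symm _ _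
  rw [h, mul_div_cancel₀ _ B.rootProd_weylVec_pos.ne', rootProd]
  exact Finset.prod_congr rfl fun α _ => by rw [S.symm, add_comm]

lemma multi_limits {v : ℝ} (hv : 0 < v) : ∃ M : ℝ, 0 < M ∧
    M * ∏ α ∈ B.Pos, thetaNull (S.I α α * v) * S.I (weylVec B) α =
      ∑' m, B.multiCoeff v m * B.rootProd (B.latSum m) ∧
    M * ((∏ α ∈ B.Pos, thetaNull (S.I α α * v) * S.I (weylVec B) α) *
        ∑ α ∈ B.Pos, thetaLog (S.I α α * v) / 3 * S.I (weylVec B) α ^ 2) =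
      ∑' m, B.multiCoeff v m * (B.rootProd (B.latSum m) *
        ∑ α ∈ B.Pos, S.I α (B.latSum m) ^ 2 / 24) := by
  obtain ⟨M, hM, hid⟩ := B.exists_multi_identity
  have hs := B.summable_multiCoeff_exp hv 2
  have h1 := tendsto_tsum_sinh hs
  have h2 := tendsto_tsum_sinh_sub hs
  have hp : ∀ α ∈ B.Pos, 0 < S.I α α * v := fun α hα =>
    mul_pos (RootSys.I_self_pos (B.pos_sub hα)) hv
  have hid' : ∀ s : ℝ, M * ∏ α ∈ B.Pos, oddTheta (S.I α α * v) (s * S.I (weylVec B) α) / s =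
      ∑' m : {x // x ∈ B.Pos} → ℤ, B.multiCoeff v m *
        ∏ α ∈ B.Pos, 2 * Real.sinh (s * S.I α (B.latSum m) / 2) / s := fun s => by
    simp only [Finset.prod_div_distrib, Finset.prod_const]
    simp only [← mul_div_assoc]
    rw [hid v hv, tsum_div_const]
  have h3 : Tendsto (fun s => M * ∏ α ∈ B.Pos,
      oddTheta (S.I α α * v) (s * S.I (weylVec B) α) / s) (𝓝[>] 0)
      (𝓝 (M * ∏ α ∈ B.Pos, thetaNull (S.I α α * v) * S.I (weylVec B) α)) :=
    (tendsto_finsetProd _ fun α hα => tendsto_oddTheta (hp α hα) _).const_mul M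
  have h4 := (tendsto_prod_sub_div B.Pos
    (fun α hα => tendsto_oddTheta (hp α hα) (S.I (weylVec B) α))
    (fun α hα => tendsto_oddTheta_sub (hp α hα) (S.I (weylVec B) α))).const_mul M
  simp only [hid'] at h3
  have h5 := tendsto_nhds_unique h3 h1
  refine ⟨M, hM, h5, tendsto_nhds_unique h4 (h2.congr fun s => ?_)⟩
  rw [← hid', ← h5]
  ring

/-- The specialised theta series of the dilated root lattice. -/
noncomputable def latSeries (c v : ℝ) : ℝ :=
  ∑' γ : scaledLat S c, dFun B γ * Real.exp (-(v * (S.I (weylVec B + γ) (weylVec B + γ) / c)))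

/-- The negative derivative of `latSeries`. -/
noncomputable def latSeriesDer (c v : ℝ) : ℝ :=
  ∑' γ : scaledLat S c, dFun B γ * (S.I (weylVec B + γ) (weylVec B + γ) / c) *
    Real.exp (-(v * (S.I (weylVec B + γ) (weylVec B + γ) / c)))

section

variable {θs : V} (hθsR : θs ∈ S.R)
  (hθshigh : ∀ α ∈ S.R, S.I α α = S.I θs θs →
    ∃ c : V → ℕ, θs - α = ∑ b ∈ B.Pi, (c b : ℝ) • b)
  (hmin : ∀ α ∈ S.R, S.I θs θs ≤ S.I α α)
  {c : ℝ} (hc : c = 1 + S.co θs (weylVec B)) (hc0 : 0 < c)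
  {k : ℝ} (hk : ∀ x, B.sumOp (fun _ => 1) x = k • x) (hk0 : 0 < k)

lemma summable_rootProd {v : ℝ} (hv : 0 < v) :
    Summable fun m => |B.multiCoeff v m * B.rootProd (B.latSum m)| := by
  refine Summable.of_nonneg_of_le (fun _ => abs_nonneg _) (fun m => ?_)
    (B.summable_multiCoeff_exp hv 2)
  rw [abs_mul]
  exact mul_le_mul_of_nonneg_left (abs_prod_le_exp _ _) (abs_nonneg _)

include hk hk0 in
lemma summable_rootProd_mul {v : ℝ} (hv : 0 < v) :
    Summable fun m => |B.multiCoeff v m * (B.rootProd (B.latSum m) *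
      S.I (B.latSum m) (B.latSum m))| := by
  refine Summable.of_nonneg_of_le (fun _ => abs_nonneg _) (fun m => ?_)
    ((B.summable_multiCoeff_exp hv 4).mul_left (2 / k))
  have h1 : k * S.I (B.latSum m) (B.latSum m) = ∑ α ∈ B.Pos, S.I α (B.latSum m) ^ 2 := by
    rw [← B.sumOp_quad hk]
    exact Finset.sum_congr rfl fun α _ => by ring
  set σ := ∑ α ∈ B.Pos, |S.I α (B.latSum m)| with hσ
  have hσ0 : 0 ≤ σ := Finset.sum_nonneg fun _ _ => abs_nonneg _
  have h2 : ∑ α ∈ B.Pos, S.I α (B.latSum m) ^ 2 ≤ σ ^ 2 := by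
    have := Finset.sum_sq_le_sq_sum_of_nonneg (s := B.Pos)
      (f := fun α => |S.I α (B.latSum m)|) fun _ _ => abs_nonneg _
    simpa only [sq_abs] using this
  have h3 : σ ^ 2 ≤ 2 * Real.exp (2 * σ) := by
    have := Real.quadratic_le_exp_of_nonneg hσ0
    have h4 : Real.exp σ ≤ Real.exp (2 * σ) := Real.exp_le_exp.2 (by linarith)
    nlinarith
  have h5 : |B.rootProd (B.latSum m)| ≤ Real.exp (2 * σ) := abs_prod_le_exp _ _
  have h6 : |S.I (B.latSum m) (B.latSum m)| ≤ 2 / k * Real.exp (2 * σ) := by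
    rw [abs_of_nonneg (RootSys.I_self_nonneg _), div_mul_eq_mul_div, le_div_iff₀ hk0, mul_comm]
    linarith
  rw [abs_mul, abs_mul]
  calc |B.multiCoeff v m| * (|B.rootProd (B.latSum m)| * |S.I (B.latSum m) (B.latSum m)|)
      ≤ |B.multiCoeff v m| * (Real.exp (2 * σ) * (2 / k * Real.exp (2 * σ))) := by gcongr
    _ = 2 / k * (|B.multiCoeff v m| * Real.exp (4 * σ)) := by
      rw [show 4 * σ = 2 * σ + 2 * σ by ring, Real.exp_add]; ring

include hθsR hθshigh hmin hc hc0

lemma summable_latSeries {v : ℝ} (hv : 0 < v) : Summable fun γ : scaledLat S c =>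
    |dFun B γ| * Real.exp (-(v * (S.I (weylVec B + γ) (weylVec B + γ) / c))) := by
  have h := (B.summable_scaledLat hθsR hθshigh hmin hc hc0 (B.summable_rootProd hv)).mul_left
    (B.rootProd (weylVec B))⁻¹
  refine h.congr fun γ => ?_
  have h0 := B.rootProd_weylVec_pos
  rw [rootProd_add, abs_mul, abs_of_pos h0]
  field_simp

include hk hk0

lemma summable_latSeriesDer {v : ℝ} (hv : 0 < v) : Summable fun γ : scaledLat S c =>
    |dFun B γ| * (S.I (weylVec B + γ) (weylVec B + γ) / c) *
      Real.exp (-(v * (S.I (weylVec B + γ) (weylVec B + γ) / c))) := by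
  have h := (B.summable_scaledLat hθsR hθshigh hmin hc hc0
    (φ := fun y => B.rootProd y * S.I y y) (B.summable_rootProd_mul hk hk0 hv)).mul_left
    ((B.rootProd (weylVec B))⁻¹ / c)
  refine h.congr fun γ => ?_
  have h0 := B.rootProd_weylVec_pos
  rw [rootProd_add, abs_mul, abs_mul, abs_of_pos h0, abs_of_nonneg (RootSys.I_self_nonneg _)]
  field_simp

lemma hasDerivAt_latSeries {v : ℝ} (hv : 0 < v) :
    HasDerivAt (B.latSeries c) (-B.latSeriesDer c v) v := by
  have h := hasDerivAt_tsum_exp (d := fun γ : scaledLat S c => dFun B γ)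
    (e := fun γ => S.I (weylVec B + γ) (weylVec B + γ) / c)
    (fun γ => div_nonneg (RootSys.I_self_nonneg _) hc0.le)
    (fun u hu => Summable.of_abs ((B.summable_latSeries hθsR hθshigh hmin hc hc0 hu).congr
      fun γ => by rw [abs_mul, Real.abs_exp]))
    (fun u hu => B.summable_latSeriesDer hθsR hθshigh hmin hc hc0 hk hk0 hu) hv
  rwa [tsum_neg] at h

/-- The theta series does not vanish and satisfies a logarithmic differential equation. -/
lemma latSeries_mul_sum {v : ℝ} (hv : 0 < v) : B.latSeries c v ≠ 0 ∧
    B.latSeries c v * ∑ α ∈ B.Pos, thetaLog (S.I α α * v) * S.I (weylVec B) α ^ 2 =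
      k * c / 8 * B.latSeriesDer c v := by
  obtain ⟨M, hM, h1, h2⟩ := B.multi_limits hv
  set P := ∏ α ∈ B.Pos, thetaNull (S.I α α * v) * S.I (weylVec B) α with hP
  have hP0 : 0 < P := Finset.prod_pos fun α hα => mul_pos
    (thetaNull_pos (mul_pos (RootSys.I_self_pos (B.pos_sub hα)) hv)) (B.I_weylVec_pos hα)
  have e1 : ∀ m, ∑ α ∈ B.Pos, S.I α (B.latSum m) ^ 2 / 24 =
      S.I (B.latSum m) (B.latSum m) * (k / 24) := fun m => by
    rw [← Finset.sum_div, mul_div_assoc', mul_comm _ k, ← B.sumOp_quad hk]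
    congr 1
    exact Finset.sum_congr rfl fun α _ => by ring
  simp only [e1] at h2
  rw [B.tsum_multiCoeff_mul hθsR hθshigh hmin hc hc0 (fun a ha y => B.rootProd_refl ha y)
    (B.summable_rootProd hv).of_abs] at h1
  have hs2 := ((B.summable_rootProd_mul hk hk0 hv).of_abs).mul_right (k / 24)
  rw [B.tsum_multiCoeff_mul hθsR hθshigh hmin hc hc0
    (φ := fun y => B.rootProd y * (S.I y y * (k / 24)))
    (fun a ha y => by
      rw [B.rootProd_refl ha, RootSys.I_refl_refl (B.pi_mem_R ha), neg_mul])
    (hs2.congr fun m => by ring)] at h2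
  set K := B.numCosets c * (B.wtCoeff v (weylVec B) *
        Real.exp (v / c * S.I (weylVec B) (weylVec B))) with hK
  have e2 : ∑' γ : scaledLat S c, B.rootProd (weylVec B + γ) *
      Real.exp (-(v * (S.I (weylVec B + γ) (weylVec B + γ) / c))) =
      B.rootProd (weylVec B) * B.latSeries c v := by
    rw [latSeries, ← tsum_mul_left]
    exact tsum_congr fun γ => by rw [rootProd_add]; ring
  have e3 : ∑' γ : scaledLat S c, B.rootProd (weylVec B + γ) *
      (S.I (weylVec B + γ) (weylVec B + γ) * (k / 24)) *
      Real.exp (-(v * (S.I (weylVec B + γ) (weylVec B + γ) / c))) =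
      B.rootProd (weylVec B) * (k * c / 24) * B.latSeriesDer c v := by
    rw [latSeriesDer, ← tsum_mul_left]
    exact tsum_congr fun γ => by rw [rootProd_add]; field_simp
  rw [e2] at h1
  rw [e3] at h2
  have hMP : 0 < M * P := mul_pos hM hP0
  rw [h1] at hMP
  have hF : B.latSeries c v ≠ 0 := by
    intro h; rw [h] at hMP; simp at hMP
  refine ⟨hF, ?_⟩
  have hKp : K * B.rootProd (weylVec B) ≠ 0 := by
    intro h; rw [← mul_assoc, h, zero_mul] at hMP; exact hMP.false
  have e4 : ∑ α ∈ B.Pos, thetaLog (S.I α α * v) / 3 * S.I (weylVec B) α ^ 2 =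
      (∑ α ∈ B.Pos, thetaLog (S.I α α * v) * S.I (weylVec B) α ^ 2) / 3 := by
    rw [Finset.sum_div]
    exact Finset.sum_congr rfl fun α _ => by ring
  rw [e4, ← mul_assoc, h1] at h2
  apply mul_left_cancel₀ hKp
  linear_combination 3 * h2

end

end Base

namespace RootSys

variable {V : Type} [AddCommGroup V] [Module ℝ V] {S : RootSys V}

lemma add_mem_of_I_neg {α β : V} (hα : α ∈ S.R) (hβ : β ∈ S.R) (h : S.I α β < 0) :
    α + β = 0 ∨ α + β ∈ S.R := by
  by_cases h1 : β = -α
  · left; rw [h1, add_neg_cancel]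
  right
  have h2 : β ≠ α := by rintro rfl; linarith [I_self_pos hβ]
  have h3 := I_mul_lt hα hβ h2 h1
  have hpα := I_self_pos hα
  have hpβ := I_self_pos hβ
  obtain ⟨m, hm⟩ := co_int hα hβ
  obtain ⟨n, hn⟩ := co_int hβ hα
  have hm' : (m : ℝ) * S.I α α = 2 * S.I α β := by
    rw [← hm, co_apply]; field_simp
  have hn' : (n : ℝ) * S.I β β = 2 * S.I α β := by
    rw [← hn, co_apply, S.symm β α]; field_simp
  have hm0 : m < 0 := by
    have : (m : ℝ) < 0 := by by_contra! hc; nlinarith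
    exact_mod_cast this
  have hn0 : n < 0 := by
    have : (n : ℝ) < 0 := by by_contra! hc; nlinarith
    exact_mod_cast this
  have h4 : m * n < 4 := by
    have : (m : ℝ) * n < 4 := by
      have h5 : ((m : ℝ) * n) * (S.I α α * S.I β β) = 4 * (S.I α β * S.I α β) := by
        linear_combination (n : ℝ) * S.I β β * hm' + 2 * S.I α β * hn'
      by_contra! hc
      nlinarith [mul_pos hpα hpβ]
    exact_mod_cast this
  have h5 : m = -1 ∨ n = -1 := by
    by_contra! hc
    have : m ≤ -2 := by have := hc.1; omega
    have : n ≤ -2 := by have := hc.2; omega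
    nlinarith
  rcases h5 with h5 | h5
  · have := refl_mem hα hβ
    rwa [refl_apply, hm, h5, Int.cast_neg, Int.cast_one, neg_one_smul, sub_neg_eq_add,
      add_comm] at this
  · have := refl_mem hβ hα
    rwa [refl_apply, hn, h5, Int.cast_neg, Int.cast_one, neg_one_smul, sub_neg_eq_add] at this

/-- A vector of the root lattice whose pairings with all coroots have absolute value at most `1`
vanishes. -/
lemma eq_zero_of_co_lt_two {γ : V} (hγ : γ ∈ rootLat S) (h : ∀ α ∈ S.R, S.co α γ < 2) :
    γ = 0 := by
  have hrep : ∃ L : Multiset V, (∀ x ∈ L, x ∈ S.R) ∧ L.sum = γ := by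
    clear h
    induction hγ using AddSubgroup.closure_induction with
    | mem x hx => exact ⟨{x}, by simpa using hx, by simp⟩
    | zero => exact ⟨0, by simp, by simp⟩
    | add x y _ _ hx hy =>
      obtain ⟨L, hL, rfl⟩ := hx
      obtain ⟨M, hM, rfl⟩ := hy
      refine ⟨L + M, fun x hx => ?_, by simp⟩
      rcases Multiset.mem_add.1 hx with h | h
      exacts [hL x h, hM x h]
    | neg x _ hx =>
      obtain ⟨L, hL, rfl⟩ := hx
      refine ⟨L.map Neg.neg, fun x hx => ?_, by rw [Multiset.sum_map_neg']⟩
      obtain ⟨y, hy, rfl⟩ := Multiset.mem_map.1 hx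
      exact neg_mem (hL y hy)
  obtain ⟨L, hL, hs⟩ := hrep
  induction hn : L.card using Nat.strong_induction_on generalizing L with
  | _ n ih =>
    rcases L.empty_or_exists_mem with rfl | ⟨α, hα⟩
    · simpa using hs.symm
    obtain ⟨M, rfl⟩ := Multiset.exists_cons_of_mem hα
    have hαR := hL α hα
    have h1 : ∃ β ∈ M, S.I α β < 0 := by
      by_contra! hc
      have h2 := h α hαR
      rw [← hs, Multiset.sum_cons, map_add, co_self hαR, co_apply, map_multiset_sum] at h2
      have h3 : 0 ≤ (M.map (S.I α)).sum := Multiset.sum_nonneg fun x hx => by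
        obtain ⟨y, hy, rfl⟩ := Multiset.mem_map.1 hx
        exact hc y hy
      have := I_self_pos hαR
      have : 0 ≤ 2 / S.I α α * (M.map (S.I α)).sum := by positivity
      linarith
    obtain ⟨β, hβ, hneg⟩ := h1
    obtain ⟨N, rfl⟩ := Multiset.exists_cons_of_mem hβ
    have hN : ∀ x ∈ N, x ∈ S.R := fun x hx =>
      hL x (Multiset.mem_cons_of_mem (Multiset.mem_cons_of_mem hx))
    rw [Multiset.sum_cons, Multiset.sum_cons, ← add_assoc] at hs
    rw [Multiset.card_cons, Multiset.card_cons] at hn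
    rcases add_mem_of_I_neg hαR (hL β (Multiset.mem_cons_of_mem hβ)) hneg with h0 | hR
    · exact ih _ (by omega) N hN (by rw [← hs, h0, zero_add]) rfl
    · refine ih (n - 1) (by omega) ((α + β) ::ₘ N) ?_ (by rw [← hs, Multiset.sum_cons])
        (by rw [Multiset.card_cons]; omega)
      intro x hx
      rcases Multiset.mem_cons.1 hx with rfl | hx
      exacts [hR, hN x hx]

end RootSys

namespace Base

variable {V : Type} [AddCommGroup V] [Module ℝ V] {S : RootSys V} (B : Base S)

/-- The Weyl vector is strictly shorter than its other translates by the dilated root lattice. -/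
lemma I_weylVec_lt {c : ℝ} (hc0 : 0 < c)
    (hop : ∀ x, B.sumOp (fun α => 2 / S.I α α) x = c • x) {γ : V} (hγ : γ ∈ rootLat S)
    (h0 : γ ≠ 0) : S.I (weylVec B) (weylVec B) <
      S.I (weylVec B + c • γ) (weylVec B + c • γ) := by
  have h1 : c * S.I γ γ = ∑ α ∈ B.Pos, S.I α α / 2 * S.co α γ ^ 2 := by
    rw [← B.sumOp_quad hop]
    refine Finset.sum_congr rfl fun α hα => ?_
    have := RootSys.I_self_pos (B.pos_sub hα)
    rw [RootSys.co_apply]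
    field_simp
  have h2 : 2 * S.I (weylVec B) γ = ∑ α ∈ B.Pos, S.I α α / 2 * S.co α γ := by
    rw [weylVec, map_smul, map_sum, LinearMap.smul_apply, LinearMap.sum_apply, smul_eq_mul,
      mul_inv_cancel_left₀ two_ne_zero]
    refine Finset.sum_congr rfl fun α hα => ?_
    have := RootSys.I_self_pos (B.pos_sub hα)
    rw [RootSys.co_apply]
    field_simp
  have h3 : S.I (weylVec B + c • γ) (weylVec B + c • γ) - S.I (weylVec B) (weylVec B) =
      c * ∑ α ∈ B.Pos, S.I α α / 2 * (S.co α γ * (S.co α γ + 1)) := by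
    have : ∑ α ∈ B.Pos, S.I α α / 2 * (S.co α γ * (S.co α γ + 1)) =
        c * S.I γ γ + 2 * S.I (weylVec B) γ := by
      rw [h1, h2, ← Finset.sum_add_distrib]
      exact Finset.sum_congr rfl fun α _ => by ring
    rw [this]
    simp only [map_add, map_smul, LinearMap.add_apply, LinearMap.smul_apply, smul_eq_mul]
    rw [S.symm γ (weylVec B)]
    ring
  have hterm : ∀ α ∈ B.Pos, 0 ≤ S.I α α / 2 * (S.co α γ * (S.co α γ + 1)) := fun α hα => by
    obtain ⟨n, hn⟩ := RootSys.co_int_of_mem_rootLat (B.pos_sub hα) hγ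
    rw [hn]
    have hn0 : (0 : ℤ) ≤ n * (n + 1) := by
      rcases le_or_gt 0 n with h | h
      · positivity
      · exact mul_nonneg_of_nonpos_of_nonpos h.le (by omega)
    have : (0 : ℝ) ≤ n * (n + 1) := by exact_mod_cast hn0
    exact mul_nonneg (half_pos (RootSys.I_self_pos (B.pos_sub hα))).le this
  rw [← sub_pos, h3]
  refine mul_pos hc0 (lt_of_le_of_ne (Finset.sum_nonneg hterm) fun he => h0 ?_)
  have hz := (Finset.sum_eq_zero_iff_of_nonneg hterm).1 he.symm
  have hb : ∀ α ∈ B.Pos, -1 ≤ S.co α γ ∧ S.co α γ ≤ 0 := fun α hα => by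
    have h4 := hz α hα
    rw [mul_eq_zero, or_iff_right (half_pos (RootSys.I_self_pos (B.pos_sub hα))).ne',
      mul_eq_zero] at h4
    rcases h4 with h | h
    · rw [h]; norm_num
    · rw [eq_neg_of_add_eq_zero_left h]; norm_num
  refine RootSys.eq_zero_of_co_lt_two hγ fun α hα => ?_
  rcases B.mem_or_neg α hα with h | h
  · linarith [(hb α h).2]
  · have := (hb _ h).1
    rw [RootSys.co_neg] at this
    linarith

end Base

lemma eq_of_hasDerivAt_zero_of_tendsto {G : ℝ → ℝ} {l : ℝ}
    (hG : ∀ v, 0 < v → HasDerivAt G 0 v) (hl : Tendsto G atTop (𝓝 l)) {v : ℝ} (hv : 0 < v) :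
    G v = l := by
  have hc : ∀ w, 0 < w → G w = G v := fun w hw =>
    (convex_Ioi (0 : ℝ)).is_const_of_fderivWithin_eq_zero (𝕜 := ℝ)
      (fun x hx => (hG x hx).differentiableAt.differentiableWithinAt)
      (fun x hx => by
        rw [fderivWithin_of_isOpen isOpen_Ioi hx, (hG x hx).hasFDerivAt.fderiv]
        ext; simp) hw hv
  refine tendsto_nhds_unique (tendsto_const_nhds.congr' ?_) hl
  filter_upwards [eventually_gt_atTop 0] with w hw
  exact (hc w hw).symm

namespace Base

variable {V : Type} [AddCommGroup V] [Module ℝ V] {S : RootSys V} (B : Base S)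
  {θs : V} (hθsR : θs ∈ S.R)
  (hθshigh : ∀ α ∈ S.R, S.I α α = S.I θs θs →
    ∃ c : V → ℕ, θs - α = ∑ b ∈ B.Pi, (c b : ℝ) • b)
  (hmin : ∀ α ∈ S.R, S.I θs θs ≤ S.I α α) {c : ℝ} {h : ℕ}
  (hop : ∀ x, B.sumOp (fun α => 2 / S.I α α) x = c • x)
  (hcount : ∀ g : ℝ → ℝ, 2 * ∑ α ∈ B.Pos, g (S.I α α) = h * ∑ b ∈ B.Pi, g (S.I b b))

lemma pi_nonempty {α : V} (hα : α ∈ S.R) : B.Pi.Nonempty := by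
  rcases B.mem_or_neg α hα with h | h <;> obtain ⟨b, -⟩ := B.exists_coord_pos' h <;>
    exact ⟨b, b.2⟩

include hθsR in
lemma card_pi_pos : (0 : ℝ) < B.Pi.card := by
  exact_mod_cast Finset.card_pos.2 (B.pi_nonempty hθsR)

include hθsR hcount hop in
lemma eq_coxeter : c = h := by
  have h1 := B.sumOp_trace hop
  have h2 := hcount fun _ => 1
  have h3 : ∑ α ∈ B.Pos, 2 / S.I α α * S.I α α = 2 * ∑ α ∈ B.Pos, (1 : ℝ) := by
    rw [Finset.mul_sum]
    refine Finset.sum_congr rfl fun α hα => ?_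
    have := RootSys.I_self_pos (B.pos_sub hα)
    field_simp
  rw [h3, h2] at h1
  simp only [Finset.sum_const, nsmul_eq_mul, mul_one] at h1
  exact mul_right_cancel₀ (B.card_pi_pos hθsR).ne' h1

include hcount in
lemma card_pos_eq : (2 : ℝ) * B.Pos.card = h * B.Pi.card := by
  have h2 := hcount fun _ => 1
  simpa using h2

include hcount in
lemma I_weylVec_self [FiniteDimensional ℝ V] :
    S.I (weylVec B) (weylVec B) = h * (h + 1) / 24 * ∑ b ∈ B.Pi, S.I b b := by
  obtain ⟨k, hk⟩ := B.sumOp_scalar (f := fun _ => 1) (fun α hα β _ => rfl)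
  have h1 := B.strange_formula hk
  have h2 := B.sumOp_trace hk
  have h3 := hcount fun r => r
  have h4 := B.card_pos_eq hcount
  simp only [one_mul] at h2
  rw [h1, h4]
  linear_combination (h + 1 : ℝ) / 12 * h2 + (h + 1 : ℝ) / 24 * h3

include hθsR hθshigh hmin hcount in
lemma hasDerivAt_latSeries_mul [FiniteDimensional ℝ V] (hc : c = 1 + S.co θs (weylVec B)) (hc0 : 0 < c)
    {v : ℝ} (hv : 0 < v) : HasDerivAt (B.latSeries c) (-(B.latSeries c v *
      ((h + 1) / 3 * ∑ b ∈ B.Pi, S.I b b * thetaLog (S.I b b * v)))) v := by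
  have hop := B.sumOp_coroot hθsR hθshigh hmin
  rw [← hc] at hop
  obtain ⟨k, hk⟩ := B.sumOp_scalar (f := fun _ => 1) (fun α hα β _ => rfl)
  obtain ⟨κ, hκ⟩ := B.sumOp_scalar (f := fun α => thetaLog (S.I α α * v))
    (fun α hα β _ => by simp only [RootSys.I_refl_refl hα])
  have hl := B.card_pi_pos hθsR
  have hk1 := B.sumOp_trace hk
  have hk0 : 0 < k := by
    have : 0 < ∑ α ∈ B.Pos, 1 * S.I α α := Finset.sum_pos (fun α hα => by
      rw [one_mul]; exact RootSys.I_self_pos (B.pos_sub hα)) ⟨θs, B.highest_pos hθsR hθshigh⟩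
    rw [← hk1] at this
    exact pos_of_mul_pos_left this hl.le
  have h1 := (B.latSeries_mul_sum hθsR hθshigh hmin hc hc0 hk hk0 hv).2
  have h2 := B.sumOp_quad hκ (weylVec B) (weylVec B)
  have h3 := B.sumOp_trace hκ
  have h4 := hcount fun r => thetaLog (r * v) * r
  have h5 := B.strange_formula hk
  rw [B.card_pos_eq hcount] at h5
  have hce := B.eq_coxeter hθsR hop hcount
  have h8 : ∑ α ∈ B.Pos, thetaLog (S.I α α * v) * S.I (weylVec B) α ^ 2 =
      κ * S.I (weylVec B) (weylVec B) := by
    rw [← h2]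
    exact Finset.sum_congr rfl fun α _ => by rw [pow_two, S.symm (weylVec B)]
  rw [h8, h5] at h1
  have hd := B.hasDerivAt_latSeries hθsR hθshigh hmin hc hc0 hk hk0 hv
  convert hd using 2
  have h6 : ∑ b ∈ B.Pi, S.I b b * thetaLog (S.I b b * v) =
      ∑ b ∈ B.Pi, thetaLog (S.I b b * v) * S.I b b := Finset.sum_congr rfl fun b _ => mul_comm _ _
  rw [h6]
  rw [hce] at h1 hc0 ⊢
  have h7 : κ * B.Pi.card * 2 = h * ∑ b ∈ B.Pi, thetaLog (S.I b b * v) * S.I b b := by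
    rw [h3, ← h4]; ring
  apply mul_left_cancel₀ (mul_pos hk0 hc0).ne'
  linear_combination 8 * h1 - B.latSeries h v * k * (h + 1) / 3 * h7

include hθsR hθshigh hmin hcount in
lemma tendsto_latSeries [FiniteDimensional ℝ V] (hc : c = 1 + S.co θs (weylVec B)) (hc0 : 0 < c) :
    Tendsto (fun v => B.latSeries c v *
      Real.exp (v * ((h + 1) / 24 * ∑ b ∈ B.Pi, S.I b b))) atTop (𝓝 1) := by
  have hop := B.sumOp_coroot hθsR hθshigh hmin
  rw [← hc] at hop
  have hce := B.eq_coxeter hθsR hop hcount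
  have hA : S.I (weylVec B) (weylVec B) / c = (h + 1) / 24 * ∑ b ∈ B.Pi, S.I b b := by
    rw [B.I_weylVec_self hcount, ← hce]
    field_simp
  rw [← hA]
  have hexp : ∀ v x : ℝ, Real.exp (-(v * ((x - S.I (weylVec B) (weylVec B)) / c))) =
      Real.exp (-(v * (x / c))) * Real.exp (v * (S.I (weylVec B) (weylVec B) / c)) :=
    fun v x => by rw [← Real.exp_add]; congr 1; ring
  have h1 := tendsto_tsum_exp_atTop (d := fun γ : scaledLat S c => dFun B γ)
    (e := fun γ => (S.I (weylVec B + γ) (weylVec B + γ) - S.I (weylVec B) (weylVec B)) / c) 0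
    (by
      rintro ⟨_, γ, hγ, rfl⟩ hne
      refine div_pos (sub_pos.2 (B.I_weylVec_lt hc0 hop hγ ?_)) hc0
      rintro rfl
      exact hne (Subtype.ext (smul_zero c)))
    (by simp)
    (by
      simp only [hexp]
      refine ((B.summable_latSeries hθsR hθshigh hmin hc hc0 one_pos).mul_right
        (Real.exp (1 * (S.I (weylVec B) (weylVec B) / c)))).congr fun γ => ?_
      rw [mul_assoc])
  have h2 : dFun B ((0 : scaledLat S c) : V) = 1 := by
    rw [dFun]
    refine Finset.prod_eq_one fun α hα => ?_
    rw [ZeroMemClass.coe_zero, zero_add]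
    exact div_self (B.I_weylVec_pos hα).ne'
  rw [h2] at h1
  refine h1.congr fun v => ?_
  rw [latSeries, ← tsum_mul_right]
  exact tsum_congr fun γ => by rw [hexp, mul_assoc]

include hθsR hθshigh hmin hcount in
theorem latSeries_eq [FiniteDimensional ℝ V] (hc : c = 1 + S.co θs (weylVec B)) (hc0 : 0 < c)
    {v : ℝ} (hv : 0 < v) :
    B.latSeries c v = (∏ b ∈ B.Pi, eta (Real.exp (-(S.I b b * v)))) ^ (h + 1) := by
  have hpos : ∀ w : ℝ, 0 < w → ∀ b ∈ B.Pi, 0 < S.I b b * w := fun w hw b hb =>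
    mul_pos (RootSys.I_self_pos (B.pi_mem_R hb)) hw
  set L : ℝ → ℝ := fun w => -((h + 1) * ∑ b ∈ B.Pi, Real.log (thetaNull (S.I b b * w))) with hL
  have hLd : ∀ w, 0 < w → HasDerivAt L
      ((h + 1) * ∑ b ∈ B.Pi, S.I b b * thetaLog (S.I b b * w)) w := fun w hw => by
    have := ((HasDerivAt.fun_sum (u := B.Pi) (x := w)
      (A := fun b w => Real.log (thetaNull (S.I b b * w))) fun b hb =>
      ((hasDerivAt_thetaNull (hpos w hw b hb)).comp w
        ((hasDerivAt_id w).const_mul (S.I b b))).log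
          (thetaNull_pos (hpos w hw b hb)).ne').const_mul ((h : ℝ) + 1)).neg
    refine this.congr_deriv ?_
    rw [← mul_neg, ← Finset.sum_neg_distrib]
    congr 1
    refine Finset.sum_congr rfl fun b hb => ?_
    have := thetaNull_pos (hpos w hw b hb)
    simp only [Function.comp_apply]
    field_simp
  have hG : ∀ w, 0 < w → HasDerivAt (fun w => B.latSeries c w ^ 3 * Real.exp (L w)) 0 w :=
    fun w hw => by
      refine (((B.hasDerivAt_latSeries_mul hθsR hθshigh hmin hcount hc hc0 hw).pow 3).mul
        (hLd w hw).exp).congr_deriv ?_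
      simp only [Pi.pow_apply]
      push_cast
      ring
  have hlim : Tendsto (fun w => B.latSeries c w ^ 3 * Real.exp (L w)) atTop (𝓝 1) := by
    have h1 := (B.tendsto_latSeries hθsR hθshigh hmin hcount hc hc0).pow 3
    have h2 : Tendsto (fun w => (∏ b ∈ B.Pi,
        (thetaNull (S.I b b * w) * Real.exp (S.I b b * w / 8))) ^ (h + 1)) atTop (𝓝 1) := by
      have := (tendsto_finsetProd (f := fun b w => thetaNull (S.I b b * w) *
        Real.exp (S.I b b * w / 8)) (a := fun _ => (1 : ℝ)) B.Pi fun b hb =>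
        tendsto_thetaNull_atTop.comp (tendsto_id.const_mul_atTop
          (RootSys.I_self_pos (B.pi_mem_R hb)))).pow (h + 1)
      simpa using this
    have h3 := h1.div h2 one_ne_zero
    rw [one_pow, div_one] at h3
    refine h3.congr' ?_
    filter_upwards [eventually_gt_atTop 0] with w hw
    have hP : 0 < ∏ b ∈ B.Pi, thetaNull (S.I b b * w) :=
      Finset.prod_pos fun b hb => thetaNull_pos (hpos w hw b hb)
    have h4 : Real.exp (L w) = ((∏ b ∈ B.Pi, thetaNull (S.I b b * w)) ^ (h + 1))⁻¹ := by
      rw [hL]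
      simp only
      rw [Real.exp_neg, ← Nat.cast_add_one, Real.exp_nat_mul, Real.exp_sum]
      congr 2
      exact Finset.prod_congr rfl fun b hb => Real.exp_log (thetaNull_pos (hpos w hw b hb))
    have h5 : (∏ b ∈ B.Pi, Real.exp (S.I b b * w / 8)) ^ (h + 1) =
        Real.exp (w * ((h + 1) / 24 * ∑ b ∈ B.Pi, S.I b b)) ^ 3 := by
      rw [← Real.exp_sum, ← Real.exp_nat_mul, ← Real.exp_nat_mul, ← Finset.sum_div,
        ← Finset.sum_mul]
      congr 1
      push_cast
      ring
    simp only [Pi.div_apply]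
    rw [h4, Finset.prod_mul_distrib, mul_pow, mul_pow, h5]
    have := Real.exp_pos (w * ((h + 1) / 24 * ∑ b ∈ B.Pi, S.I b b))
    field_simp
  have h1 := eq_of_hasDerivAt_zero_of_tendsto hG hlim hv
  have h4 : Real.exp (L v) = (((∏ b ∈ B.Pi, eta (Real.exp (-(S.I b b * v)))) ^ (h + 1)) ^ 3)⁻¹ := by
    rw [hL]
    simp only
    rw [Real.exp_neg, ← Nat.cast_add_one, Real.exp_nat_mul, Real.exp_sum, pow_right_comm _ (h + 1) 3,
      ← Finset.prod_pow B.Pi 3]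
    congr 2
    refine Finset.prod_congr rfl fun b hb => ?_
    rw [eta_cube (hpos v hv b hb), Real.exp_log (thetaNull_pos (hpos v hv b hb))]
  have hE : 0 < (∏ b ∈ B.Pi, eta (Real.exp (-(S.I b b * v)))) ^ (h + 1) :=
    pow_pos (Finset.prod_pos fun b hb => eta_pos (hpos v hv b hb)) _
  rw [h4, mul_inv_eq_one₀ (pow_pos hE 3).ne'] at h1
  exact (Odd.strictMono_pow (by decide : Odd 3)).injective h1

end Base

/-- **Macdonald identity, twisted case, not of type `BC_l^{(2)}`.** -/
theorem macdonald_twisted (V : Type) [AddCommGroup V] [Module ℝ V]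
    [FiniteDimensional ℝ V]
    (S : RootSys V) (B : Base S)
    -- θ is the highest root
    (θ : V) (hθR : θ ∈ S.R)
    (hθhigh : ∀ α ∈ S.R, ∃ c : V → ℕ, θ - α = ∑ b ∈ B.Pi, (c b : ℝ) • b)
    -- θs is the highest short root; R_f has two root lengths
    (θs : V) (hθsR : θs ∈ S.R)
    (htwo : ∀ α ∈ S.R, S.I α α = S.I θs θs ∨ S.I α α = S.I θ θ)
    (hne : S.I θs θs ≠ S.I θ θ)
    (hθshigh : ∀ α ∈ S.R, S.I α α = S.I θs θs →
      ∃ c : V → ℕ, θs - α = ∑ b ∈ B.Pi, (c b : ℝ) • b)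
    -- the tier number t = I(θ,θ)/I(θs,θs) ∈ {2,3}
    (t : ℝ) (htdef : t = S.I θ θ / S.I θs θs) (ht : t = 2 ∨ t = 3)
    -- the Coxeter number h: the order of a Coxeter element of W(R_f)
    (cx : V ≃ₗ[ℝ] V) (lst : List V) (hnd : lst.Nodup) (hset : lst.toFinset = B.Pi)
    (hcx : ∀ x : V, cx x = lst.foldl (fun y α => y - (2 * S.I α y / S.I α α) • α) x)
    (h : ℕ) (hh : h = orderOf cx)
    -- the dual Coxeter number of the twisted affine root system
    (hvt : ℝ) (hhvt : hvt = 1 + S.I (weylVec B) ((2 / S.I θs θs) • θs))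
    (q : ℝ) (hq0 : 0 < q) (hq1 : q < 1) :
    Summable (fun γ : {x : V // ∃ y ∈ rootLat S, x = hvt • y} =>
      |dFun B γ.1 * q ^ (2 / S.I θs θs *
        (S.I (weylVec B + γ.1) (weylVec B + γ.1) / (2 * hvt)))|) ∧
    (eta q ^ (B.Pi.filter (fun b => S.I b b = S.I θs θs)).card *
       eta (q ^ t) ^ (B.Pi.filter (fun b => S.I b b = S.I θ θ)).card) ^ (h + 1) =
      ∑' γ : {x : V // ∃ y ∈ rootLat S, x = hvt • y},
        dFun B γ.1 * q ^ (2 / S.I θs θs *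
          (S.I (weylVec B + γ.1) (weylVec B + γ.1) / (2 * hvt))) := by
  have hr := RootSys.I_self_pos hθsR
  have hθ : S.I θ θ = t * S.I θs θs := by rw [htdef]; field_simp
  have hmin : ∀ α ∈ S.R, S.I θs θs ≤ S.I α α := fun α hα => by
    rcases htwo α hα with h1 | h1
    · exact h1.ge
    · rw [h1, hθ]
      rcases ht with rfl | rfl <;> linarith
  have hc : hvt = 1 + S.co θs (weylVec B) := by
    rw [hhvt, RootSys.co_apply, map_smul, smul_eq_mul, S.symm θs (weylVec B)]
  have hc0 : 0 < hvt := by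
    have h1 := B.I_weylVec_pos (B.highest_pos hθsR hθshigh)
    rw [hhvt, map_smul, smul_eq_mul]
    positivity
  have hcount := B.coxeter_count ⟨θs, hθsR, θ, hθR, hne⟩ cx lst hnd hset
    fun x => by rw [hcx, RootSys.word_foldl]
  rw [← hh] at hcount
  set v := -Real.log q / S.I θs θs with hv
  have hv0 : 0 < v := div_pos (neg_pos.2 (Real.log_neg hq0 hq1)) hr
  have hrv : S.I θs θs * v = -Real.log q := by rw [hv]; field_simp
  have hexp : ∀ x : ℝ, q ^ (2 / S.I θs θs * (x / (2 * hvt))) = Real.exp (-(v * (x / hvt))) :=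
    fun x => by
      rw [Real.rpow_def_of_pos hq0]
      congr 1
      rw [hv]
      field_simp
  have hshort : Real.exp (-(S.I θs θs * v)) = q := by
    rw [hrv, neg_neg, Real.exp_log hq0]
  have hlong : Real.exp (-(S.I θ θ * v)) = q ^ t := by
    rw [hθ, mul_assoc, hrv, Real.rpow_def_of_pos hq0]
    congr 1
    ring
  simp only [hexp]
  refine ⟨?_, ?_⟩
  · refine (B.summable_latSeries hθsR hθshigh hmin hc hc0 hv0).congr fun γ => ?_
    rw [abs_mul, Real.abs_exp]
  · have hprod : eta q ^ (B.Pi.filter (fun b => S.I b b = S.I θs θs)).card *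
        eta (q ^ t) ^ (B.Pi.filter (fun b => S.I b b = S.I θ θ)).card =
        ∏ b ∈ B.Pi, eta (Real.exp (-(S.I b b * v))) := by
      rw [← Finset.prod_filter_mul_prod_filter_not B.Pi fun b => S.I b b = S.I θs θs]
      have hf : B.Pi.filter (fun b => S.I b b = S.I θ θ) =
          B.Pi.filter (fun b => ¬S.I b b = S.I θs θs) :=
        Finset.filter_congr fun b hb => ⟨fun h1 h2 => hne (h2.symm.trans h1),
          fun h1 => (htwo b (B.pi_mem_R hb)).resolve_left h1⟩
      rw [← hf]
      congr 1
      · rw [Finset.prod_eq_pow_card]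
        intro b hb
        rw [(Finset.mem_filter.1 hb).2, hshort]
      · rw [Finset.prod_eq_pow_card]
        intro b hb
        rw [(Finset.mem_filter.1 hb).2, hlong]
    rw [hprod]
    exact (B.latSeries_eq hθsR hθshigh hmin hcount hc hc0 hv0).symm
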